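/- arXiv:2112.10111 — 8 statements merged into one kernel-verified Lean document; each statement's English description precedes it below -/
import Mathlib

section
/- Let G be a countable group that is linear sofic (i.e., κ-linear sofic for some κ > 0). Then G is 1/2-linear sofic. -/
open Matrix

/-- A group `G` is `κ`-linear sofic over the field `F` if for every finite subset `S ⊆ G`,
every `δ > 0` and every `κ' < κ`, there exist `d ≥ 1` and a map `φ` from `G` into
`GL_d(F)` such that `ρ_d(φ(gh), φ(g)φ(h)) < δ` whenever `g, h, gh ∈ S`, and
`ρ_d(φ(g), Id) ≥ κ'` for every `g ∈ S` with `g ≠ 1`, where `ρ_d(A,B) = rank(A - B)/d`. -/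
def IsLinearSofic (F : Type*) [Field F] (G : Type*) [Group G] (κ : ℝ) : Prop :=
  ∀ S : Finset G, ∀ δ : ℝ, 0 < δ → ∀ κ' : ℝ, κ' < κ →
    ∃ d : ℕ, 0 < d ∧ ∃ φ : G → GL (Fin d) F,
      (∀ g ∈ S, ∀ h ∈ S, g * h ∈ S →
        (((φ (g * h) : Matrix (Fin d) (Fin d) F) -
          (φ g : Matrix (Fin d) (Fin d) F) * (φ h : Matrix (Fin d) (Fin d) F)).rank : ℝ)
            < δ * d) ∧
      (∀ g ∈ S, g ≠ 1 →
        κ' * d ≤ (((φ g : Matrix (Fin d) (Fin d) F) - 1).rank : ℝ))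

open scoped Kronecker

section Helpers

variable {F : Type*} [Field F]

theorem aux_normal_form {m : Type*} [Fintype m] [DecidableEq m] (M : Matrix m m F) :
    ∃ (P Q : (Matrix m m F)ˣ) (w : m → F), M = P.val * diagonal w * Q.val := by
  classical
  obtain ⟨V, U, e, hV, hU, h⟩ := exists_rank_normal_form M
  obtain ⟨V, rfl⟩ := hV
  obtain ⟨U, rfl⟩ := hU
  rw [← diagonal_one, ← diagonal_zero, fromBlocks_diagonal, submatrix_diagonal_equiv] at h
  refine ⟨V⁻¹, U⁻¹, ((fun _ => 1) ⊕ᵥ fun _ => 0) ∘ e, ?_⟩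
  rw [← h]
  simp [Matrix.mul_assoc]

theorem aux_rank_unit_mul {m : Type*} [Fintype m] [DecidableEq m] (P : (Matrix m m F)ˣ)
    (M : Matrix m m F) : (P.val * M).rank = M.rank :=
  rank_mul_eq_right_of_isUnit_det _ _ ((isUnit_iff_isUnit_det _).1 P.isUnit)

theorem aux_rank_mul_unit {m : Type*} [Fintype m] [DecidableEq m] (P : (Matrix m m F)ˣ)
    (M : Matrix m m F) : (M * P.val).rank = M.rank :=
  rank_mul_eq_left_of_isUnit_det _ _ ((isUnit_iff_isUnit_det _).1 P.isUnit)

theorem aux_rank_kronecker {m n : Type*} [Fintype m] [DecidableEq m] [Fintype n] [DecidableEq n]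
    (M : Matrix m m F) (N : Matrix n n F) : (M ⊗ₖ N).rank = M.rank * N.rank := by
  classical
  obtain ⟨P, Q, w, rfl⟩ := aux_normal_form M
  obtain ⟨P', Q', w', rfl⟩ := aux_normal_form N
  rw [mul_kronecker_mul, mul_kronecker_mul]
  have h1 : IsUnit (P.val ⊗ₖ P'.val) := Matrix.IsUnit.kronecker P.isUnit P'.isUnit
  have h2 : IsUnit (Q.val ⊗ₖ Q'.val) := Matrix.IsUnit.kronecker Q.isUnit Q'.isUnit
  obtain ⟨u, hu⟩ := h1
  obtain ⟨v, hv⟩ := h2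
  rw [← hu, ← hv]
  simp only [aux_rank_mul_unit, aux_rank_unit_mul]
  rw [diagonal_kronecker_diagonal, rank_diagonal, rank_diagonal, rank_diagonal,
    ← Fintype.card_prod]
  refine Fintype.card_congr ⟨fun x => (⟨x.1.1, left_ne_zero_of_mul x.2⟩,
    ⟨x.1.2, right_ne_zero_of_mul x.2⟩), fun x => ⟨(x.1.1, x.2.1), mul_ne_zero x.1.2 x.2.2⟩,
    fun _ => rfl, fun _ => rfl⟩

theorem aux_left_annihilator {m : Type*} [Fintype m] [DecidableEq m] (M : Matrix m m F) :
    ∃ L : Matrix m m F, L * M = 0 ∧ L.rank + M.rank = Fintype.card m := by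
  classical
  obtain ⟨P, Q, w, rfl⟩ := aux_normal_form M
  refine ⟨diagonal (fun i => if w i = 0 then 1 else 0) * (P⁻¹).val, ?_, ?_⟩
  · have : diagonal (fun i => if w i = 0 then (1 : F) else 0) * diagonal w = 0 := by
      rw [diagonal_mul_diagonal, ← diagonal_zero]
      congr 1
      funext i
      by_cases h : w i = 0 <;> simp [h]
    calc _ = diagonal (fun i => if w i = 0 then (1 : F) else 0) * ((P⁻¹).val * P.val)
          * diagonal w * Q.val := by simp only [Matrix.mul_assoc]
      _ = 0 := by rw [Units.inv_mul, Matrix.mul_one, this, Matrix.zero_mul]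
  · rw [aux_rank_mul_unit, aux_rank_mul_unit, aux_rank_unit_mul, rank_diagonal, rank_diagonal]
    have := Fintype.card_subtype_compl (fun i => w i = 0)
    have h2 := Fintype.card_subtype_le (fun i => w i = 0)
    simp at *
    omega

theorem aux_right_annihilator {m : Type*} [Fintype m] [DecidableEq m] (M : Matrix m m F) :
    ∃ R : Matrix m m F, M * R = 0 ∧ R.rank + M.rank = Fintype.card m := by
  obtain ⟨L, h1, h2⟩ := aux_left_annihilator Mᵀ
  refine ⟨Lᵀ, ?_, by simpa using h2⟩
  have := congrArg transpose h1
  simpa using this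

/-- Frobenius inequality in a special case. -/
theorem aux_frobenius {m : Type*} [Fintype m] [DecidableEq m] (L T R : Matrix m m F)
    (h : L * T * R = 0) : (L * T).rank + (T * R).rank ≤ T.rank := by
  have key := LinearMap.finrank_range_add_finrank_ker (L.mulVecLin.domRestrict T.mulVecLin.range)
  have h1 : (L.mulVecLin.domRestrict T.mulVecLin.range).range = (L * T).mulVecLin.range := by
    rw [LinearMap.range_domRestrict, mulVecLin_mul, LinearMap.range_comp]
  have h2 : (T * R).rank ≤
      Module.finrank F (L.mulVecLin.domRestrict T.mulVecLin.range).ker := by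
    unfold Matrix.rank
    have hle : (T * R).mulVecLin.range ≤ T.mulVecLin.range := by
      rw [mulVecLin_mul]; exact LinearMap.range_comp_le_range _ _
    rw [← (Submodule.comapSubtypeEquivOfLe hle).finrank_eq]
    apply Submodule.finrank_mono
    rintro ⟨x, hx⟩ hx'
    obtain ⟨y, hy⟩ : x ∈ (T * R).mulVecLin.range := hx'
    rw [LinearMap.mem_ker, LinearMap.domRestrict_apply]
    simp only [← hy, mulVecLin_apply, mulVec_mulVec]
    rw [← Matrix.mul_assoc, h, zero_mulVec]
  rw [h1] at key
  unfold Matrix.rank at *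
  omega

theorem aux_rank_add_le {m : Type*} [Fintype m] (A B : Matrix m m F) :
    (A + B).rank ≤ A.rank + B.rank := by
  unfold Matrix.rank
  rw [mulVecLin_add]
  refine (Submodule.finrank_mono ?_).trans (Submodule.finrank_add_le_finrank_add_finrank _ _)
  rintro _ ⟨y, rfl⟩
  exact Submodule.add_mem_sup ⟨y, rfl⟩ ⟨y, rfl⟩

/-- The key estimate: rank distance to the identity of a tensor product. -/
theorem aux_key {m n : Type*} [Fintype m] [DecidableEq m] [Fintype n] [DecidableEq n]
    (A : Matrix m m F) (B : Matrix n n F) :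
    (Fintype.card m - (A - 1).rank : ℝ) * (B - 1).rank
      + (A - 1).rank * (Fintype.card n - (B - 1).rank : ℝ) ≤ (A ⊗ₖ B - 1).rank := by
  obtain ⟨L, hL, hL'⟩ := aux_left_annihilator (A - 1)
  obtain ⟨R, hR, hR'⟩ := aux_right_annihilator (B - 1)
  have hT : A ⊗ₖ B - 1 = (A - 1) ⊗ₖ B + 1 ⊗ₖ (B - 1) := by
    ext ⟨i, j⟩ ⟨i', j'⟩
    rw [← one_kronecker_one]
    simp only [Matrix.add_apply, Matrix.sub_apply, kroneckerMap_apply]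
    ring
  have h1 : (L ⊗ₖ (1 : Matrix n n F)) * (A ⊗ₖ B - 1) = L ⊗ₖ (B - 1) := by
    rw [hT, Matrix.mul_add, ← mul_kronecker_mul, ← mul_kronecker_mul, hL, zero_kronecker]
    simp
  have hBR : B * R = R := by
    rw [Matrix.sub_mul, Matrix.one_mul, sub_eq_zero] at hR
    exact hR
  have h2 : (A ⊗ₖ B - 1) * ((1 : Matrix m m F) ⊗ₖ R) = (A - 1) ⊗ₖ R := by
    rw [hT, Matrix.add_mul, ← mul_kronecker_mul, ← mul_kronecker_mul, hR, kronecker_zero, hBR]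
    simp
  have h3 := aux_frobenius (L ⊗ₖ (1 : Matrix n n F)) (A ⊗ₖ B - 1) ((1 : Matrix m m F) ⊗ₖ R) (by
    rw [h1, ← mul_kronecker_mul, hR, kronecker_zero])
  rw [h1, h2, aux_rank_kronecker, aux_rank_kronecker] at h3
  rw [← hL', ← hR']
  push_cast
  have h4 : (L.rank : ℝ) * (B - 1).rank + (A - 1).rank * R.rank ≤ (A ⊗ₖ B - 1).rank := by
    exact_mod_cast h3
  linarith

theorem aux_rank_kronecker_sub {m n : Type*} [Fintype m] [DecidableEq m] [Fintype n]
    [DecidableEq n] (A A' : Matrix m m F) (B B' : Matrix n n F) :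
    (A ⊗ₖ B - A' ⊗ₖ B').rank ≤
      (A - A').rank * Fintype.card n + Fintype.card m * (B - B').rank := by
  have hT : A ⊗ₖ B - A' ⊗ₖ B' = (A - A') ⊗ₖ B + A' ⊗ₖ (B - B') := by
    ext ⟨i, j⟩ ⟨i', j'⟩
    simp only [Matrix.add_apply, Matrix.sub_apply, kroneckerMap_apply]
    ring
  rw [hT]
  refine (aux_rank_add_le _ _).trans ?_
  rw [aux_rank_kronecker, aux_rank_kronecker]
  gcongr
  · exact rank_le_card_width _
  · exact rank_le_card_width _

theorem aux_rank_block {m : Type*} [Fintype m] [DecidableEq m] (X : Matrix m m F) :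
    (fromBlocks X 0 0 (0 : Matrix m m F)).rank = X.rank := by
  apply le_antisymm
  · have : fromBlocks X 0 0 (0 : Matrix m m F)
        = fromRows (1 : Matrix m m F) (0 : Matrix m m F) *
          (X * fromCols (1 : Matrix m m F) (0 : Matrix m m F)) := by
      rw [mul_fromCols, fromRows_mul_fromCols]
      simp
    rw [this]
    exact (rank_mul_le_right _ _).trans (rank_mul_le_left _ _)
  · have : X = (fromBlocks X 0 0 (0 : Matrix m m F)).submatrix Sum.inl Sum.inl := by
      ext i j; simp
    conv_lhs => rw [this]
    exact rank_submatrix_le _ _ _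

/-- Approximation data over an arbitrary finite index type. -/
def AuxApprox (F : Type*) [Field F] {G : Type*} [Group G] (S : Finset G) (δ κ : ℝ) : Prop :=
  ∃ (ι : Type) (_ : Fintype ι) (_ : DecidableEq ι) (_ : Nonempty ι) (φ : G → (Matrix ι ι F)ˣ),
    (∀ g ∈ S, ∀ h ∈ S, g * h ∈ S →
      (((φ (g * h)).val - (φ g).val * (φ h).val).rank : ℝ) ≤ δ * Fintype.card ι) ∧
    (∀ g ∈ S, g ≠ 1 → κ * Fintype.card ι ≤ (((φ g).val - 1).rank : ℝ))

theorem aux_step {G : Type*} [Group G] (S : Finset G) (δ κ : ℝ) (hκ : κ ≤ 1)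
    {d : ℕ} (hd : 0 < d) (φ : G → GL (Fin d) F)
    (hA : ∀ g ∈ S, ∀ h ∈ S, g * h ∈ S →
        (((φ (g * h) : Matrix (Fin d) (Fin d) F) -
          (φ g : Matrix (Fin d) (Fin d) F) * (φ h : Matrix (Fin d) (Fin d) F)).rank : ℝ)
            < δ * d)
    (hD : ∀ g ∈ S, g ≠ 1 →
        κ * d ≤ (((φ g : Matrix (Fin d) (Fin d) F) - 1).rank : ℝ)) (k : ℕ) :
    AuxApprox F S (k * δ) (1 / 2 - (1 - κ) ^ k / 2) := by
  induction k with
  | zero =>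
    refine ⟨Unit, inferInstance, inferInstance, inferInstance, fun _ => 1, ?_, ?_⟩
    · intro g _ h _ _
      simp
    · intro g _ _
      simp
  | succ k ih =>
    obtain ⟨ι, _, _, _, ψ, hψA, hψD⟩ := ih
    set β : G → Matrix (Fin d ⊕ Fin d) (Fin d ⊕ Fin d) F :=
      fun g => fromBlocks (φ g).val 0 0 1 with hβ
    have hβu : ∀ g, IsUnit (β g) := fun g => by
      rw [isUnit_iff_isUnit_det, hβ, det_fromBlocks_zero₂₁]
      simpa using (isUnit_iff_isUnit_det _).1 (φ g).isUnit
    have hβ1 : ∀ g, (β g - 1).rank = ((φ g).val - 1).rank := fun g => by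
      rw [← aux_rank_block ((φ g).val - 1)]
      congr 1
      rw [hβ]
      ext (i | i) (j | j) <;> simp [Matrix.one_apply]
    have hβ2 : ∀ g h, (β (g * h) - β g * β h).rank
        = ((φ (g * h)).val - (φ g).val * (φ h).val).rank := fun g h => by
      rw [← aux_rank_block ((φ (g * h)).val - (φ g).val * (φ h).val)]
      congr 1
      simp only [hβ, fromBlocks_multiply]
      ext (i | i) (j | j) <;> simp
    have hu : ∀ g, IsUnit ((ψ g).val ⊗ₖ β g) := fun g =>
      Matrix.IsUnit.kronecker (ψ g).isUnit (hβu g)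
    have hcard : (Fintype.card (Fin d ⊕ Fin d) : ℝ) = 2 * d := by simp; ring
    have hdpos : (0 : ℝ) < d := by exact_mod_cast hd
    have hN : (0 : ℝ) < Fintype.card ι := by exact_mod_cast Fintype.card_pos
    refine ⟨ι × (Fin d ⊕ Fin d), inferInstance, inferInstance,
      ⟨(Classical.arbitrary ι, Sum.inl ⟨0, hd⟩)⟩, fun g => (hu g).unit, ?_, ?_⟩
    · intro g hg h hh hgh
      simp only [IsUnit.unit_spec]
      rw [← mul_kronecker_mul]
      have h1 := aux_rank_kronecker_sub (ψ (g * h)).val ((ψ g).val * (ψ h).val)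
        (β (g * h)) (β g * β h)
      rw [hβ2] at h1
      have h2 := hψA g hg h hh hgh
      have h3 := hA g hg h hh hgh
      have h1' : ((((ψ (g * h)).val ⊗ₖ β (g * h) -
          ((ψ g).val * (ψ h).val) ⊗ₖ (β g * β h)).rank : ℕ) : ℝ) ≤
          (((ψ (g * h)).val - (ψ g).val * (ψ h).val).rank : ℝ) * (2 * d) +
          Fintype.card ι * (((φ (g * h)).val - (φ g).val * (φ h).val).rank : ℝ) := by
        rw [← hcard]; exact_mod_cast h1
      rw [Fintype.card_prod, Nat.cast_mul, hcard]
      push_cast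
      have h0 : (0 : ℝ) ≤ (((φ (g * h)).val - (φ g).val * (φ h).val).rank : ℝ) :=
        Nat.cast_nonneg _
      have h4 := mul_le_mul_of_nonneg_right h2 (by positivity : (0 : ℝ) ≤ 2 * d)
      have h5 := mul_le_mul_of_nonneg_left h3.le hN.le
      have h6 : 0 ≤ (Fintype.card ι : ℝ) * (δ * d) := mul_nonneg hN.le (h0.trans h3.le)
      linarith
    · intro g hg hg1
      simp only [IsUnit.unit_spec]
      have h1 := aux_key (ψ g).val (β g)
      rw [hβ1, hcard] at h1
      have h2 := hψD g hg hg1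
      have h3 := hD g hg hg1
      have h4 : (((φ g).val - 1).rank : ℝ) ≤ d := by
        exact_mod_cast (rank_le_card_width _).trans (by simp)
      rw [Fintype.card_prod, Nat.cast_mul, hcard, pow_succ]
      set r : ℝ := (((φ g).val - 1).rank : ℝ)
      set R : ℝ := (((ψ g).val - 1).rank : ℝ)
      set N : ℝ := (Fintype.card ι : ℝ)
      have hq : 0 ≤ (1 - κ) ^ k := pow_nonneg (by linarith) _
      set q := (1 - κ) ^ k
      have h5 := mul_le_mul_of_nonneg_right h2 (by linarith : (0 : ℝ) ≤ 2 * d - 2 * r)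
      have h6 := mul_le_mul_of_nonneg_left h3 (mul_nonneg hq hN.le)
      linarith

theorem aux_reindex {G : Type*} [Group G] (S : Finset G) (δ δ' κ : ℝ) (hδ : δ < δ')
    (h : AuxApprox F S δ κ) : ∃ d : ℕ, 0 < d ∧ ∃ φ : G → GL (Fin d) F,
      (∀ g ∈ S, ∀ h ∈ S, g * h ∈ S →
        (((φ (g * h) : Matrix (Fin d) (Fin d) F) -
          (φ g : Matrix (Fin d) (Fin d) F) * (φ h : Matrix (Fin d) (Fin d) F)).rank : ℝ)
            < δ' * d) ∧
      (∀ g ∈ S, g ≠ 1 →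
        κ * d ≤ (((φ g : Matrix (Fin d) (Fin d) F) - 1).rank : ℝ)) := by
  obtain ⟨ι, _, _, _, ψ, hψA, hψD⟩ := h
  have hN : (0 : ℝ) < Fintype.card ι := by exact_mod_cast Fintype.card_pos
  let e := (Fintype.equivFin ι)
  let E := reindexAlgEquiv F F e
  have hE : ∀ X, (E X).rank = X.rank := fun X => rank_reindex e e X
  refine ⟨Fintype.card ι, Fintype.card_pos, fun g => Units.map E.toMulEquiv.toMonoidHom (ψ g),
    ?_, ?_⟩
  · intro g hg h hh hgh
    have h2 := hψA g hg h hh hgh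
    have h3 : δ * Fintype.card ι < δ' * Fintype.card ι := mul_lt_mul_of_pos_right hδ hN
    refine lt_of_le_of_lt (le_trans (le_of_eq ?_) h2) h3
    rw [← hE, map_sub, map_mul]
    rfl
  · intro g hg hg1
    refine (hψD g hg hg1).trans (le_of_eq ?_)
    rw [← hE, map_sub, map_one]
    rfl

end Helpers

/-- Every countable linear sofic group is `1/2`-linear sofic. -/
theorem linearSofic_imp_half_linearSofic
    (G : Type*) [Group G] [Countable G]

    (h : ∃ κ : ℝ, 0 < κ ∧ IsLinearSofic ℂ G κ) :
    IsLinearSofic ℂ G (1 / 2) := by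
  obtain ⟨κ, hκ, hG⟩ := h
  intro S δ hδ κ' hκ'
  have hc0 : 0 < min κ 1 / 2 := by positivity
  have hc1 : min κ 1 / 2 < κ := by
    have := min_le_left κ 1
    linarith
  have hc2 : min κ 1 / 2 ≤ 1 := by
    have := min_le_right κ 1
    linarith
  set c := min κ 1 / 2
  obtain ⟨k, hk⟩ := exists_pow_lt_of_lt_one (show 0 < 1 - 2 * κ' by linarith)
    (show 1 - c < 1 by linarith)
  obtain ⟨d, hd, φ, hA, hD⟩ := hG S (δ / (k + 1)) (by positivity) c hc1
  have h1 := aux_step S (δ / (k + 1)) c hc2 hd φ hA hD k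
  have h2 : (k : ℝ) * (δ / (k + 1)) < δ := by
    rw [← mul_div_assoc, div_lt_iff₀ (by positivity)]
    linarith
  obtain ⟨d', hd', φ', hA', hD'⟩ := aux_reindex S _ δ _ h2 h1
  refine ⟨d', hd', φ', hA', fun g hg hg1 => le_trans ?_ (hD' g hg hg1)⟩
  apply mul_le_mul_of_nonneg_right _ (Nat.cast_nonneg _)
  linarith
end

section
/- Let F be a field of characteristic p and let G be a finite group such that p is the smallest prime dividing the order of G. Then G is (1 − 1/p)-linear sofic over F, and for every κ with 1 − 1/p < κ ≤ 1, G is not κ-linear sofic over F. -/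
open Matrix

theorem rank_add_le_aux {F : Type*} [Field F] {n : ℕ} (A B : Matrix (Fin n) (Fin n) F) :
    (A + B).rank ≤ A.rank + B.rank := by
  unfold Matrix.rank
  rw [Matrix.mulVecLin_add]
  refine le_trans (Submodule.finrank_mono (t := LinearMap.range A.mulVecLin ⊔ LinearMap.range B.mulVecLin) ?_)
    (Submodule.finrank_add_le_finrank_add_finrank _ _)
  rintro _ ⟨x, rfl⟩
  exact Submodule.add_mem_sup ⟨x, rfl⟩ ⟨x, rfl⟩

theorem sylvester_aux {F : Type*} [Field F] {n : ℕ} (A B : Matrix (Fin n) (Fin n) F) :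
    A.rank + B.rank ≤ (A * B).rank + n := by
  unfold Matrix.rank
  have h1 := LinearMap.finrank_range_add_finrank_ker A.mulVecLin
  have h2 := LinearMap.finrank_range_add_finrank_ker
    (A.mulVecLin.domRestrict (LinearMap.range B.mulVecLin))
  have h3 : LinearMap.range (A.mulVecLin.domRestrict (LinearMap.range B.mulVecLin)) =
      LinearMap.range (A * B).mulVecLin := by
    rw [Matrix.mulVecLin_mul, LinearMap.range_comp, LinearMap.range_domRestrict]
  have h4 : Module.finrank F
      (LinearMap.ker (A.mulVecLin.domRestrict (LinearMap.range B.mulVecLin))) ≤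
      Module.finrank F (LinearMap.ker A.mulVecLin) := by
    rw [LinearMap.ker_domRestrict]
    refine LinearMap.finrank_le_finrank_of_injective
      (f := ((LinearMap.range B.mulVecLin).subtype.comp
        (Submodule.subtype _)).codRestrict _ (fun x => x.2)) ?_
    intro x y h
    have := congrArg Subtype.val h
    exact Subtype.ext (Subtype.ext this)
  rw [h3] at h2
  simp only [Module.finrank_fin_fun] at h1
  omega

theorem rank_pow_aux {F : Type*} [Field F] {n : ℕ} (A : Matrix (Fin n) (Fin n) F) (k : ℕ) :
    k * A.rank + n ≤ (A ^ k).rank + k * n := by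
  induction k with
  | zero => simp [Matrix.rank_one]
  | succ k ih =>
    have := sylvester_aux (A ^ k) A
    rw [pow_succ, add_mul, add_mul]
    omega

theorem rank_regular_aux (F : Type*) [Field F] {p : ℕ} {G : Type*} [Group G] [Fintype G]
    [DecidableEq G] (hmin : ∀ q : ℕ, q.Prime → q ∣ Fintype.card G → p ≤ q)
    (g : G) (hg : g ≠ 1) :
    p * Fintype.card G ≤
      p * ((Equiv.mulRight g).permMatrix F - 1).rank + Fintype.card G := by
  have hord : p ≤ orderOf g := by
    have h1 : orderOf g ≠ 1 := by simpa using hg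
    exact (hmin _ (Nat.minFac_prime h1)
      ((Nat.minFac_dvd _).trans orderOf_dvd_card)).trans
      (Nat.minFac_le (orderOf_pos g))
  have hidx := (Subgroup.zpowers g).card_mul_index
  rw [Nat.card_zpowers, Nat.card_eq_fintype_card] at hidx
  unfold Matrix.rank
  have h1 := LinearMap.finrank_range_add_finrank_ker
    ((Equiv.mulRight g).permMatrix F - 1).mulVecLin
  rw [Module.finrank_fintype_fun_eq_card] at h1
  have h2 : LinearMap.ker ((Equiv.mulRight g).permMatrix F - 1).mulVecLin ≤
      LinearMap.range (LinearMap.funLeft F F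
        (QuotientGroup.mk : G → G ⧸ Subgroup.zpowers g)) := by
    intro v hv
    have hv1 : ∀ x, v (x * g) = v x := by
      intro x
      have h := congrFun (LinearMap.mem_ker.1 hv) x
      simpa [Matrix.sub_mulVec, Matrix.permMatrix_mulVec, sub_eq_zero] using h
    have hv2 : ∀ (k : ℕ) x, v (x * g ^ k) = v x := by
      intro k
      induction k with
      | zero => simp
      | succ k ih =>
        intro x
        rw [pow_succ, ← mul_assoc, hv1, ih]
    refine ⟨fun q => v q.out, ?_⟩
    ext x
    simp only [LinearMap.funLeft_apply]
    obtain ⟨⟨z, hz⟩, h⟩ := QuotientGroup.mk_out_eq_mul (Subgroup.zpowers g) x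
    rw [h]
    rw [← mem_powers_iff_mem_zpowers] at hz
    obtain ⟨k, rfl⟩ := hz
    exact hv2 k x
  have h3 := Submodule.finrank_mono h2
  have h4 := LinearMap.finrank_range_le (LinearMap.funLeft F F
        (QuotientGroup.mk : G → G ⧸ Subgroup.zpowers g))
  haveI := Fintype.ofFinite (G ⧸ Subgroup.zpowers g)
  rw [Module.finrank_fintype_fun_eq_card, ← Nat.card_eq_fintype_card] at h4
  have h5 : p * Module.finrank F (LinearMap.ker ((Equiv.mulRight g).permMatrix F - 1).mulVecLin)
      ≤ Fintype.card G := by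
    rw [← hidx]
    exact Nat.mul_le_mul hord (h3.trans h4)
  have h6 := congrArg (p * ·) h1
  simp only [mul_add] at h6
  omega

/-- Let `F` be a field of characteristic `p` and `G` a finite group such that `p` is the
smallest prime dividing `|G|`. Then `G` is `(1 - 1/p)`-linear sofic over `F`, and for every
`κ` with `1 - 1/p < κ ≤ 1`, `G` is not `κ`-linear sofic over `F`. -/
theorem kappa_finite_group_char_p
    (F : Type*) [Field F] (p : ℕ) [CharP F p]
    (G : Type*) [Group G] [Fintype G]
    (hp : p.Prime) (hdvd : p ∣ Fintype.card G)
    (hmin : ∀ q : ℕ, q.Prime → q ∣ Fintype.card G → p ≤ q) :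
    IsLinearSofic F G (1 - 1 / (p : ℝ)) ∧
      ∀ κ : ℝ, 1 - 1 / (p : ℝ) < κ → κ ≤ 1 → ¬ IsLinearSofic F G κ := by
  classical
  have hp0 : (0 : ℝ) < p := by exact_mod_cast hp.pos
  constructor
  · intro S δ hδ κ' hκ'
    let e := Fintype.equivFin G
    let Φ : G → Matrix (Fin (Fintype.card G)) (Fin (Fintype.card G)) F := fun g =>
      Matrix.reindexAlgEquiv F F e ((Equiv.mulRight g).permMatrix F)
    have hmul : ∀ g h, Φ (g * h) = Φ g * Φ h := by
      intro g h
      simp only [Φ, ← map_mul, ← Matrix.permMatrix_mul]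
      congr 2
      ext x
      simp [mul_assoc]
    have hone : Φ 1 = 1 := by
      have : (Equiv.mulRight (1 : G)) = 1 := by ext x; simp
      simp only [Φ, this, Matrix.permMatrix_one, map_one]
    have hd : 0 < Fintype.card G := Fintype.card_pos
    refine ⟨Fintype.card G, hd,
      fun g => ⟨Φ g, Φ g⁻¹, by rw [← hmul]; simp [hone], by rw [← hmul]; simp [hone]⟩, ?_, ?_⟩
    · intro g _ h _ _
      have hd' : (0 : ℝ) < Fintype.card G := by exact_mod_cast hd
      simp only [hmul, sub_self, Matrix.rank_zero, Nat.cast_zero]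
      positivity
    · intro g _ hg
      have h1 : (Φ g - 1).rank = ((Equiv.mulRight g).permMatrix F - 1).rank := by
        have : Φ g - 1 = Matrix.reindexAlgEquiv F F e ((Equiv.mulRight g).permMatrix F - 1) := by
          simp only [Φ, map_sub, map_one]
        rw [this, Matrix.coe_reindexAlgEquiv, Matrix.rank_reindex]
      have h2 := rank_regular_aux F hmin g hg
      rw [← h1] at h2
      have h3 : (p : ℝ) * Fintype.card G ≤ p * ((Φ g - 1).rank : ℝ) + Fintype.card G := by
        exact_mod_cast h2
      change κ' * _ ≤ ((Φ g - 1).rank : ℝ)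
      refine (mul_le_mul_of_nonneg_right hκ'.le (Nat.cast_nonneg _)).trans ?_
      refine le_of_mul_le_mul_left ?_ hp0
      have : (p : ℝ) * ((1 - 1 / p) * Fintype.card G) = p * Fintype.card G - Fintype.card G := by
        field_simp
      rw [this]
      linarith
  · intro κ hκ _ hs
    haveI : Fact p.Prime := ⟨hp⟩
    obtain ⟨g, hg⟩ := exists_prime_orderOf_dvd_card p hdvd
    have hg1 : g ≠ 1 := by
      rintro rfl
      rw [orderOf_one] at hg
      exact hp.one_lt.ne hg
    obtain ⟨κ', hκ1, hκ2⟩ := exists_between hκ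
    have hη : 0 < p * κ' - (p - 1) := by
      have : (p : ℝ) * (1 - 1 / p) < p * κ' := by gcongr
      have h2 : (p : ℝ) * (1 - 1 / p) = p - 1 := by field_simp
      linarith
    set δ : ℝ := (p * κ' - (p - 1)) / (2 * (p + 1)) with hδ
    have hδ0 : 0 < δ := by positivity
    obtain ⟨d, hd, φ, hφ, hφ1⟩ := hs Finset.univ δ hδ0 κ' hκ2
    have hd' : (0 : ℝ) < d := by exact_mod_cast hd
    have hm : ∀ a b, (((φ (a * b) : Matrix (Fin d) (Fin d) F) - φ a * φ b).rank : ℝ) ≤ δ * d :=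
      fun a b => (hφ a (Finset.mem_univ _) b (Finset.mem_univ _) (Finset.mem_univ _)).le
    have hadd : ∀ A B : Matrix (Fin d) (Fin d) F, ((A + B).rank : ℝ) ≤ A.rank + B.rank := by
      intro A B
      exact_mod_cast rank_add_le_aux A B
    have hleft : ∀ A B : Matrix (Fin d) (Fin d) F, ((A * B).rank : ℝ) ≤ A.rank := by
      intro A B
      exact_mod_cast Matrix.rank_mul_le_left A B
    have h1 : ((1 - (φ 1 : Matrix (Fin d) (Fin d) F)).rank : ℝ) ≤ δ * d := by
      have := hm 1 1
      have e : (1 - (φ 1 : Matrix (Fin d) (Fin d) F)) =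
          ((φ (1 * 1) : Matrix (Fin d) (Fin d) F) - φ 1 * φ 1) * ((φ 1)⁻¹ : GL (Fin d) F) := by
        rw [mul_one, sub_mul, mul_assoc, Units.mul_inv, mul_one]
      rw [e]
      exact (hleft _ _).trans this
    have hpow : ∀ k : ℕ, (((φ g : Matrix (Fin d) (Fin d) F) ^ k - φ (g ^ k)).rank : ℝ)
        ≤ (k + 1) * (δ * d) := by
      intro k
      induction k with
      | zero => simpa using h1
      | succ k ih =>
        have e : (φ g : Matrix (Fin d) (Fin d) F) ^ (k + 1) - φ (g ^ (k + 1)) =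
            ((φ g : Matrix (Fin d) (Fin d) F) ^ k - φ (g ^ k)) * φ g +
            ((φ (g ^ k * g) : Matrix (Fin d) (Fin d) F) - φ (g ^ k) * φ g) * (-1) := by
          rw [← pow_succ, pow_succ, sub_mul]
          simp
        rw [e]
        refine (hadd _ _).trans ?_
        have := (hleft ((φ g : Matrix (Fin d) (Fin d) F) ^ k - φ (g ^ k)) (φ g)).trans ih
        have := (hleft ((φ (g ^ k * g) : Matrix (Fin d) (Fin d) F) - φ (g ^ k) * φ g) (-1)).trans
          (hm (g ^ k) g)
        push_cast
        linarith
    have hN : ((((φ g : Matrix (Fin d) (Fin d) F) - 1) ^ p).rank : ℝ) ≤ (p + 2) * (δ * d) := by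
      haveI : Nonempty (Fin d) := ⟨⟨0, hd⟩⟩
      have hc : ((φ g : Matrix (Fin d) (Fin d) F) - 1) ^ p =
          (φ g : Matrix (Fin d) (Fin d) F) ^ p - 1 := by
        rw [sub_pow_char_of_commute (p := p) (Commute.one_right _), one_pow]
      have e : (φ g : Matrix (Fin d) (Fin d) F) ^ p - 1 =
          ((φ g : Matrix (Fin d) (Fin d) F) ^ p - φ (g ^ p)) +
          (1 - (φ 1 : Matrix (Fin d) (Fin d) F)) * (-1) := by
        rw [← hg, pow_orderOf_eq_one]
        simp
      rw [hc, e]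
      refine (hadd _ _).trans ?_
      have := hpow p
      have := (hleft (1 - (φ 1 : Matrix (Fin d) (Fin d) F)) (-1)).trans h1
      linarith
    have hr : (p : ℝ) * (((φ g : Matrix (Fin d) (Fin d) F) - 1).rank : ℝ) + d ≤
        (((φ g : Matrix (Fin d) (Fin d) F) - 1) ^ p).rank + p * d := by
      exact_mod_cast rank_pow_aux ((φ g : Matrix (Fin d) (Fin d) F) - 1) p
    have hk := mul_le_mul_of_nonneg_left (hφ1 g (Finset.mem_univ _) hg1) hp0.le
    have hfin : (p * κ' - (p - 1)) * d ≤ (p + 2) * δ * d := by linarith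
    have hfin2 := le_of_mul_le_mul_right hfin hd'
    have hδe : p * κ' - (p - 1) = 2 * (p + 1) * δ := by
      rw [hδ]; field_simp
    rw [hδe] at hfin2
    nlinarith [mul_pos hp0 hδ0]
end

section
/- For every n ≥ 2, the group (ℤ/2ℤ)^n is κ-linear sofic over ℂ for κ = 2^{n−1}/(2^n − 1), and it is not κ-linear sofic over ℂ for any κ > 2^{n−1}/(2^n − 1). -/
open Matrix

open Module in
/-- For a representation of a finite group of exponent two, the ranks of `1 - ρ g` sum to
at most `|G|/2 * dim W`. -/
lemma sum_rank_rep {G : Type} [Group G] [Fintype G] {W : Type} [AddCommGroup W] [Module ℂ W]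
    [FiniteDimensional ℂ W] (ρ : Representation ℂ G W) (h2 : ∀ g : G, g * g = 1) :
    2 * ∑ g : G, (finrank ℂ (LinearMap.range (ρ g - 1)) : ℝ)
      ≤ (Fintype.card G : ℝ) * finrank ℂ W := by
  have hsq : ∀ g, ρ g * ρ g = 1 := fun g => by rw [← map_mul, h2, map_one]
  have e1 : ∀ g, 2 * (finrank ℂ (LinearMap.range (ρ g - 1)) : ℂ)
      = finrank ℂ W - LinearMap.trace ℂ W (ρ g) := by
    intro g
    have hid : IsIdempotentElem ((-1/2 : ℂ) • (ρ g - 1)) := by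
      unfold IsIdempotentElem
      rw [smul_mul_smul_comm]
      have : (ρ g - 1) * (ρ g - 1) = (-2 : ℂ) • (ρ g - 1) := by
        rw [sub_mul, mul_sub, hsq, mul_one, one_mul, smul_sub, neg_smul, neg_smul, two_smul,
          two_smul]
        abel
      rw [this, smul_smul]; norm_num
    have hp := (LinearMap.isProj_range_iff_isIdempotentElem _).2 hid
    have ht := hp.trace
    rw [LinearMap.range_smul _ _ (by norm_num), map_smul, map_sub, LinearMap.trace_one] at ht
    rw [← ht]
    simp only [smul_eq_mul]
    ring
  have hav : ∑ g, LinearMap.trace ℂ W (ρ g)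
      = (Fintype.card G : ℂ) * finrank ℂ (Representation.invariants ρ) := by
    have hc : (Fintype.card G : ℂ) ≠ 0 := by simp
    have : Invertible (Fintype.card G : ℂ) := invertibleOfNonzero hc
    have h := (Representation.isProj_averageMap ρ).trace
    rw [← h]
    simp only [Representation.averageMap, GroupAlgebra.average, map_smul, map_sum,
      Representation.asAlgebraHom_of, smul_eq_mul, invOf_eq_inv]
    rw [mul_inv_cancel_left₀ hc]
  have e2 : (2 * ∑ g : G, (finrank ℂ (LinearMap.range (ρ g - 1)) : ℂ))
      = (Fintype.card G : ℂ) * finrank ℂ W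
        - (Fintype.card G : ℂ) * finrank ℂ (Representation.invariants ρ) := by
    rw [Finset.mul_sum, Finset.sum_congr rfl (fun g _ => e1 g), Finset.sum_sub_distrib, hav]
    simp
  have e3 : (2 * ∑ g : G, (finrank ℂ (LinearMap.range (ρ g - 1)) : ℝ))
      = (Fintype.card G : ℝ) * finrank ℂ W
        - (Fintype.card G : ℝ) * finrank ℂ (Representation.invariants ρ) := by
    exact_mod_cast e2
  rw [e3]
  have : (0 : ℝ) ≤ (Fintype.card G : ℝ) * finrank ℂ (Representation.invariants ρ) := by positivity
  linarith

open Module in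
lemma codim_iInf_ker {ι V : Type} [Fintype ι] [AddCommGroup V] [Module ℂ V]
    [FiniteDimensional ℂ V] (M : ι → V →ₗ[ℂ] V) (W : Submodule ℂ V)
    (hW : ∀ v, (∀ i, M i v = 0) → v ∈ W) :
    finrank ℂ V ≤ finrank ℂ W + ∑ i, finrank ℂ (LinearMap.range (M i)) := by
  let T : V →ₗ[ℂ] (∀ i, LinearMap.range (M i)) := LinearMap.pi (fun i => (M i).rangeRestrict)
  have h1 := LinearMap.finrank_range_add_finrank_ker T
  have h2 : finrank ℂ (LinearMap.range T) ≤ ∑ i, finrank ℂ (LinearMap.range (M i)) := by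
    rw [← Module.finrank_pi_fintype ℂ]
    exact Submodule.finrank_le _
  have h3 : finrank ℂ (LinearMap.ker T) ≤ finrank ℂ W := by
    apply Submodule.finrank_mono
    intro v hv
    apply hW
    intro i
    have := congrFun (LinearMap.mem_ker.1 hv) i
    exact congrArg Subtype.val this
  omega

open Module in
/-- Main estimate. -/
lemma sum_rank_almost {G V : Type} [Group G] [Fintype G] [AddCommGroup V] [Module ℂ V]
    [FiniteDimensional ℂ V] (f : G → V →ₗ[ℂ] V) (hf : ∀ g, Function.Injective (f g))
    (h2 : ∀ g : G, g * g = 1) :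
    2 * ∑ g : G, (finrank ℂ (LinearMap.range (f g - 1)) : ℝ)
      ≤ (Fintype.card G : ℝ) * finrank ℂ V + 2 * (Fintype.card G : ℝ) *
        ∑ p : G × G, (finrank ℂ (LinearMap.range (f (p.1 * p.2) - f p.1 * f p.2)) : ℝ) := by
  let W : Submodule ℂ V := ⨅ p : G × G, LinearMap.ker (f (p.1 * p.2) - f p.1 * f p.2)
  have memW : ∀ v, v ∈ W ↔ ∀ g h, f (g * h) v = f g (f h v) := by
    intro v
    simp [W, Submodule.mem_iInf, sub_eq_zero]
  have inv : ∀ k, ∀ v ∈ W, f k v ∈ W := by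
    intro k v hv
    rw [memW] at hv ⊢
    intro g h
    rw [← hv, ← hv, ← hv, mul_assoc]
  let ρ : Representation ℂ G W :=
    { toFun := fun g => (f g).restrict (inv g)
      map_one' := by
        ext v
        apply hf 1
        have := (memW v).1 v.2 1 1
        simpa using this.symm
      map_mul' := by
        intro g h
        ext v
        exact (memW v).1 v.2 g h }
  have hcod := codim_iInf_ker (fun p : G × G => f (p.1 * p.2) - f p.1 * f p.2) W (by
    intro v hv
    simpa [W, Submodule.mem_iInf] using hv)
  have hrep := sum_rank_rep ρ h2
  have hg : ∀ g, finrank ℂ (LinearMap.range (f g - 1)) + finrank ℂ W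
      ≤ finrank ℂ V + finrank ℂ (LinearMap.range (ρ g - 1)) := by
    intro g
    have a1 := LinearMap.finrank_range_add_finrank_ker (f g - 1)
    have a2 := LinearMap.finrank_range_add_finrank_ker (ρ g - 1)
    have a3 : finrank ℂ (LinearMap.ker (ρ g - 1)) ≤ finrank ℂ (LinearMap.ker (f g - 1)) := by
      rw [← Submodule.finrank_map_subtype_eq W (LinearMap.ker (ρ g - 1))]
      apply Submodule.finrank_mono
      rintro _ ⟨v, hv, rfl⟩
      have := congrArg Subtype.val (LinearMap.mem_ker.1 hv)
      exact LinearMap.mem_ker.2 this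
    omega
  set D : ℝ := ∑ p : G × G, (finrank ℂ (LinearMap.range (f (p.1 * p.2) - f p.1 * f p.2)) : ℝ)
    with hD
  have hcod' : (finrank ℂ V : ℝ) ≤ finrank ℂ W + D := by
    rw [hD]; exact_mod_cast hcod
  have hg' : ∀ g, (finrank ℂ (LinearMap.range (f g - 1)) : ℝ)
      ≤ D + finrank ℂ (LinearMap.range (ρ g - 1)) := by
    intro g
    have : (finrank ℂ (LinearMap.range (f g - 1)) : ℝ) + finrank ℂ W
      ≤ finrank ℂ V + finrank ℂ (LinearMap.range (ρ g - 1)) := by exact_mod_cast hg g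
    linarith
  have hs := Finset.sum_le_sum (fun g (_ : g ∈ Finset.univ) => hg' g)
  rw [Finset.sum_add_distrib] at hs
  simp only [Finset.sum_const, Finset.card_univ, nsmul_eq_mul] at hs
  have hWV : (finrank ℂ W : ℝ) ≤ finrank ℂ V := by exact_mod_cast Submodule.finrank_le W
  have := mul_le_mul_of_nonneg_left hWV (Nat.cast_nonneg (α := ℝ) (Fintype.card G))
  linarith

lemma card_half (n : ℕ) (hn : 1 ≤ n) (g : Fin n → ZMod 2) (hg : g ≠ 0) :
    2 ^ (n - 1) = Fintype.card {c : Fin n → ZMod 2 // c ⬝ᵥ g ≠ 0} := by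
  obtain ⟨i, hi⟩ := Function.ne_iff.1 hg
  have hi1 : g i = 1 := by
    have h : ∀ x : ZMod 2, x ≠ 0 → x = 1 := by decide
    exact h _ hi
  have key : ∀ x : ZMod 2, x + 1 ≠ 0 ↔ x = 0 := by decide
  have e : {c : Fin n → ZMod 2 // c ⬝ᵥ g = 0} ≃ {c : Fin n → ZMod 2 // c ⬝ᵥ g ≠ 0} :=
    (Equiv.addRight (Pi.single i 1)).subtypeEquiv (by
      intro c
      simp only [Equiv.coe_addRight, add_dotProduct, single_dotProduct, hi1, mul_one]
      exact (key _).symm)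
  have h1 := Fintype.card_congr e
  have h2 := Fintype.card_subtype_compl (fun c : Fin n → ZMod 2 => c ⬝ᵥ g = 0)
  have h3 := Fintype.card_subtype_le (fun c : Fin n → ZMod 2 => c ⬝ᵥ g = 0)
  have h4 : Fintype.card (Fin n → ZMod 2) = 2 * 2 ^ (n - 1) := by
    rw [← pow_succ', Nat.sub_add_cancel hn]
    simp [ZMod.card]
  have h5 : Fintype.card {c : Fin n → ZMod 2 // ¬ c ⬝ᵥ g = 0}
    = Fintype.card {c : Fin n → ZMod 2 // c ⬝ᵥ g ≠ 0} := rfl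
  omega

/-- The sign character of `ZMod 2`. -/
noncomputable def sgn2 (x : ZMod 2) : ℂ := if x = 0 then 1 else -1

lemma sgn2_add (x y : ZMod 2) : sgn2 (x + y) = sgn2 x * sgn2 y := by
  have h : ∀ x y : ZMod 2, (x + y = 0) ↔ (x = 0 ↔ y = 0) := by decide
  unfold sgn2
  by_cases hx : x = 0 <;> by_cases hy : y = 0 <;> simp [h, hx, hy]

lemma lower_part (n : ℕ) (hn : 2 ≤ n) :
    IsLinearSofic ℂ (Multiplicative (Fin n → ZMod 2))
        ((2 : ℝ) ^ (n - 1) / ((2 : ℝ) ^ n - 1)) := by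
  intro S δ hδ κ' hκ
  have hpow : (4 : ℝ) ≤ 2 ^ n := by
    calc (4 : ℝ) = 2 ^ 2 := by norm_num
      _ ≤ 2 ^ n := pow_le_pow_right₀ (by norm_num) hn
  let X := {c : Fin n → ZMod 2 // c ≠ 0}
  have hX : Fintype.card X = 2 ^ n - 1 := by
    have := Fintype.card_subtype_compl (fun c : Fin n → ZMod 2 => c = 0)
    have h1 : Fintype.card {c : Fin n → ZMod 2 // c = 0} = 1 := by simp
    rw [h1] at this
    have h2 : Fintype.card (Fin n → ZMod 2) = 2 ^ n := by simp [ZMod.card]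
    rw [h2] at this
    exact this
  have hXr : ((Fintype.card X : ℕ) : ℝ) = 2 ^ n - 1 := by
    rw [hX, Nat.cast_sub Nat.one_le_two_pow]; simp
  let d := Fintype.card X
  let e : X ≃ Fin d := Fintype.equivFin X
  let w : Multiplicative (Fin n → ZMod 2) → Fin d → ℂ :=
    fun g i => sgn2 ((e.symm i).1 ⬝ᵥ g.toAdd)
  have wmul : ∀ g h, w (g * h) = w g * w h := by
    intro g h
    funext i
    simp only [w, toAdd_mul, dotProduct_add, sgn2_add, Pi.mul_apply]
  have wsq : ∀ g, w g * w g = 1 := by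
    intro g
    funext i
    simp only [w, Pi.mul_apply, sgn2, Pi.one_apply]
    split_ifs <;> norm_num
  have dsq : ∀ g, Matrix.diagonal (w g) * Matrix.diagonal (w g) = 1 := by
    intro g
    rw [Matrix.diagonal_mul_diagonal, ← Matrix.diagonal_one]
    exact congrArg Matrix.diagonal (wsq g)
  refine ⟨d, ?_, fun g => ⟨Matrix.diagonal (w g), Matrix.diagonal (w g), dsq g, dsq g⟩, ?_, ?_⟩
  · have : (0 : ℝ) < d := by rw [hXr]; linarith
    exact_mod_cast this
  · intro g _ h _ _
    have hd : (0 : ℝ) < d := by rw [hXr]; linarith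
    have : Matrix.diagonal (w (g * h)) - Matrix.diagonal (w g) * Matrix.diagonal (w h) = 0 := by
      rw [Matrix.diagonal_mul_diagonal, wmul]
      exact sub_self _
    show ((Matrix.diagonal (w (g * h))
      - Matrix.diagonal (w g) * Matrix.diagonal (w h)).rank : ℝ) < δ * d
    rw [this, Matrix.rank_zero]
    simpa using mul_pos hδ hd
  · intro g _ hg
    show κ' * d ≤ ((Matrix.diagonal (w g) - 1).rank : ℝ)
    have hle : 2 ^ (n - 1) ≤ (Matrix.diagonal (w g) - 1).rank := by
      rw [← Matrix.diagonal_one, Matrix.diagonal_sub, Matrix.rank_diagonal,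
        card_half n (by omega) g.toAdd (fun h => hg (by simpa using h))]
      refine Fintype.card_le_of_injective
        (fun c => ⟨e ⟨c.1, fun h => c.2 (by rw [h, zero_dotProduct])⟩, ?_⟩) ?_
      · simp only [w, Equiv.symm_apply_apply, sgn2, if_neg c.2]
        norm_num
      · intro a b hab
        have h1 := e.injective (congrArg Subtype.val hab)
        exact Subtype.ext (Subtype.mk.inj h1)
    have hle' : (2 : ℝ) ^ (n - 1) ≤ ((Matrix.diagonal (w g) - 1).rank : ℝ) := by
      exact_mod_cast hle
    refine le_trans ?_ hle'
    have : (d : ℝ) = 2 ^ n - 1 := hXr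
    rw [this]
    rw [lt_div_iff₀ (by linarith)] at hκ
    exact hκ.le

lemma upper_part (n : ℕ) (hn : 2 ≤ n) (κ : ℝ) (hκ : (2 : ℝ) ^ (n - 1) / ((2 : ℝ) ^ n - 1) < κ) :
    ¬ IsLinearSofic ℂ (Multiplicative (Fin n → ZMod 2)) κ := by
  intro H
  have hpow : (4 : ℝ) ≤ 2 ^ n := by
    calc (4 : ℝ) = 2 ^ 2 := by norm_num
      _ ≤ 2 ^ n := pow_le_pow_right₀ (by norm_num) hn
  have hhalf : (2 : ℝ) ^ n = 2 * 2 ^ (n - 1) := by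
    rw [← pow_succ', Nat.sub_add_cancel (by omega)]
  obtain ⟨κ', h1, h2⟩ := exists_between hκ
  rw [div_lt_iff₀ (by linarith)] at h1
  set N : ℝ := 2 ^ n with hN
  let ε : ℝ := κ' * (N - 1) - 2 ^ (n - 1)
  have hε : 0 < ε := by simp only [ε]; linarith
  obtain ⟨d, hd, φ, hA, hD⟩ := H Finset.univ (ε / (2 * N ^ 3)) (by positivity) κ' h2
  have hd' : (0 : ℝ) < d := by exact_mod_cast hd
  have hcard : (Fintype.card (Multiplicative (Fin n → ZMod 2)) : ℝ) = N := by
    simp [ZMod.card, hN]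
  have main := sum_rank_almost (G := Multiplicative (Fin n → ZMod 2)) (V := Fin d → ℂ)
    (fun g => (φ g : Matrix (Fin d) (Fin d) ℂ).mulVecLin)
    (fun g => by
      have := Matrix.mulVec_injective_of_isUnit (φ g).isUnit
      exact this)
    (fun g => by
      have : ∀ x : ZMod 2, x + x = 0 := by decide
      apply Multiplicative.toAdd.injective
      funext i
      exact this _)
  have r1 : ∀ g, Module.finrank ℂ (LinearMap.range
      ((φ g : Matrix (Fin d) (Fin d) ℂ).mulVecLin - 1))
      = ((φ g : Matrix (Fin d) (Fin d) ℂ) - 1).rank := by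
    intro g
    have : (φ g : Matrix (Fin d) (Fin d) ℂ).mulVecLin - 1
        = ((φ g : Matrix (Fin d) (Fin d) ℂ) - 1).mulVecLin := by
      apply LinearMap.ext
      intro v
      simp [Matrix.sub_mulVec]
    rw [Matrix.rank, this]
  have r2 : ∀ g h, Module.finrank ℂ (LinearMap.range
      ((φ (g * h) : Matrix (Fin d) (Fin d) ℂ).mulVecLin
        - (φ g : Matrix (Fin d) (Fin d) ℂ).mulVecLin * (φ h : Matrix (Fin d) (Fin d) ℂ).mulVecLin))
      = ((φ (g * h) : Matrix (Fin d) (Fin d) ℂ)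
        - (φ g : Matrix (Fin d) (Fin d) ℂ) * (φ h : Matrix (Fin d) (Fin d) ℂ)).rank := by
    intro g h
    have : (φ (g * h) : Matrix (Fin d) (Fin d) ℂ).mulVecLin - (φ g : Matrix (Fin d) (Fin d) ℂ).mulVecLin * (φ h : Matrix (Fin d) (Fin d) ℂ).mulVecLin
        = ((φ (g * h) : Matrix (Fin d) (Fin d) ℂ) - (φ g : Matrix (Fin d) (Fin d) ℂ) * (φ h : Matrix (Fin d) (Fin d) ℂ)).mulVecLin := by
      apply LinearMap.ext
      intro v
      simp [Matrix.sub_mulVec]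
    rw [Matrix.rank, this]
  simp only [r1, r2, hcard, Module.finrank_fin_fun] at main
  have b1 : ∑ p : Multiplicative (Fin n → ZMod 2) × Multiplicative (Fin n → ZMod 2),
      (((φ (p.1 * p.2) : Matrix (Fin d) (Fin d) ℂ)
        - (φ p.1 : Matrix (Fin d) (Fin d) ℂ) * (φ p.2 : Matrix (Fin d) (Fin d) ℂ)).rank : ℝ)
      < N ^ 2 * (ε / (2 * N ^ 3) * d) := by
    refine lt_of_lt_of_eq (Finset.sum_lt_sum_of_nonempty Finset.univ_nonempty
      (fun p _ => hA p.1 (Finset.mem_univ _) p.2 (Finset.mem_univ _) (Finset.mem_univ _))) ?_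
    rw [Finset.sum_const, Finset.card_univ, Fintype.card_prod, nsmul_eq_mul, Nat.cast_mul, hcard]
    ring
  have b2 : (N - 1) * (κ' * d) ≤ ∑ g : Multiplicative (Fin n → ZMod 2),
      (((φ g : Matrix (Fin d) (Fin d) ℂ) - 1).rank : ℝ) := by
    rw [← Finset.add_sum_erase _ _ (Finset.mem_univ (1 : Multiplicative (Fin n → ZMod 2)))]
    have := Finset.card_nsmul_le_sum (Finset.univ.erase (1 : Multiplicative (Fin n → ZMod 2)))
      (fun g => (((φ g : Matrix (Fin d) (Fin d) ℂ) - 1).rank : ℝ)) (κ' * d)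
      (fun g hg => hD g (Finset.mem_univ _) (Finset.ne_of_mem_erase hg))
    rw [Finset.card_erase_of_mem (Finset.mem_univ _), Finset.card_univ, nsmul_eq_mul,
      Nat.cast_sub Fintype.card_pos, hcard, Nat.cast_one] at this
    have h0 : (0 : ℝ) ≤ (((φ 1 : Matrix (Fin d) (Fin d) ℂ) - 1).rank : ℝ) := Nat.cast_nonneg _
    linarith
  have hNpos : 0 < N := by linarith
  have b3 := mul_lt_mul_of_pos_left b1 (by positivity : 0 < 2 * N)
  have b4 : 2 * N * (N ^ 2 * (ε / (2 * N ^ 3) * d)) = ε * d := by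
    field_simp
  rw [b4] at b3
  have b5 : 2 * ((N - 1) * (κ' * d)) = N * d + 2 * (ε * d) := by
    simp only [ε]
    rw [hhalf]; ring
  have b6 : 0 < ε * d := by positivity
  linarith





/-- For `n ≥ 2`, the group `(ℤ/2ℤ)^n` is `κ`-linear sofic over `ℂ` for
`κ = 2^(n-1)/(2^n - 1)`, and not `κ`-linear sofic for any larger `κ`. -/
theorem kappa_Z2_pow (n : ℕ) (hn : 2 ≤ n) :
    IsLinearSofic ℂ (Multiplicative (Fin n → ZMod 2))
        ((2 : ℝ) ^ (n - 1) / ((2 : ℝ) ^ n - 1)) ∧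
      ∀ κ : ℝ, (2 : ℝ) ^ (n - 1) / ((2 : ℝ) ^ n - 1) < κ →
        ¬ IsLinearSofic ℂ (Multiplicative (Fin n → ZMod 2)) κ := by
  exact ⟨lower_part n hn, fun κ hκ => upper_part n hn κ hκ⟩
end

section
/- For every 0 < β < 1/2, every integer r ≥ 1 and every η > 0, there exists M = M(β, r, η) (independent of the matrix and its size) such that the following holds: if A ∈ GL_d(ℂ) satisfies (1) β ≤ m₁(A) ≤ 1 − β and (2) m^{≤r}(A) ≤ 1 − β, then for all n ≥ M, m₁(A^{⊗n}) ≤ 1/r + η. Moreover, under assumption (1) alone, for every η > 0 there exists M' = M'(β, η) such that for all n ≥ M', m₁(A^{⊗n}) ≤ 1/2 + η. -/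
open Matrix
open scoped Classical

/-- The `k`-fold Kronecker (tensor) power of a `d × d` matrix `A`, realized as a matrix
indexed by `Fin k → Fin d` with entries `(A^{⊗k})_{i,j} = ∏ t, A (i t) (j t)`. -/
noncomputable def kronPow {d : ℕ} (A : Matrix (Fin d) (Fin d) ℂ) (k : ℕ) :
    Matrix (Fin k → Fin d) (Fin k → Fin d) ℂ :=
  Matrix.of fun i j => ∏ t, A (i t) (j t)

/-- `m₁(A)`: the number of eigenvalues of `A` equal to `1`, counted with algebraic
multiplicity, divided by the size of the matrix. -/
noncomputable def m1 {ι : Type*} [Fintype ι] [DecidableEq ι] (A : Matrix ι ι ℂ) : ℝ :=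
  (A.charpoly.rootMultiplicity 1 : ℝ) / (Fintype.card ι)

/-- `m^{≤r}(A)`: the number of eigenvalues `μ` of `A`, counted with algebraic
multiplicity, with `μ^k = 1` for some `1 ≤ k ≤ r`, divided by the size of the matrix. -/
noncomputable def mLe {ι : Type*} [Fintype ι] [DecidableEq ι] (A : Matrix ι ι ℂ)
    (r : ℕ) : ℝ :=
  ((A.charpoly.roots.filter fun μ => ∃ k : ℕ, 1 ≤ k ∧ k ≤ r ∧ μ ^ k = 1).card : ℝ) /
    (Fintype.card ι)

lemma norm_one_add_exp (x : ℝ) : ‖1 + Complex.exp ((2 * x : ℝ) * Complex.I)‖ = 2 * |Real.cos x| := by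
  have : 1 + Complex.exp ((2 * x : ℝ) * Complex.I)
      = Complex.exp (x * Complex.I) * ((2 * Real.cos x : ℝ) : ℂ) := by
    push_cast
    rw [Complex.cos, mul_div_cancel₀ _ (two_ne_zero), mul_add, ← Complex.exp_add, ← Complex.exp_add]
    rw [add_comm]
    congr 1
    · congr 1; ring
    · simp
  rw [this, norm_mul, Complex.norm_exp_ofReal_mul_I, one_mul, Complex.norm_real, Real.norm_eq_abs,
    abs_mul, abs_two]

lemma near_card (N : ℕ) (hN : 0 < N) (δ : ℝ) (hδ : 0 < δ) (hδ' : δ < 1 / 2) (S : Finset ℂ)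
    (hS : ∀ z ∈ S, z ^ N = 1) (hS' : ∀ z ∈ S, 2 * Real.cos (Real.pi * δ) < ‖1 + z‖) :
    (S.card : ℝ) ≤ 2 * δ * N + 1 := by
  have hN' : (0 : ℝ) < N := by exact_mod_cast hN
  let J : Finset ℕ := Finset.range ⌈δ * N⌉₊ ∪ (Finset.Icc 1 ⌊δ * N⌋₊).image (fun j => N - j)
  have hsub : S ⊆ J.image (fun j : ℕ => Complex.exp (2 * Real.pi * Complex.I * (j / N))) := by
    intro z hz
    have hz1 := hS z hz
    have hz2 := hS' z hz
    have : NeZero N := ⟨hN.ne'⟩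
    obtain ⟨j, hj, hjz⟩ := (Complex.isPrimitiveRoot_exp N hN.ne').eq_pow_of_pow_eq_one hz1
    have hjz' : Complex.exp (2 * Real.pi * Complex.I * (j / N)) = z := by
      rw [← hjz, ← Complex.exp_nat_mul]; congr 1; field_simp
    rw [Finset.mem_image]
    refine ⟨j, ?_, hjz'⟩
    have e : (2 * Real.pi * Complex.I * (j / N) : ℂ) = ((2 * (Real.pi * (j / N)) : ℝ) : ℂ) * Complex.I := by
      push_cast; ring
    rw [← hjz', e, norm_one_add_exp] at hz2
    have hz3 : Real.cos (Real.pi * δ) < |Real.cos (Real.pi * (j / N))| := by linarith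
    have hjN : (j : ℝ) < N := by exact_mod_cast hj
    by_contra hJ
    have h1 : δ * N ≤ j := by
      by_contra h; push Not at h
      exact hJ (Finset.mem_union_left _ (Finset.mem_range.2 (Nat.lt_ceil.2 h)))
    have h2 : δ * N ≤ N - j := by
      by_contra h; push Not at h
      apply hJ (Finset.mem_union_right _ (Finset.mem_image.2 ⟨N - j, ?_, by omega⟩))
      rw [Finset.mem_Icc]
      refine ⟨by omega, Nat.le_floor ?_⟩
      rw [Nat.cast_sub hj.le]; exact h.le
    have h1' : δ ≤ j / N := by rw [le_div_iff₀ hN']; exact h1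
    have h2' : (j : ℝ) / N ≤ 1 - δ := by rw [div_le_iff₀ hN']; linarith
    have hpi := Real.pi_pos
    apply absurd hz3
    rw [not_lt, abs_le]
    constructor
    · rw [← Real.cos_pi_sub]
      apply Real.cos_le_cos_of_nonneg_of_le_pi
      · positivity
      · nlinarith
      · nlinarith
    · apply Real.cos_le_cos_of_nonneg_of_le_pi
      · positivity
      · nlinarith
      · nlinarith
  have hc : S.card ≤ ⌈δ * N⌉₊ + ⌊δ * N⌋₊ := by
    calc S.card ≤ J.card := (Finset.card_le_card hsub).trans Finset.card_image_le
      _ ≤ _ := Finset.card_union_le _ _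
      _ ≤ _ := by
        gcongr
        · simp
        · exact Finset.card_image_le.trans (by simp)
  have h1 : (⌈δ * N⌉₊ : ℝ) < δ * N + 1 := Nat.ceil_lt_add_one (by positivity)
  have h2 : (⌊δ * N⌋₊ : ℝ) ≤ δ * N := Nat.floor_le (by positivity)
  have : (S.card : ℝ) ≤ ⌈δ * N⌉₊ + ⌊δ * N⌋₊ := by exact_mod_cast hc
  linarith

lemma near_chars {Q : Type*} [AddCommGroup Q] [Fintype Q] (r : ℕ) (g : Q)
    (hg : ∀ k : ℕ, 1 ≤ k → k ≤ r → k • g ≠ 0) (δ : ℝ) (hδ : 0 < δ) (hδ' : δ < 1 / 2) :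
    ((Finset.univ.filter fun χ : AddChar Q ℂ => 2 * Real.cos (Real.pi * δ) < ‖1 + χ g‖).card : ℝ)
      ≤ (2 * δ + 1 / (r + 1)) * Fintype.card Q := by
  let ev : AddChar Q ℂ →* ℂ := ⟨⟨fun χ => χ g, by simp⟩, by intro a b; simp⟩
  let f : AddChar Q ℂ →* ℂˣ := ev.toHomUnits
  have hf : ∀ χ, (f χ : ℂ) = χ g := fun χ => rfl
  have key : ∀ s : Finset ℂˣ, (∀ z ∈ s, z ∈ f.range) →
      (Finset.univ.filter fun χ => f χ ∈ s).card =
        s.card * (Finset.univ.filter fun χ => f χ = 1).card := by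
    intro s hs
    rw [Finset.card_eq_sum_card_fiberwise (f := f) (t := s) (by intro x; simp)]
    rw [Finset.sum_const_nat]
    intro z hz
    rw [← MonoidHom.card_fiber_eq_of_mem_range f (x := z) (y := 1) (hs z hz) ⟨1, by simp⟩]
    congr 1
    ext χ
    simp only [Finset.mem_filter, Finset.mem_univ, true_and]
    constructor
    · rintro ⟨_, h⟩; exact h
    · rintro h; exact ⟨h ▸ hz, h⟩
  set R : Finset ℂˣ := Finset.univ.image f with hR
  have hRcard : Nat.card f.range = R.card := by
    have : (f.range : Set ℂˣ) = R := by ext; simp [hR]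
    rw [← SetLike.coe_sort_coe, this]; simp
  set c := (Finset.univ.filter fun χ => f χ = 1).card with hc
  have hRange : ∀ z ∈ R, z ∈ f.range := by
    intro z hz; obtain ⟨χ, _, h⟩ := Finset.mem_image.1 hz; exact ⟨χ, h⟩
  have htot : Fintype.card Q = R.card * c := by
    rw [← AddChar.card_eq (α := Q), ← key R hRange, ← Finset.card_univ]
    congr 1
    ext χ; simp [hR]
  have hpow : ∀ z ∈ R, z ^ R.card = 1 := by
    intro z hz
    have := pow_card_eq_one' (x := (⟨z, hRange z hz⟩ : f.range))
    rw [hRcard] at this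
    exact congrArg Subtype.val this
  have hRpos : 0 < R.card := Finset.card_pos.2 ⟨f 1, Finset.mem_image_of_mem _ (Finset.mem_univ _)⟩
  have hRr : r + 1 ≤ R.card := by
    by_contra h
    apply hg R.card hRpos (by omega)
    rw [← AddChar.forall_apply_eq_zero]
    intro χ
    rw [AddChar.map_nsmul_eq_pow, ← hf]
    have := hpow (f χ) (Finset.mem_image_of_mem _ (Finset.mem_univ _))
    simpa using congrArg Units.val this
  let S : Finset ℂˣ := R.filter fun z : ℂˣ => 2 * Real.cos (Real.pi * δ) < ‖1 + (z : ℂ)‖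
  have hS : (Finset.univ.filter fun χ : AddChar Q ℂ => 2 * Real.cos (Real.pi * δ) < ‖1 + χ g‖)
      = Finset.univ.filter fun χ => f χ ∈ S := by
    ext χ; simp [S, hR, hf]
  rw [hS, key S (fun z hz => hRange z (Finset.mem_filter.1 hz).1), htot]
  have hn := near_card R.card hRpos δ hδ hδ' (S.image Units.val)
    (by
      intro z hz
      obtain ⟨w, hw, rfl⟩ := Finset.mem_image.1 hz
      have := hpow w (Finset.mem_filter.1 hw).1
      simpa using congrArg Units.val this)
    (by
      intro z hz
      obtain ⟨w, hw, rfl⟩ := Finset.mem_image.1 hz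
      exact (Finset.mem_filter.1 hw).2)
  rw [Finset.card_image_of_injective _ Units.val_injective] at hn
  have hRr' : (r : ℝ) + 1 ≤ R.card := by exact_mod_cast hRr
  have h1 : (1 : ℝ) ≤ 1 / (r + 1) * R.card := by
    rw [one_div, inv_mul_eq_div, le_div_iff₀ (by positivity)]; linarith
  push_cast
  rw [← mul_assoc]
  gcongr
  linarith

lemma per_elem {Q : Type*} [AddCommGroup Q] [Fintype Q] (r : ℕ) (g : Q)
    (hg : ∀ k : ℕ, 1 ≤ k → k ≤ r → k • g ≠ 0) (δ : ℝ) (hδ : 0 < δ) (hδ' : δ < 1 / 2)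
    (β : ℝ) (hβ0 : 0 < β) (hβ : β < 1 / 2) (n : ℕ)
    (hn : (1 - 2 * β + 2 * β * Real.cos (Real.pi * δ)) ^ n ≤ δ) :
    ∑ χ : AddChar Q ℂ, (1 - 2 * β + β * ‖1 + χ g‖) ^ n ≤
      (1 / (r + 1) + 3 * δ) * Fintype.card Q := by
  have hle2 : ∀ χ : AddChar Q ℂ, ‖1 + χ g‖ ≤ 2 := by
    intro χ
    calc ‖1 + χ g‖ ≤ ‖(1 : ℂ)‖ + ‖χ g‖ := norm_add_le _ _
      _ = 2 := by rw [AddChar.norm_apply]; norm_num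
  have hpt : ∀ χ : AddChar Q ℂ, (1 - 2 * β + β * ‖1 + χ g‖) ^ n ≤
      (if 2 * Real.cos (Real.pi * δ) < ‖1 + χ g‖ then 1 else 0) + δ := by
    intro χ
    have h0 : 0 ≤ 1 - 2 * β + β * ‖1 + χ g‖ := by
      have : 0 ≤ β * ‖1 + χ g‖ := by positivity
      linarith
    split_ifs with h
    · have : (1 - 2 * β + β * ‖1 + χ g‖) ^ n ≤ 1 := by
        apply pow_le_one₀ h0
        nlinarith [hle2 χ]
      linarith
    · rw [zero_add]
      refine le_trans ?_ hn
      push Not at h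
      apply pow_le_pow_left₀ h0
      nlinarith
  calc ∑ χ : AddChar Q ℂ, (1 - 2 * β + β * ‖1 + χ g‖) ^ n
      ≤ ∑ χ : AddChar Q ℂ, ((if 2 * Real.cos (Real.pi * δ) < ‖1 + χ g‖ then 1 else 0) + δ) :=
        Finset.sum_le_sum fun χ _ => hpt χ
    _ = ((Finset.univ.filter fun χ : AddChar Q ℂ =>
          2 * Real.cos (Real.pi * δ) < ‖1 + χ g‖).card : ℝ) + Fintype.card Q * δ := by
        rw [Finset.sum_add_distrib, Finset.sum_boole, Finset.sum_const, Finset.card_univ,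
          AddChar.card_eq, nsmul_eq_mul]
    _ ≤ _ := by
        have := near_chars r g hg δ hδ hδ'
        linarith

lemma char_bound {Q : Type*} [AddCommGroup Q] [Fintype Q] (r : ℕ) (hr : 1 ≤ r) (d : ℕ) (hd : 0 < d)
    (q : Fin d → Q) (β : ℝ) (hβ0 : 0 < β) (hβ : β < 1 / 2)
    (Z B : Finset (Fin d)) (hZ : Z = Finset.univ.filter fun i => q i = 0)
    (hB : B = Finset.univ.filter fun i => ∀ k : ℕ, 1 ≤ k → k ≤ r → k • q i ≠ 0)
    (hZc : β * d ≤ Z.card) (hBc : β * d ≤ B.card) (χ : AddChar Q ℂ) :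
    ‖∑ i, χ (q i)‖ ≤ d * ∑ i ∈ B, (1 / (B.card : ℝ)) * (1 - 2 * β + β * ‖1 + χ (q i)‖) := by
  have hd' : (0 : ℝ) < d := by exact_mod_cast hd
  have hb : (0 : ℝ) < B.card := lt_of_lt_of_le (by positivity) hBc
  have hdisj : Disjoint Z B := by
    rw [Finset.disjoint_left]
    intro i hi hi'
    rw [hZ, Finset.mem_filter] at hi
    rw [hB, Finset.mem_filter] at hi'
    exact hi'.2 1 le_rfl hr (by simp [hi.2])
  set W := (Z ∪ B)ᶜ with hW
  have hcard : (Z.card : ℝ) + B.card + W.card = d := by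
    have h1 := Finset.card_add_card_compl (Z ∪ B)
    rw [Finset.card_union_of_disjoint hdisj, Fintype.card_fin] at h1
    exact_mod_cast h1
  have hsplit : ∑ i, χ (q i) = (Z.card : ℂ) + ∑ i ∈ B, χ (q i) + ∑ i ∈ W, χ (q i) := by
    rw [← Finset.sum_add_sum_compl (Z ∪ B), Finset.sum_union hdisj]
    congr 2
    rw [Finset.sum_congr rfl (g := fun _ => (1 : ℂ))]
    · simp
    · intro i hi
      rw [hZ, Finset.mem_filter] at hi
      simp [hi.2]
  set a : ℝ := β * d / B.card with ha
  have ha0 : 0 ≤ a := by positivity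
  have ha1 : a ≤ 1 := by rw [ha, div_le_one hb]; exact hBc
  have hab : a * B.card = β * d := by rw [ha]; field_simp
  have hre : (Z.card : ℂ) + ∑ i ∈ B, χ (q i) + ∑ i ∈ W, χ (q i) =
      ((Z.card - β * d : ℝ) : ℂ) + ∑ i ∈ B, ((a : ℂ) * (1 + χ (q i)) + ((1 - a : ℝ) : ℂ) * χ (q i))
        + ∑ i ∈ W, χ (q i) := by
    have : ∑ i ∈ B, ((a : ℂ) * (1 + χ (q i)) + ((1 - a : ℝ) : ℂ) * χ (q i)) =
        ((a * B.card : ℝ) : ℂ) + ∑ i ∈ B, χ (q i) := by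
      rw [Finset.sum_congr rfl (g := fun i => (a : ℂ) + χ (q i))]
      · rw [Finset.sum_add_distrib]; simp [mul_comm]
      · intro i _; push_cast; ring
    rw [this, hab]; push_cast; ring
  rw [hsplit, hre]
  have n1 : ‖((Z.card - β * d : ℝ) : ℂ)‖ = Z.card - β * d := by
    rw [Complex.norm_real, Real.norm_eq_abs, abs_of_nonneg (by linarith)]
  have n2 : ‖∑ i ∈ B, ((a : ℂ) * (1 + χ (q i)) + ((1 - a : ℝ) : ℂ) * χ (q i))‖ ≤
      a * ∑ i ∈ B, ‖1 + χ (q i)‖ + (1 - a) * B.card := by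
    calc _ ≤ ∑ i ∈ B, (a * ‖1 + χ (q i)‖ + (1 - a)) := by
          refine norm_sum_le_of_le _ fun i _ => ?_
          refine (norm_add_le _ _).trans ?_
          rw [norm_mul, norm_mul, AddChar.norm_apply, Complex.norm_real, Complex.norm_real,
            Real.norm_eq_abs, Real.norm_eq_abs, abs_of_nonneg ha0, abs_of_nonneg (by linarith : 0 ≤ 1 - a), mul_one]
      _ = _ := by rw [Finset.sum_add_distrib, ← Finset.mul_sum, Finset.sum_const, nsmul_eq_mul]; ring
  have n3 : ‖∑ i ∈ W, χ (q i)‖ ≤ W.card := by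
    refine (norm_sum_le _ _).trans ?_
    simp [AddChar.norm_apply]
  have hfin : d * ∑ i ∈ B, (1 / (B.card : ℝ)) * (1 - 2 * β + β * ‖1 + χ (q i)‖) =
      d * (1 - 2 * β) + a * ∑ i ∈ B, ‖1 + χ (q i)‖ := by
    rw [← Finset.mul_sum, Finset.sum_add_distrib, ← Finset.mul_sum, Finset.sum_const, nsmul_eq_mul, ha]
    field_simp
  rw [hfin]
  refine (norm_add_le _ _).trans ?_
  have := norm_add_le ((Z.card - β * d : ℝ) : ℂ) (∑ i ∈ B, ((a : ℂ) * (1 + χ (q i)) + ((1 - a : ℝ) : ℂ) * χ (q i)))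
  nlinarith

lemma fin_group (β : ℝ) (hβ0 : 0 < β) (hβ : β < 1 / 2) (r : ℕ) (hr : 1 ≤ r)
    (η : ℝ) (hη : 0 < η) :
    ∃ M : ℕ, ∀ (Q : Type) [AddCommGroup Q] [Fintype Q] (d : ℕ), 0 < d → ∀ q : Fin d → Q,
      β * d ≤ (Finset.univ.filter fun i => q i = 0).card →
      β * d ≤ (Finset.univ.filter fun i => ∀ k : ℕ, 1 ≤ k → k ≤ r → k • q i ≠ 0).card →
      ∀ n : ℕ, M ≤ n →
        ((Finset.univ.filter fun t : Fin n → Fin d => ∑ j, q (t j) = 0).card : ℝ) ≤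
          (1 / (r + 1) + η) * d ^ n := by
  obtain ⟨δ, hδ, hδ', hδη⟩ : ∃ δ : ℝ, 0 < δ ∧ δ < 1 / 2 ∧ 3 * δ ≤ η :=
    ⟨min (η / 3) (1 / 4), by positivity, (min_le_right _ _).trans_lt (by norm_num),
      by linarith [min_le_left (η / 3) (1 / 4 : ℝ)]⟩
  have hpi := Real.pi_pos
  have hcos1 : Real.cos (Real.pi * δ) < 1 := by
    rw [← Real.cos_zero]
    apply Real.cos_lt_cos_of_nonneg_of_le_pi le_rfl <;> nlinarith
  have hcos0 : 0 ≤ Real.cos (Real.pi * δ) := by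
    apply Real.cos_nonneg_of_mem_Icc; constructor <;> nlinarith
  set c := 1 - 2 * β + 2 * β * Real.cos (Real.pi * δ) with hc
  have hc0 : 0 ≤ c := by
    have : 0 ≤ 2 * β * Real.cos (Real.pi * δ) := by positivity
    linarith
  have hc1 : c < 1 := by nlinarith
  obtain ⟨M, hM⟩ := exists_pow_lt_of_lt_one hδ hc1
  refine ⟨M, ?_⟩
  intro Q _ _ d hd q hZc hBc n hn
  have hcn : c ^ n ≤ δ := (pow_le_pow_of_le_one hc0 hc1.le hn).trans hM.le
  set Z := Finset.univ.filter fun i => q i = 0 with hZ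
  set B := Finset.univ.filter fun i => ∀ k : ℕ, 1 ≤ k → k ≤ r → k • q i ≠ 0 with hB
  have hd' : (0 : ℝ) < d := by exact_mod_cast hd
  have hb : (0 : ℝ) < B.card := lt_of_lt_of_le (by positivity) hBc
  have hQ : (0 : ℝ) < Fintype.card Q := by exact_mod_cast Fintype.card_pos
  have hcount : (((Finset.univ.filter fun t : Fin n → Fin d => ∑ j, q (t j) = 0).card : ℝ) : ℂ)
      * Fintype.card Q = ∑ χ : AddChar Q ℂ, (∑ i, χ (q i)) ^ n := by
    have h1 : ∀ χ : AddChar Q ℂ, (∑ i, χ (q i)) ^ n = ∑ t : Fin n → Fin d, χ (∑ j, q (t j)) := by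
      intro χ
      have := Finset.prod_univ_sum (fun _ : Fin n => (Finset.univ : Finset (Fin d))) (fun _ i => χ (q i))
      simp only [Finset.prod_const, Finset.card_univ, Fintype.card_fin, Fintype.piFinset_univ] at this
      rw [this]
      refine Finset.sum_congr rfl fun t _ => ?_
      have := map_prod χ.toMonoidHom (fun j => Multiplicative.ofAdd (q (t j))) Finset.univ
      rw [← ofAdd_sum] at this
      exact this.symm
    simp_rw [h1]
    rw [Finset.sum_comm]
    simp_rw [AddChar.sum_apply_eq_ite]
    rw [← Finset.sum_filter, Finset.sum_const, nsmul_eq_mul]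
    simp
  have hnorm : ((Finset.univ.filter fun t : Fin n → Fin d => ∑ j, q (t j) = 0).card : ℝ)
      * Fintype.card Q ≤ ∑ χ : AddChar Q ℂ, ‖∑ i, χ (q i)‖ ^ n := by
    have h := congrArg norm hcount
    rw [norm_mul, Complex.norm_real, Complex.norm_natCast, Real.norm_natCast] at h
    rw [h]
    refine (norm_sum_le _ _).trans ?_
    simp [norm_pow]
  have hpt : ∀ χ : AddChar Q ℂ, ‖∑ i, χ (q i)‖ ^ n ≤
      d ^ n * ∑ i ∈ B, (1 / (B.card : ℝ)) * (1 - 2 * β + β * ‖1 + χ (q i)‖) ^ n := by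
    intro χ
    have h := char_bound r hr d hd q β hβ0 hβ Z B hZ hB hZc hBc χ
    calc _ ≤ (d * ∑ i ∈ B, (1 / (B.card : ℝ)) * (1 - 2 * β + β * ‖1 + χ (q i)‖)) ^ n :=
          pow_le_pow_left₀ (norm_nonneg _) h n
      _ ≤ _ := by
        rw [mul_pow]
        gcongr
        apply Real.pow_arith_mean_le_arith_mean_pow
        · intro i _; positivity
        · rw [Finset.sum_const, nsmul_eq_mul]; field_simp
        · intro i _
          have : 0 ≤ β * ‖1 + χ (q i)‖ := by positivity
          linarith
  have hsum : ∑ χ : AddChar Q ℂ, ‖∑ i, χ (q i)‖ ^ n ≤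
      d ^ n * ((1 / (r + 1) + 3 * δ) * Fintype.card Q) := by
    refine (Finset.sum_le_sum fun χ _ => hpt χ).trans ?_
    rw [← Finset.mul_sum, Finset.sum_comm]
    gcongr
    calc _ ≤ ∑ i ∈ B, (1 / (B.card : ℝ)) * ((1 / (r + 1) + 3 * δ) * Fintype.card Q) := by
          refine Finset.sum_le_sum fun i hi => ?_
          rw [← Finset.mul_sum]
          gcongr
          exact per_elem r (q i) (Finset.mem_filter.1 hi).2 δ hδ hδ' β hβ0 hβ n hcn
      _ = _ := by rw [Finset.sum_const, nsmul_eq_mul]; field_simp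
  have h2 := hnorm.trans hsum
  have h3 : ((Finset.univ.filter fun t : Fin n → Fin d => ∑ j, q (t j) = 0).card : ℝ) ≤
      (1 / (r + 1) + 3 * δ) * d ^ n := by
    refine le_of_mul_le_mul_right (h2.trans (le_of_eq ?_)) hQ
    ring
  refine h3.trans ?_
  gcongr

lemma units_count (β : ℝ) (hβ0 : 0 < β) (hβ : β < 1 / 2) (r : ℕ) (hr : 1 ≤ r)
    (η : ℝ) (hη : 0 < η) :
    ∃ M : ℕ, ∀ (d : ℕ), 0 < d → ∀ u : Fin d → ℂˣ,
      β * d ≤ (Finset.univ.filter fun i => u i = 1).card →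
      β * d ≤ (Finset.univ.filter fun i => ∀ k : ℕ, 1 ≤ k → k ≤ r → u i ^ k ≠ 1).card →
      ∀ n : ℕ, M ≤ n →
        ((Finset.univ.filter fun t : Fin n → Fin d => ∏ j, u (t j) = 1).card : ℝ) ≤
          (1 / (r + 1) + η) * d ^ n := by
  obtain ⟨M, hM⟩ := fin_group β hβ0 hβ r hr η hη
  refine ⟨M, ?_⟩
  intro d hd u h1 h2 n hn
  -- separating homomorphism to a power of `ℚ/ℤ`
  have hex : ∀ s : Fin d × Fin (r + 1), ∃ c : CharacterModule (Additive ℂˣ),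
      u s.1 ^ (s.2 : ℕ) ≠ 1 → c (Additive.ofMul (u s.1 ^ (s.2 : ℕ))) ≠ 0 := by
    intro s
    by_cases h : u s.1 ^ (s.2 : ℕ) = 1
    · exact ⟨0, fun h' => absurd h h'⟩
    · obtain ⟨c, hc⟩ := CharacterModule.exists_character_apply_ne_zero_of_ne_zero
        (a := Additive.ofMul (u s.1 ^ (s.2 : ℕ))) (fun h' => h (ofMul_eq_zero.1 h'))
      exact ⟨c, fun _ => hc⟩
  choose c hc using hex
  let P := Fin d × Fin (r + 1) → AddCircle (1 : ℚ)
  let φ : Additive ℂˣ →+ P := AddMonoidHom.mk' (fun x s => c s x) (by intro a b; ext s; exact map_add (c s) a b)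
  let Q := AddSubgroup.closure (Set.range fun i => φ (Additive.ofMul (u i)))
  have hfg : AddGroup.FG Q := by
    have : Finite (Set.range fun i => φ (Additive.ofMul (u i))) := inferInstance
    exact AddGroup.closure_finite_fg _
  have htor1 : ∀ x : AddCircle (1 : ℚ), IsOfFinAddOrder x := by
    intro x
    induction x using QuotientAddGroup.induction_on with
    | H x =>
      rw [isOfFinAddOrder_iff_nsmul_eq_zero]
      refine ⟨x.den, x.den_pos, ?_⟩
      change ((x.den • x : ℚ) : AddCircle (1 : ℚ)) = 0
      rw [AddCircle.coe_eq_zero_iff]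
      exact ⟨x.num, by simp⟩
  have htor : IsAddTorsion Q := by
    rintro ⟨x, hx⟩
    rw [isOfFinAddOrder_iff_nsmul_eq_zero]
    refine ⟨∏ s, addOrderOf (x s), Finset.prod_pos fun s _ => (htor1 (x s)).addOrderOf_pos, ?_⟩
    apply Subtype.ext
    funext s
    change (∏ s, addOrderOf (x s)) • x s = 0
    exact addOrderOf_dvd_iff_nsmul_eq_zero.1 (Finset.dvd_prod_of_mem _ (Finset.mem_univ s))
  have hfin : Finite Q := AddCommGroup.finite_of_fg_isAddTorsion _ htor
  have : Fintype Q := Fintype.ofFinite Q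
  let q : Fin d → Q := fun i => ⟨φ (Additive.ofMul (u i)), AddSubgroup.subset_closure ⟨i, rfl⟩⟩
  have hq : ∀ i, ((q i : Q) : P) = φ (Additive.ofMul (u i)) := fun i => rfl
  have := hM Q d hd q ?_ ?_ n hn
  · refine le_trans ?_ this
    gcongr with t
    intro ht
    apply Subtype.ext
    rw [AddSubgroup.val_finsetSum]
    simp only [hq]
    rw [← map_sum, ← ofMul_prod, ht]; simp
  · refine h1.trans ?_
    gcongr with i
    intro hi
    apply Subtype.ext
    rw [hq, hi]; simp
  · refine h2.trans ?_
    norm_cast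
    refine Finset.card_le_card (Finset.monotone_filter_right _ ?_)
    intro i _ hi k hk1 hkr h0
    have h0' := congrArg Subtype.val h0
    rw [AddSubgroup.coe_nsmul, hq, ← map_nsmul, ← ofMul_pow] at h0'
    exact hc (i, ⟨k, by omega⟩) (hi k hk1 hkr) (congrFun h0' (i, ⟨k, by omega⟩))

lemma exists_upper_basis (n : ℕ) : ∀ (V : Type) [AddCommGroup V] [Module ℂ V] [FiniteDimensional ℂ V]
    (f : Module.End ℂ V), Module.finrank ℂ V = n →
    ∃ b : Module.Basis (Fin n) ℂ V, ∀ j, f (b j) ∈ Submodule.span ℂ (Set.image b (Set.Iic j)) := by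
  induction n with
  | zero =>
    intro V _ _ _ f hV
    exact ⟨Module.finBasisOfFinrankEq ℂ V hV, fun j => j.elim0⟩
  | succ n ih =>
    intro V _ _ _ f hV
    have : Nontrivial V := Module.nontrivial_of_finrank_pos (R := ℂ) (by omega)
    obtain ⟨c, hc⟩ := Module.End.exists_eigenvalue f
    have hlt : LinearMap.range (f - c • (1 : Module.End ℂ V)) < ⊤ := by
      rw [lt_top_iff_ne_top]
      intro h
      have hinj := (LinearMap.injective_iff_surjective).2 (LinearMap.range_eq_top.1 h)
      obtain ⟨v, hv⟩ := hc.exists_hasEigenvector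
      apply hv.2
      apply hinj
      simp [hv.apply_eq_smul]
    obtain ⟨φ, hφ, hle⟩ := Submodule.exists_le_ker_of_lt_top _ hlt
    set N := LinearMap.ker φ with hN
    have hinv : ∀ x ∈ N, f x ∈ N := by
      intro x hx
      have h1 : (f - c • (1 : Module.End ℂ V)) x ∈ N := hle ⟨x, rfl⟩
      have : f x = (f - c • (1 : Module.End ℂ V)) x + c • x := by simp
      rw [this]
      exact N.add_mem h1 (N.smul_mem c hx)
    have hrank : Module.finrank ℂ N = n := by
      have h1 := LinearMap.finrank_range_add_finrank_ker φ
      have h2 : LinearMap.range φ = ⊤ := LinearMap.range_eq_top.2 (LinearMap.surjective hφ)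
      rw [h2, finrank_top, Module.finrank_self, hV] at h1
      rw [hN]; omega
    obtain ⟨b, hb⟩ := ih N (f.restrict hinv) hrank
    obtain ⟨y, hy⟩ := LinearMap.surjective hφ 1
    let b' := Module.Basis.mkFinSnoc b y
      (by
        intro a x hx h
        have := congrArg φ h
        rw [hN, LinearMap.mem_ker] at hx
        simpa [hx, hy] using this)
      (by
        intro z
        refine ⟨-φ z, ?_⟩
        rw [hN, LinearMap.mem_ker]
        simp [hy])
    have hb' : (b' : Fin (n + 1) → V) = Fin.snoc ((↑) ∘ b) y := Module.Basis.coe_mkFinSnoc _ _ _ _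
    refine ⟨b', ?_⟩
    intro j
    refine Fin.lastCases ?_ (fun j => ?_) j
    · have : Set.Iic (Fin.last n) = Set.univ := by ext i; simp [Fin.le_last]
      rw [this, Set.image_univ, b'.span_eq]
      trivial
    · have h1 : b' j.castSucc = (b j : V) := by rw [hb']; simp
      rw [h1]
      have h2 := Submodule.mem_map_of_mem (f := N.subtype) (hb j)
      rw [Submodule.map_span, ← Set.image_comp] at h2
      refine Submodule.span_mono ?_ h2
      rintro _ ⟨i, hi, rfl⟩
      refine ⟨i.castSucc, ?_, ?_⟩
      · simpa using hi
      · rw [hb']; simp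

lemma exists_upper {d : ℕ} (A : Matrix (Fin d) (Fin d) ℂ) :
    ∃ P T Q : Matrix (Fin d) (Fin d) ℂ, Q * P = 1 ∧ A = P * T * Q ∧ T.IsUpperTriangular := by
  obtain ⟨b, hb⟩ := exists_upper_basis d (Fin d → ℂ) (Matrix.toLin' A) (by simp)
  let e := Pi.basisFun ℂ (Fin d)
  refine ⟨e.toMatrix b, LinearMap.toMatrix b b (Matrix.toLin' A), b.toMatrix e, ?_, ?_, ?_⟩
  · exact b.toMatrix_mul_toMatrix_flip e
  · rw [basis_toMatrix_mul_linearMap_toMatrix_mul_basis_toMatrix]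
    exact (LinearMap.toMatrix'_toLin' A).symm
  · intro i j hij
    rw [LinearMap.toMatrix_apply]
    have h := b.mem_span_image.1 (hb j)
    by_contra hne
    have : i ∈ Set.Iic j := h (by simpa using hne)
    exact absurd hij (not_lt.2 this)

lemma kronPow_mul {d : ℕ} (A B : Matrix (Fin d) (Fin d) ℂ) (n : ℕ) :
    kronPow (A * B) n = kronPow A n * kronPow B n := by
  ext i j
  simp only [kronPow, Matrix.of_apply, Matrix.mul_apply]
  rw [Finset.prod_univ_sum]
  simp [Finset.prod_mul_distrib]

lemma kronPow_one {d : ℕ} (n : ℕ) :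
    kronPow (1 : Matrix (Fin d) (Fin d) ℂ) n = 1 := by
  ext i j
  simp only [kronPow, Matrix.of_apply, Matrix.one_apply]
  rw [Finset.prod_ite_zero]
  simp [funext_iff]

lemma charpoly_kronPow_upper {d : ℕ} (T : Matrix (Fin d) (Fin d) ℂ) (hT : T.IsUpperTriangular)
    (n : ℕ) : (kronPow T n).charpoly =
      ∏ t : Fin n → Fin d, (Polynomial.X - Polynomial.C (∏ j, T (t j) (t j))) := by
  let e : (Fin n → Fin d) ≃ Lex (Fin n → Fin d) := toLex
  rw [← Matrix.charpoly_reindex e, Matrix.charpoly_of_isUpperTriangular]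
  · rw [← e.prod_comp]
    rfl
  · intro i j hij
    change ∏ t, T (ofLex i t) (ofLex j t) = 0
    by_contra hne
    have hne := Finset.prod_ne_zero_iff.1 hne
    have hle : ofLex i ≤ ofLex j := by
      intro t
      by_contra hlt
      exact hne t (Finset.mem_univ t) (hT (not_le.1 hlt))
    exact absurd hij (not_lt.2 (Pi.toLex_monotone hle))

lemma exists_eigs {d : ℕ} (A : Matrix (Fin d) (Fin d) ℂ) :
    ∃ lam : Fin d → ℂ, A.charpoly = ∏ i, (Polynomial.X - Polynomial.C (lam i)) ∧ A.det = ∏ i, lam i ∧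
      ∀ n, (kronPow A n).charpoly =
        ∏ t : Fin n → Fin d, (Polynomial.X - Polynomial.C (∏ j, lam (t j))) := by
  obtain ⟨P, T, Q, hQP, rfl, hT⟩ := exists_upper A
  refine ⟨fun i => T i i, ?_, ?_, ?_⟩
  · rw [Matrix.charpoly_mul_comm, ← mul_assoc, hQP, one_mul, Matrix.charpoly_of_isUpperTriangular _ hT]
  · rw [Matrix.det_mul_comm, ← mul_assoc, hQP, one_mul, Matrix.det_of_isUpperTriangular hT]
  · intro n
    rw [kronPow_mul, kronPow_mul, Matrix.charpoly_mul_comm, ← mul_assoc, ← kronPow_mul, hQP,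
      kronPow_one, one_mul, charpoly_kronPow_upper T hT]

lemma roots_of_eq {ι : Type*} [Fintype ι] (p : Polynomial ℂ) (lam : ι → ℂ)
    (h : p = ∏ i, (Polynomial.X - Polynomial.C (lam i))) :
    p.roots = (Finset.univ : Finset ι).val.map lam := by
  rw [h, ← Polynomial.roots_multiset_prod_X_sub_C (Multiset.map lam _), Multiset.map_map]
  rfl

lemma m1_eq {ι : Type*} [Fintype ι] [DecidableEq ι] (A : Matrix ι ι ℂ) (lam : ι → ℂ)
    (h : A.charpoly = ∏ i, (Polynomial.X - Polynomial.C (lam i))) :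
    m1 A = ((Finset.univ.filter fun i => lam i = 1).card : ℝ) / Fintype.card ι := by
  rw [m1, ← Polynomial.count_roots, roots_of_eq _ _ h, Multiset.count_map]
  simp only [eq_comm (a := (1 : ℂ))]
  rfl

lemma mLe_eq {ι : Type*} [Fintype ι] [DecidableEq ι] (A : Matrix ι ι ℂ) (lam : ι → ℂ) (r : ℕ)
    (h : A.charpoly = ∏ i, (Polynomial.X - Polynomial.C (lam i))) :
    mLe A r = ((Finset.univ.filter fun i => ∃ k : ℕ, 1 ≤ k ∧ k ≤ r ∧ lam i ^ k = 1).card : ℝ)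
      / Fintype.card ι := by
  rw [mLe, roots_of_eq _ _ h, Multiset.filter_map, Multiset.card_map]
  rfl

lemma key_bound (β : ℝ) (hβ0 : 0 < β) (hβ : β < 1 / 2) (r : ℕ) (hr : 1 ≤ r)
    (η : ℝ) (hη : 0 < η) :
    ∃ M : ℕ, ∀ d : ℕ, 0 < d → ∀ A : GL (Fin d) ℂ,
      β ≤ m1 (A : Matrix (Fin d) (Fin d) ℂ) →
      mLe (A : Matrix (Fin d) (Fin d) ℂ) r ≤ 1 - β →
      ∀ n : ℕ, M ≤ n → m1 (kronPow (A : Matrix (Fin d) (Fin d) ℂ) n) ≤ 1 / (r + 1) + η := by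
  obtain ⟨M, hM⟩ := units_count β hβ0 hβ r hr η hη
  refine ⟨M, ?_⟩
  intro d hd A h1 h2 n hn
  have hd' : (0 : ℝ) < d := by exact_mod_cast hd
  obtain ⟨lam, hc, hdet, hk⟩ := exists_eigs (A : Matrix (Fin d) (Fin d) ℂ)
  have hne : ∀ i, lam i ≠ 0 := by
    have hdu : (A : Matrix (Fin d) (Fin d) ℂ).det ≠ 0 :=
      ((Matrix.isUnit_iff_isUnit_det _).1 A.isUnit).ne_zero
    rw [hdet, Finset.prod_ne_zero_iff] at hdu
    exact fun i => hdu i (Finset.mem_univ i)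
  let u : Fin d → ℂˣ := fun i => Units.mk0 (lam i) (hne i)
  have hu : ∀ i, (u i : ℂ) = lam i := fun i => rfl
  rw [m1_eq _ _ hc, Fintype.card_fin, le_div_iff₀ hd'] at h1
  rw [mLe_eq _ _ r hc, Fintype.card_fin, div_le_iff₀ hd'] at h2
  have e1 : (Finset.univ.filter fun i => lam i = 1) = Finset.univ.filter fun i => u i = 1 := by
    ext i; simp [Units.ext_iff, hu]
  have e2 : (Finset.univ.filter fun i => ∃ k : ℕ, 1 ≤ k ∧ k ≤ r ∧ lam i ^ k = 1)ᶜ =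
      Finset.univ.filter fun i => ∀ k : ℕ, 1 ≤ k → k ≤ r → u i ^ k ≠ 1 := by
    ext i; simp [Units.ext_iff, hu]
  have h3 := Finset.card_add_card_compl
    (Finset.univ.filter fun i => ∃ k : ℕ, 1 ≤ k ∧ k ≤ r ∧ lam i ^ k = 1)
  rw [e2, Fintype.card_fin] at h3
  have h3' := congrArg (Nat.cast (R := ℝ)) h3
  push_cast at h3'
  rw [e1] at h1
  have h4 := hM d hd u h1 (by linarith) n hn
  rw [m1_eq _ _ (hk n)]
  simp only [Fintype.card_pi, Fintype.card_fin, Finset.prod_const, Finset.card_univ, Nat.cast_pow]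
  rw [div_le_iff₀ (by positivity)]
  have e3 : (Finset.univ.filter fun t : Fin n → Fin d => ∏ j, lam (t j) = 1) =
      Finset.univ.filter fun t : Fin n → Fin d => ∏ j, u (t j) = 1 := by
    ext t; simp [Units.ext_iff, hu]
  rw [e3]
  exact h4

/-- For every `0 < β < 1/2`, integer `r ≥ 1` and `η > 0` there is `M = M(β,r,η)`
(independent of the matrix and its size) such that any `A ∈ GL_d(ℂ)` with
`β ≤ m₁(A) ≤ 1 - β` and `m^{≤r}(A) ≤ 1 - β` satisfies `m₁(A^{⊗n}) ≤ 1/r + η` for all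
`n ≥ M`. Moreover, under the first assumption alone, there is `M' = M'(β,η)` such that
`m₁(A^{⊗n}) ≤ 1/2 + η` for all `n ≥ M'`. -/
theorem m1_kronPow_small (β : ℝ) (hβ0 : 0 < β) (hβ : β < 1 / 2) (r : ℕ) (hr : 1 ≤ r)
    (η : ℝ) (hη : 0 < η) :
    (∃ M : ℕ, ∀ d : ℕ, 0 < d → ∀ A : GL (Fin d) ℂ,
      β ≤ m1 (A : Matrix (Fin d) (Fin d) ℂ) →
      m1 (A : Matrix (Fin d) (Fin d) ℂ) ≤ 1 - β →
      mLe (A : Matrix (Fin d) (Fin d) ℂ) r ≤ 1 - β →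
      ∀ n : ℕ, M ≤ n → m1 (kronPow (A : Matrix (Fin d) (Fin d) ℂ) n) ≤ 1 / r + η) ∧
    (∃ M' : ℕ, ∀ d : ℕ, 0 < d → ∀ A : GL (Fin d) ℂ,
      β ≤ m1 (A : Matrix (Fin d) (Fin d) ℂ) →
      m1 (A : Matrix (Fin d) (Fin d) ℂ) ≤ 1 - β →
      ∀ n : ℕ, M' ≤ n → m1 (kronPow (A : Matrix (Fin d) (Fin d) ℂ) n) ≤ 1 / 2 + η) := by
  refine ⟨?_, ?_⟩
  · obtain ⟨M, hM⟩ := key_bound β hβ0 hβ r hr η hη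
    refine ⟨M, fun d hd A h1 _ h2 n hn => (hM d hd A h1 h2 n hn).trans ?_⟩
    have hr' : (0 : ℝ) < r := by exact_mod_cast hr
    gcongr
    linarith
  · obtain ⟨M, hM⟩ := key_bound β hβ0 hβ 1 le_rfl η hη
    refine ⟨M, fun d hd A h1 h2 n hn => (hM d hd A h1 ?_ n hn).trans ?_⟩
    · obtain ⟨lam, hc, -, -⟩ := exists_eigs (A : Matrix (Fin d) (Fin d) ℂ)
      rw [m1_eq _ _ hc] at h2
      rw [mLe_eq _ _ 1 hc]
      refine le_trans (le_of_eq ?_) h2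
      congr 3
      ext i
      simp only [Finset.mem_filter, Finset.mem_univ, true_and]
      constructor
      · rintro ⟨k, hk1, hk2, h⟩
        obtain rfl : k = 1 := by omega
        simpa using h
      · intro h
        exact ⟨1, le_rfl, le_rfl, by simpa using h⟩
    · norm_num
end

section
/- For every γ > 0 and every η > 0, there exists N(γ, η) (independent of the matrix and its size) such that the following holds: for any d ≥ 1 and any A ∈ GL_d(ℂ) with j(A) ≤ 1 − γ, the sequence A₁ = A, A_m = A_{m−1} ⊗ A_{m−1} (Kronecker square) satisfies j(A_m) < η for every m > N(γ, η). -/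
open Matrix

/-- `j(B)`: the total number of Jordan blocks of `B`, i.e. the sum over the distinct
eigenvalues `μ` of `B` of the geometric multiplicity `dim ker (B - μ·Id)`, divided by
the size of the matrix. -/
noncomputable def jnum {ι : Type*} [Fintype ι] [DecidableEq ι] (A : Matrix ι ι ℂ) : ℝ :=
  (∑ μ ∈ A.charpoly.roots.toFinset,
    (Module.finrank ℂ (LinearMap.ker (Matrix.toLin' (A - μ • (1 : Matrix ι ι ℂ)))) : ℝ)) /
    (Fintype.card ι)

section partA
open MeasureTheory Filter Topology

noncomputable def cI (γ : ℝ) (k : ℕ) : ℝ :=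
  ∫ x : UnitAddCircle, (1 - γ + γ * |(fourier 1 x : ℂ).re|) ^ k

lemma abs_re_fourier_le (n : ℤ) (x : UnitAddCircle) : |(fourier n x : ℂ).re| ≤ 1 := by
  refine (Complex.abs_re_le_norm _).trans ?_
  rw [fourier_apply, Circle.norm_coe]

lemma cI_tendsto (γ : ℝ) (h0 : 0 < γ) (h1 : γ ≤ 1) : Tendsto (cI γ) atTop (𝓝 0) := by
  have key : Tendsto (fun k : ℕ => ∫ x : UnitAddCircle, (1 - γ + γ * |(fourier 1 x : ℂ).re|) ^ k)
      atTop (𝓝 (∫ x : UnitAddCircle, (0:ℝ))) := by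
    apply tendsto_integral_of_dominated_convergence (fun _ => (1:ℝ))
    · intro k
      apply Continuous.aestronglyMeasurable
      fun_prop
    · simp
    · intro k
      filter_upwards with x
      have := abs_re_fourier_le 1 x
      have h2 := abs_nonneg (fourier 1 x : ℂ).re
      rw [Real.norm_eq_abs, abs_pow]
      apply pow_le_one₀ (abs_nonneg _)
      rw [abs_le]; constructor <;> nlinarith
    · have hfin : Set.Finite {x : UnitAddCircle | |(fourier 1 x : ℂ).re| = 1} := by
        have : Set.Finite ((fun x : UnitAddCircle => AddCircle.toCircle x) ⁻¹' {1, -1}) := by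
          apply Set.Finite.preimage
          · exact (AddCircle.injective_toCircle one_ne_zero).injOn
          · simp
        refine this.subset ?_
        intro x hx
        simp only [Set.mem_ofPred_eq, fourier_one] at hx
        simp only [Set.mem_preimage, Set.mem_insert_iff, Set.mem_singleton_iff]
        have hn : (AddCircle.toCircle x : ℂ).re ^ 2 + (AddCircle.toCircle x : ℂ).im ^ 2 = 1 := by
          have := Circle.normSq_coe (AddCircle.toCircle x)
          rw [Complex.normSq_apply] at this
          linarith
        rcases (abs_eq (by norm_num)).1 hx with h | h
        · left
          apply Circle.ext
          apply Complex.ext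
          · simpa using h
          · rw [h] at hn; simp at hn; simpa using hn
        · right
          apply Circle.ext
          apply Complex.ext
          · simpa using h
          · rw [h] at hn; simp at hn; simpa using hn
      have hz : ∀ᵐ x : UnitAddCircle, x ∉ {x : UnitAddCircle | |(fourier 1 x : ℂ).re| = 1} := by
        rw [← MeasureTheory.measure_eq_zero_iff_ae_notMem]
        have : NullSingletonClass (volume : Measure UnitAddCircle) := by
          constructor
          intro x
          refine le_antisymm ?_ bot_le
          refine ENNReal.le_of_forall_pos_le_add fun ε hε _ => ?_
          calc volume {x} ≤ volume (Metric.closedBall x ((ε : ℝ) / 2)) :=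
                measure_mono (by simp; positivity)
            _ ≤ 0 + ε := by
              rw [AddCircle.volume_closedBall]
              rw [zero_add]
              refine ENNReal.ofReal_le_of_le_toReal ?_
              simp
              right
              linarith
        exact hfin.measure_zero _
      filter_upwards [hz] with x hx
      have h3 := lt_of_le_of_ne (abs_re_fourier_le 1 x) hx
      have h2 := abs_nonneg (fourier 1 x : ℂ).re
      apply tendsto_pow_atTop_nhds_zero_of_lt_one <;> nlinarith
  rw [integral_zero] at key
  exact key

lemma integral_fourier_uac (n : ℤ) : ∫ x : UnitAddCircle, (fourier n x : ℂ) = if n = 0 then 1 else 0 := by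
  split_ifs with h
  · subst h; simp [Measure.real, AddCircle.measure_univ]
  · exact integral_eq_zero_of_add_right_eq_neg (fourier_add_half_inv_index h one_pos)

lemma integral_comp_zsmul (g : UnitAddCircle → ℝ) (hg : Continuous g) (n : ℤ) (hn : n ≠ 0) :
    ∫ x : UnitAddCircle, g (n • x) = ∫ x : UnitAddCircle, g x := by
  have h := MeasureTheory.Measure.measurePreserving_zsmul (volume : Measure UnitAddCircle) hn
  conv_rhs => rw [← h.map_eq]
  rw [integral_map h.measurable.aemeasurable hg.aestronglyMeasurable]

lemma anticonc {I : Type*} [Fintype I] [DecidableEq I] [Nonempty I] (h : I → ℤ) (σ : I ≃ I)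
    (hσ : ∀ i, h (σ i) = - h i) (γ : ℝ) (h0 : 0 < γ) (h1 : γ ≤ 1)
    (hz : ((Finset.univ.filter fun i => h i = 0).card : ℝ) ≤ (1 - γ) * Fintype.card I)
    (s : ℤ) (k : ℕ) :
    ((Finset.univ.filter fun f : Fin k → I => ∑ t, h (f t) = s).card : ℝ)
      ≤ (Fintype.card I : ℝ) ^ k * cI γ k := by
  have hd : (0:ℝ) < Fintype.card I := by exact_mod_cast Fintype.card_pos
  set d : ℝ := (Fintype.card I : ℝ) with hdd
  set Z := Finset.univ.filter fun i => h i ≠ 0 with hZ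
  have hsplit : ((Finset.univ.filter fun i => h i = 0).card : ℝ) + Z.card = d := by
    rw [hdd, hZ, ← Nat.cast_add, Finset.card_filter_add_card_filter_not]; simp
  have hZpos : (0:ℝ) < Z.card := by nlinarith
  -- Fourier
  have e1 : ((Finset.univ.filter fun f : Fin k → I => ∑ t, h (f t) = s).card : ℂ)
      = ∫ x : UnitAddCircle, (fourier (-s) x : ℂ) * (∑ i, (fourier (h i) x : ℂ)) ^ k := by
    have : ∀ x : UnitAddCircle, (fourier (-s) x : ℂ) * (∑ i, (fourier (h i) x : ℂ)) ^ k
        = ∑ f : Fin k → I, (fourier (∑ t, h (f t) - s) x : ℂ) := by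
      intro x
      rw [← Fin.prod_const, Finset.prod_univ_sum, Fintype.piFinset_univ, Finset.mul_sum]
      refine Finset.sum_congr rfl fun f _ => ?_
      have hp : ∀ S : Finset (Fin k), (fourier (∑ t ∈ S, h (f t)) x : ℂ)
          = ∏ t ∈ S, (fourier (h (f t)) x : ℂ) := by
        intro S
        induction S using Finset.induction_on with
        | empty => simp
        | insert a S ha ih => rw [Finset.sum_insert ha, Finset.prod_insert ha, fourier_add, ih]
      rw [← hp, sub_eq_add_neg, fourier_add, mul_comm]
    simp_rw [this]
    rw [integral_finsetSum]
    · simp_rw [integral_fourier_uac, sub_eq_zero]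
      simp
    · intro f _
      exact (ContinuousMap.continuous _).integrable_of_hasCompactSupport (HasCompactSupport.of_compactSpace _)
  have hb : ∀ x : UnitAddCircle, ‖(fourier (-s) x : ℂ) * (∑ i, (fourier (h i) x : ℂ)) ^ k‖
      ≤ d ^ k * ((Z.card : ℝ)⁻¹ * ∑ i ∈ Z, (1 - γ + γ * |(fourier 1 (h i • x) : ℂ).re|) ^ k) := by
    intro x
    have n1 : ‖(fourier (-s) x : ℂ)‖ = 1 := by rw [fourier_apply, Circle.norm_coe]
    rw [norm_mul, n1, one_mul, norm_pow]
    have n2 : ‖∑ i, (fourier (h i) x : ℂ)‖ ≤ ∑ i, |(fourier (h i) x : ℂ).re| := by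
      have : ∑ i, (fourier (h i) x : ℂ) = ∑ i, ((fourier (h i) x : ℂ).re : ℂ) := by
        have a1 : ∑ i, (fourier (h i) x : ℂ) = ∑ i, (starRingEnd ℂ) (fourier (h i) x : ℂ) := by
          rw [← Equiv.sum_comp σ]
          simp_rw [hσ, fourier_neg]
        have a2 : ∀ i, ((fourier (h i) x : ℂ).re : ℂ)
          = ((fourier (h i) x : ℂ) + (starRingEnd ℂ) (fourier (h i) x : ℂ)) / 2 := fun i =>
            Complex.re_eq_add_conj _
        simp_rw [a2]
        rw [← Finset.sum_div, Finset.sum_add_distrib, ← a1]; ring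
      rw [this]
      refine (norm_sum_le _ _).trans (le_of_eq ?_)
      simp
    have n3 : ∑ i, |(fourier (h i) x : ℂ).re| ≤ d * ∑ i ∈ Z, (Z.card : ℝ)⁻¹ * (1 - γ + γ * |(fourier 1 (h i • x) : ℂ).re|) := by
      rw [← Finset.mul_sum, Finset.sum_add_distrib, ← Finset.mul_sum]
      have b1 : ∑ i, |(fourier (h i) x : ℂ).re| = ((Finset.univ.filter fun i => h i = 0).card : ℝ)
         + ∑ i ∈ Z, |(fourier 1 (h i • x) : ℂ).re| := by
        rw [← Finset.sum_filter_add_sum_filter_not Finset.univ (fun i => h i = 0)]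
        congr 1
        · rw [Finset.card_eq_sum_ones, Nat.cast_sum]
          refine Finset.sum_congr rfl fun i hi => ?_
          rw [(Finset.mem_filter.1 hi).2]; simp
        · simp [fourier_apply, hZ]
      rw [b1]
      have b2 : ∑ i ∈ Z, |(fourier 1 (h i • x) : ℂ).re| ≤ Z.card := by
        calc _ ≤ ∑ i ∈ Z, (1:ℝ) := Finset.sum_le_sum fun i _ => abs_re_fourier_le _ _
          _ = _ := by simp
      have b3 : 0 ≤ ∑ i ∈ Z, |(fourier 1 (h i • x) : ℂ).re| := Finset.sum_nonneg fun i _ => abs_nonneg _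
      set Q := ∑ i ∈ Z, |(fourier 1 (h i • x) : ℂ).re|
      set z := ((Finset.univ.filter fun i => h i = 0).card : ℝ)
      simp only [Finset.sum_const, nsmul_eq_mul]
      have : d * ((Z.card : ℝ)⁻¹ * ((Z.card:ℝ) * (1 - γ) + γ * Q)) = (d * (Z.card * (1-γ) + γ * Q)) / Z.card := by
        field_simp
      rw [this, le_div_iff₀ hZpos]
      nlinarith [mul_nonneg (sub_nonneg.2 b2) (sub_nonneg.2 hz)]
    calc _ ≤ (d * ∑ i ∈ Z, (Z.card : ℝ)⁻¹ * (1 - γ + γ * |(fourier 1 (h i • x) : ℂ).re|)) ^ k :=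
          pow_le_pow_left₀ (norm_nonneg _) (n2.trans n3) _
      _ ≤ _ := by
        rw [mul_pow]
        refine mul_le_mul_of_nonneg_left ?_ (by positivity)
        rw [Finset.mul_sum]
        apply Real.pow_arith_mean_le_arith_mean_pow
        · intros; positivity
        · simp; field_simp
        · intro i _; have := abs_nonneg (fourier 1 (h i • x) : ℂ).re; nlinarith
  have hcont : ∀ i, Continuous fun x : UnitAddCircle => (1 - γ + γ * |(fourier 1 (h i • x) : ℂ).re|) ^ k := by
    intro i; fun_prop
  have hIntg : ∀ i, Integrable fun x : UnitAddCircle => (1 - γ + γ * |(fourier 1 (h i • x) : ℂ).re|) ^ k :=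
    fun i => (hcont i).integrable_of_hasCompactSupport (HasCompactSupport.of_compactSpace _)
  calc ((Finset.univ.filter fun f : Fin k → I => ∑ t, h (f t) = s).card : ℝ)
      = ‖((Finset.univ.filter fun f : Fin k → I => ∑ t, h (f t) = s).card : ℂ)‖ := by simp
    _ ≤ ∫ x : UnitAddCircle, d ^ k * ((Z.card : ℝ)⁻¹ * ∑ i ∈ Z, (1 - γ + γ * |(fourier 1 (h i • x) : ℂ).re|) ^ k) := by
      rw [e1]
      apply norm_integral_le_of_norm_le _ (Filter.Eventually.of_forall hb)
      exact ((integrable_finsetSum _ fun i _ => hIntg i).const_mul _).const_mul _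
    _ = d ^ k * cI γ k := by
      rw [integral_const_mul, integral_const_mul, integral_finsetSum _ fun i _ => hIntg i]
      congr 1
      rw [Finset.sum_congr rfl (g := fun _ => cI γ k)]
      · simp; field_simp
      · intro i hi
        exact integral_comp_zsmul (fun x => (1 - γ + γ * |(fourier 1 x : ℂ).re|) ^ k) (by fun_prop) _ (Finset.mem_filter.1 hi).2

end partA

section partB
open Polynomial Module

/-- Basis of one block. -/
lemma block_basis (p : ℂ[X]) (hp : Irreducible p) (e : ℕ) :
    ∃ (lam : ℂ) (b : Basis (Fin e) ℂ (ℂ[X] ⧸ (Submodule.span ℂ[X] {p ^ e} : Submodule ℂ[X] ℂ[X]))),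
      ∀ j : Fin e, (X : ℂ[X]) • b j = lam • b j + (if h : (j : ℕ) + 1 < e then b ⟨j + 1, h⟩ else 0) := by
  obtain ⟨lam, hlam⟩ := IsAlgClosed.exists_root p (by
    have := hp.degree_pos; exact this.ne')
  have hdvd : (X - C lam) ∣ p := dvd_iff_isRoot.2 hlam
  have hass : Associated (X - C lam) p := (irreducible_X_sub_C lam).associated_of_dvd hp hdvd
  have hspan : (Submodule.span ℂ[X] {p ^ e} : Submodule ℂ[X] ℂ[X]) = Ideal.span {(X - C lam) ^ e} := by
    change Ideal.span _ = _
    exact Ideal.span_singleton_eq_span_singleton.2 (hass.pow_pow).symm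
  rw [hspan]
  refine ⟨lam, ?_⟩
  set g : ℂ[X] := (X - C lam) ^ e with hg
  have hmon : g.Monic := (monic_X_sub_C lam).pow e
  have hdeg : g.natDegree = e := by simp [hg]
  let v : Fin e → AdjoinRoot g := fun j => AdjoinRoot.mk g ((X - C lam) ^ (j : ℕ))
  set x : AdjoinRoot g := AdjoinRoot.mk g (X - C lam) with hx
  have hv : ∀ j, v j = x ^ (j : ℕ) := fun j => by simp [v, hx]
  have hli : LinearIndependent ℂ v := by
    have hle : e ≤ (minpoly ℂ x).natDegree := by
      have hIntg : IsIntegral ℂ x := by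
        refine ⟨X ^ e, monic_X_pow e, ?_⟩
        simp only [eval₂_pow, eval₂_X, hx]
        rw [← map_pow, AdjoinRoot.mk_self]
      have h1 : minpoly ℂ x ∣ X ^ e := by
        apply minpoly.dvd
        simp only [map_pow, aeval_X, hx]
        rw [← map_pow, AdjoinRoot.mk_self]
      obtain ⟨i, hi, hass⟩ := (dvd_prime_pow prime_X e).1 h1
      have h2 : minpoly ℂ x = X ^ i := eq_of_monic_of_associated (minpoly.monic hIntg) (monic_X_pow i) hass
      have h3 := minpoly.aeval ℂ x
      rw [h2] at h3 ⊢
      simp only [map_pow, aeval_X, hx] at h3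
      rw [← map_pow, AdjoinRoot.mk_eq_zero] at h3
      have := natDegree_le_of_dvd h3 (pow_ne_zero _ (X_sub_C_ne_zero lam))
      simpa [hg] using this
    have := (linearIndependent_pow (K := ℂ) x).comp (Fin.castLE hle) (Fin.castLE_injective hle)
    have hvv : v = (fun i : Fin (minpoly ℂ x).natDegree => x ^ (i : ℕ)) ∘ Fin.castLE hle := by
      ext j; simp [hv]
    rw [hvv]; exact this
  have hfin : finrank ℂ (AdjoinRoot g) = e := by
    rw [(AdjoinRoot.powerBasis' hmon).finrank]; simp [hdeg]
  have hxe : x ^ e = 0 := by rw [hx, ← map_pow, AdjoinRoot.mk_self]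
  rcases Nat.eq_zero_or_pos e with he | he
  · subst he
    have : Subsingleton (AdjoinRoot g) := by
      rw [AdjoinRoot]
      apply Ideal.Quotient.subsingleton_iff.2
      simp [hg]
    exact ⟨@Basis.empty (Fin 0) ℂ _ _ _ _ this _, fun j => j.elim0⟩
  have : Nonempty (Fin e) := ⟨⟨0, he⟩⟩
  let b := basisOfLinearIndependentOfCardEqFinrank hli (by simp [hfin])
  have hb : ∀ j, b j = x ^ (j : ℕ) := by intro j; simp [b, hv]
  refine ⟨b, fun j => ?_⟩
  have hX : ∀ y : ℂ[X] ⧸ Ideal.span {g}, (X : ℂ[X]) • y = lam • y + (show ℂ[X] ⧸ Ideal.span {g} from x * (show AdjoinRoot g from y)) := by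
    intro y
    obtain ⟨q, rfl⟩ := Ideal.Quotient.mk_surjective y
    change Ideal.Quotient.mk _ (X * q) = Ideal.Quotient.mk _ (lam • q) + Ideal.Quotient.mk _ ((X - C lam) * q)
    rw [← map_add]
    congr 1
    rw [smul_eq_C_mul]; ring
  refine (hX (b j)).trans ?_
  congr 1
  split_ifs with h
  · erw [hb, hb]; rw [pow_succ']
  · erw [hb]
    rw [← pow_succ', show (j:ℕ) + 1 = e by omega, hxe]
    rfl

lemma jordan_basis {d : ℕ} (A : Matrix (Fin d) (Fin d) ℂ) :
    ∃ (ι : Type) (_ : Fintype ι) (_ : DecidableEq ι) (n : ι → ℕ) (lam : ι → ℂ)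
      (b : Basis (Σ i, Fin (n i)) ℂ (Fin d → ℂ)),
      ∀ i (j : Fin (n i)), A.mulVec (b ⟨i, j⟩) = lam i • b ⟨i, j⟩ +
        (if h : (j : ℕ) + 1 < n i then b ⟨i, ⟨j + 1, h⟩⟩ else 0) := by
  classical
  set φ : Module.End ℂ (Fin d → ℂ) := Matrix.toLin' A with hφ
  have htors : Module.IsTorsion ℂ[X] (AEval' φ) := by
    intro m
    refine ⟨⟨minpoly ℂ φ, mem_nonZeroDivisors_of_ne_zero (minpoly.ne_zero (Algebra.IsIntegral.isIntegral φ))⟩, ?_⟩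
    obtain ⟨m, rfl⟩ := (AEval'.of φ).surjective m
    change minpoly ℂ φ • AEval'.of φ m = 0
    rw [← AEval.of_aeval_smul, minpoly.aeval]
    simp
  obtain ⟨ι, hι, p, hp, e, ⟨f⟩⟩ := Module.equiv_directSum_of_isTorsion htors
  choose lam b hb using fun i => block_basis (p i) (hp i) (e i)
  let B := DFinsupp.basis b
  let F : (Fin d → ℂ) ≃ₗ[ℂ] (DirectSum ι fun i => ℂ[X] ⧸ (Submodule.span ℂ[X] {p i ^ e i} : Submodule ℂ[X] ℂ[X])) :=
    (AEval'.of φ).trans (f.restrictScalars ℂ)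
  refine ⟨ι, hι, inferInstance, e, lam, B.map F.symm, fun i j => ?_⟩
  apply F.injective
  have hF : ∀ v, F (A.mulVec v) = (X : ℂ[X]) • F v := by
    intro v
    change f (AEval'.of φ (φ v)) = (X : ℂ[X]) • f (AEval'.of φ v)
    rw [← AEval'.X_smul_of, map_smul]
  rw [hF]
  have hB : ∀ i j, B ⟨i, j⟩ = DirectSum.lof ℂ[X] ι _ i (b i j) := by
    intro i j
    apply B.repr.injective
    rw [Basis.repr_self]
    ext ⟨i', j'⟩
    change _ = (b i').repr ((DFinsupp.single i (b i j) : Π₀ i, (ℂ[X] ⧸ (Submodule.span ℂ[X] {p i ^ e i} : Submodule ℂ[X] ℂ[X]))) i') j'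
    by_cases hii : i = i'
    · subst hii
      simp [Finsupp.single_apply]
    · rw [DFinsupp.single_eq_of_ne (Ne.symm hii)]
      simp [Finsupp.single_apply, hii]
  simp only [map_add, map_smul, Basis.map_apply, LinearEquiv.apply_symm_apply]
  rw [hB, ← map_smul, hb, map_add]
  congr 1
  · rw [← algebraMap_smul ℂ[X] (lam i) (b i j), map_smul, algebraMap_smul]
  · split_ifs with h
    · simp [hB]
    · simp

end partB

section normalform
open Matrix Module

/-- weight of a position in a Jordan chain -/
def wt {ι : Type} (n : ι → ℕ) (x : Σ i, Fin (n i)) : ℤ := 2 * (x.2 : ℤ) - ((n x.1 : ℤ) - 1)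

/-- successor relation -/
def sc {ι : Type} (n : ι → ℕ) (x y : Σ i, Fin (n i)) : Prop :=
  x.1 = y.1 ∧ (x.2 : ℕ) = (y.2 : ℕ) + 1

lemma sig_ext {ι : Type} {n : ι → ℕ} {x y : Σ i, Fin (n i)} (h1 : x.1 = y.1)
    (h2 : (x.2 : ℕ) = (y.2 : ℕ)) : x = y := by
  obtain ⟨i, j⟩ := x; obtain ⟨i', j'⟩ := y
  simp only at h1; subst h1
  simp only at h2
  rw [Fin.ext h2]

open Classical in
/-- the normalised raising operator -/
noncomputable def raise {ι : Type} (n : ι → ℕ) : Matrix (Σ i, Fin (n i)) (Σ i, Fin (n i)) ℂ :=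
  Matrix.of fun x y => if sc n x y then ((Real.sqrt ((x.2 : ℝ) * ((n x.1 : ℝ) - x.2)) : ℝ) : ℂ) else 0

lemma sqrt_mul_self_c (x : ℝ) (h : 0 ≤ x) : ((Real.sqrt x : ℝ) : ℂ) * ((Real.sqrt x : ℝ) : ℂ) = (x : ℂ) := by
  rw [← Complex.ofReal_mul, Real.mul_self_sqrt h]

lemma raise_comm {ι : Type} [Fintype ι] [DecidableEq ι] (n : ι → ℕ) :
    raise n * (raise n)ᴴ - (raise n)ᴴ * raise n = Matrix.diagonal fun x => ((wt n x : ℤ) : ℂ) := by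
  classical
  have hnn : ∀ x : (Σ i, Fin (n i)), 0 ≤ (x.2 : ℝ) * ((n x.1 : ℝ) - x.2) := by
    intro x
    have : ((x.2 : ℕ) : ℝ) ≤ n x.1 := by exact_mod_cast x.2.2.le
    have h0 : (0 : ℝ) ≤ ((x.2 : ℕ) : ℝ) := by positivity
    nlinarith
  have hstar : ∀ x y, star (raise n x y) = raise n x y := by
    intro x y
    simp only [raise, of_apply]
    split_ifs <;> simp
  have h1 : ∀ x z, (raise n * (raise n)ᴴ) x z
      = if x = z then (x.2 : ℂ) * ((n x.1 : ℂ) - x.2) else 0 := by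
    intro x z
    rw [Matrix.mul_apply]
    simp only [conjTranspose_apply, hstar]
    by_cases hx : (x.2 : ℕ) = 0
    · rw [Finset.sum_eq_zero]
      · split_ifs <;> simp [hx]
      · intro y _
        have : ¬ sc n x y := fun h => by have := h.2; omega
        simp [raise, this]
    · let y : Σ i, Fin (n i) := ⟨x.1, ⟨(x.2 : ℕ) - 1, by have := x.2.2; omega⟩⟩
      have hxy : sc n x y := ⟨rfl, by simp [y]; omega⟩
      rw [Finset.sum_eq_single y]
      · split_ifs with hxz
        · subst hxz
          simp only [raise, of_apply, hxy, if_true]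
          rw [sqrt_mul_self_c _ (hnn x)]; push_cast; ring
        · have : ¬ sc n z y := fun h => hxz (sig_ext (hxy.1.trans h.1.symm) (hxy.2.trans h.2.symm))
          simp [raise, this]
      · intro y' _ hy'
        have : ¬ sc n x y' := fun h => hy' (sig_ext (h.1.symm.trans hxy.1) (by have := h.2; have := hxy.2; omega))
        simp [raise, this]
      · simp
  have h2 : ∀ x z, ((raise n)ᴴ * raise n) x z
      = if x = z then ((x.2 : ℂ) + 1) * ((n x.1 : ℂ) - (x.2 + 1)) else 0 := by
    intro x z
    rw [Matrix.mul_apply]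
    simp only [conjTranspose_apply, hstar]
    by_cases hx : (x.2 : ℕ) + 1 = n x.1
    · rw [Finset.sum_eq_zero]
      · have hx' : (n x.1 : ℂ) = (x.2 : ℂ) + 1 := by exact_mod_cast hx.symm
        rw [hx']; simp
      · intro y _
        have : ¬ sc n y x := fun h => by
          have h3 := h.2; have h4 := y.2.2; have h5 : n y.1 = n x.1 := by rw [h.1]
          omega
        simp [raise, this]
    · let y : Σ i, Fin (n i) := ⟨x.1, ⟨(x.2 : ℕ) + 1, by have := x.2.2; omega⟩⟩
      have hxy : sc n y x := ⟨rfl, by simp [y]⟩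
      rw [Finset.sum_eq_single y]
      · split_ifs with hxz
        · subst hxz
          simp only [raise, of_apply, hxy, if_true]
          rw [sqrt_mul_self_c _ (hnn y)]; simp [y]
        · have : ¬ sc n y z := fun h => hxz (sig_ext (hxy.1.symm.trans h.1) (by have := h.2; have := hxy.2; omega))
          simp [raise, this]
      · intro y' _ hy'
        have : ¬ sc n y' x := fun h => hy' (sig_ext (h.1.trans hxy.1.symm) (by have := h.2; have := hxy.2; omega))
        simp [raise, this]
      · simp
  ext x z
  rw [Matrix.sub_apply, h1, h2, Matrix.diagonal_apply]
  split_ifs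
  · simp only [wt]; push_cast; ring
  · simp

/-- reflection of each chain -/
def chainRefl {ι : Type} (n : ι → ℕ) : (Σ i, Fin (n i)) ≃ (Σ i, Fin (n i)) :=
  Equiv.sigmaCongrRight fun _ => Fin.revPerm

lemma wt_refl {ι : Type} (n : ι → ℕ) (x) : wt n (chainRefl n x) = - wt n x := by
  obtain ⟨i, j⟩ := x
  change 2 * (((Fin.rev j : Fin (n i)) : ℕ) : ℤ) - ((n i : ℤ) - 1) = -(2 * ((j : ℕ) : ℤ) - ((n i : ℤ) - 1))
  rw [Fin.val_rev]
  have := j.2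
  push_cast [Nat.cast_sub (show (j:ℕ) + 1 ≤ n i by omega)]
  ring

lemma sigma_form {d : ℕ} (A : GL (Fin d) ℂ) :
    ∃ (I : Type) (_ : Fintype I) (_ : DecidableEq I) (b : Basis I ℂ (Fin d → ℂ))
      (lam : I → ℂ) (E : Matrix I I ℂ) (h : I → ℤ) (σ : I ≃ I),
      (∀ i, lam i ≠ 0) ∧ (∀ i j, E i j ≠ 0 → lam i = lam j ∧ h i = h j + 2) ∧
      (E * Eᴴ - Eᴴ * E = Matrix.diagonal fun i => ((h i : ℤ) : ℂ)) ∧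
      (∀ i, h (σ i) = - h i) ∧
      (∀ j, (A : Matrix (Fin d) (Fin d) ℂ).mulVec (b j) = ∑ l, (lam l * (1 + E) l j) • b l) ∧
      ((Finset.univ.filter fun i => h i = 0).card ≤
        ∑ μ ∈ (A : Matrix (Fin d) (Fin d) ℂ).charpoly.roots.toFinset,
          finrank ℂ (LinearMap.ker (Matrix.toLin' ((A : Matrix (Fin d) (Fin d) ℂ) - μ • (1 : Matrix (Fin d) (Fin d) ℂ))))) := by
  classical
  obtain ⟨ι, _, _, n, lam, b, hb⟩ := jordan_basis (A : Matrix (Fin d) (Fin d) ℂ)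
  -- last vector
  have hlastlt : ∀ x : (Σ i, Fin (n i)), n x.1 - 1 < n x.1 := fun x => by have := x.2.2; omega
  let last : (Σ i, Fin (n i)) → (Σ i, Fin (n i)) := fun x => ⟨x.1, ⟨n x.1 - 1, hlastlt x⟩⟩
  have hlast : ∀ x, (A : Matrix (Fin d) (Fin d) ℂ).mulVec (b (last x)) = lam x.1 • b (last x) := by
    intro x
    have := hb x.1 ⟨n x.1 - 1, hlastlt x⟩
    rw [dif_neg (by simp only; have := x.2.2; omega), add_zero] at this
    exact this
  have hlam : ∀ x : (Σ i, Fin (n i)), lam x.1 ≠ 0 := by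
    intro x h0
    have h1 := hlast x
    rw [h0, zero_smul] at h1
    have h2 : (↑(A⁻¹) : Matrix (Fin d) (Fin d) ℂ).mulVec ((A : Matrix (Fin d) (Fin d) ℂ).mulVec (b (last x))) = b (last x) := by
      rw [Matrix.mulVec_mulVec, ← Units.val_mul]; simp
    rw [h1, Matrix.mulVec_zero] at h2
    exact b.ne_zero _ h2.symm
  let c : ι → ℕ → ℂ := fun i l => ((Real.sqrt (((l + 1 : ℕ) : ℝ) * ((n i : ℝ) - (l + 1 : ℕ))) : ℝ) : ℂ)
  have hc : ∀ i l, l + 1 < n i → c i l ≠ 0 := by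
    intro i l hl
    simp only [c, ne_eq, Complex.ofReal_eq_zero]
    apply (Real.sqrt_pos.2 _).ne'
    have : (((l + 1 : ℕ)) : ℝ) < n i := by exact_mod_cast hl
    have h0 : (0 : ℝ) < ((l + 1 : ℕ) : ℝ) := by positivity
    exact mul_pos h0 (by linarith)
  let s : (Σ i, Fin (n i)) → ℂ := fun x => ∏ l ∈ Finset.range x.2, (lam x.1 * c x.1 l)⁻¹
  have hs : ∀ x, IsUnit (s x) := by
    intro x
    rw [isUnit_iff_ne_zero]
    apply Finset.prod_ne_zero_iff.2
    intro l hl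
    apply inv_ne_zero
    apply mul_ne_zero (hlam x)
    apply hc
    have := Finset.mem_range.1 hl; have := x.2.2; omega
  refine ⟨Σ i, Fin (n i), inferInstance, inferInstance, b.isUnitSMul hs, fun x => lam x.1, raise n,
    wt n, chainRefl n, hlam, ?_, raise_comm n, wt_refl n, ?_, ?_⟩
  · intro x y hxy
    have : sc n x y := by
      by_contra hcon; simp [raise, hcon] at hxy
    refine ⟨congrArg lam this.1, ?_⟩
    simp only [wt]
    have h5 : n x.1 = n y.1 := congrArg n this.1
    have h6 := this.2
    omega
  · intro y
    simp only [Basis.isUnitSMul_apply]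
    rw [Matrix.mulVec_smul]
    have h1 : ∑ l, (lam l.1 * (1 + raise n) l y) • s l • b l
       = lam y.1 • s y • b y + ∑ l, (lam l.1 * raise n l y) • s l • b l := by
      simp only [Matrix.add_apply, mul_add, add_smul, Finset.sum_add_distrib]
      congr 1
      rw [Finset.sum_eq_single y]
      · simp
      · intro x _ hx; simp [Matrix.one_apply_ne hx]
      · simp
    rw [h1]
    have h2 := hb y.1 y.2
    rw [show (⟨y.1, y.2⟩ : Σ i, Fin (n i)) = y from rfl] at h2
    rw [h2, smul_add, smul_comm]
    congr 1
    split_ifs with h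
    · set x : Σ i, Fin (n i) := ⟨y.1, ⟨y.2 + 1, h⟩⟩ with hx
      have hxy : sc n x y := ⟨rfl, rfl⟩
      rw [Finset.sum_eq_single x]
      · rw [smul_smul]
        congr 1
        have hsx : s x = s y * (lam y.1 * c y.1 y.2)⁻¹ := by
          simp only [s, hx]
          rw [Finset.prod_range_succ]
        have hr : raise n x y = c y.1 y.2 := by
          simp only [raise, of_apply, hxy, if_true, c]
          rfl
        rw [hsx, hr]
        have := hlam y
        have := hc y.1 y.2 h
        simp only [hx]
        field_simp
      · intro x' _ hx'
        have : ¬ sc n x' y := fun h => hx' (sig_ext (h.1.trans hxy.1.symm) (by have := h.2; have := hxy.2; omega))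
        simp [raise, this]
      · simp
    · rw [smul_zero, Finset.sum_eq_zero]
      intro x _
      have : ¬ sc n x y := fun h' => by
        have h3 := h'.2; have h4 := x.2.2; have h5 : n x.1 = n y.1 := by rw [h'.1]
        omega
      simp [raise, this]
  · set Z := Finset.univ.filter fun x => wt n x = 0 with hZ
    have hinj : ∀ x ∈ Z, ∀ y ∈ Z, last x = last y → x = y := by
      intro x hx y hy hxy
      have h1 : (last x).1 = (last y).1 := by rw [hxy]
      change x.1 = y.1 at h1
      have h2 := (Finset.mem_filter.1 hx).2
      have h3 := (Finset.mem_filter.1 hy).2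
      simp only [wt] at h2 h3
      have h5 : n x.1 = n y.1 := congrArg n h1
      exact sig_ext h1 (by omega)
    have hmem : ∀ x ∈ Z, lam x.1 ∈ (A : Matrix (Fin d) (Fin d) ℂ).charpoly.roots.toFinset := by
      intro x _
      rw [Multiset.mem_toFinset, Polynomial.mem_roots (Matrix.charpoly_monic _).ne_zero,
        ← Matrix.mem_spectrum_iff_isRoot_charpoly, ← Matrix.spectrum_toLin',
        ← Module.End.hasEigenvalue_iff_mem_spectrum]
      exact Module.End.hasEigenvalue_of_hasEigenvector
        (x := b (last x)) ⟨Module.End.mem_eigenspace_iff.2 (by simpa using hlast x), b.ne_zero _⟩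
    rw [Finset.card_eq_sum_card_fiberwise (f := fun x : (Σ i, Fin (n i)) => lam x.1) (by intro x hx; exact hmem x hx)]
    refine Finset.sum_le_sum fun μ _ => ?_
    set W := LinearMap.ker (Matrix.toLin' ((A : Matrix (Fin d) (Fin d) ℂ) - μ • (1 : Matrix (Fin d) (Fin d) ℂ))) with hW
    set S := Z.filter fun x => lam x.1 = μ with hS
    let v : S → W := fun x => ⟨b (last x.1), by
      rw [hW, LinearMap.mem_ker, Matrix.toLin'_apply, Matrix.sub_mulVec, hlast, (Finset.mem_filter.1 x.2).2,
        Matrix.smul_mulVec, Matrix.one_mulVec, sub_self]⟩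
    have hv : LinearIndependent ℂ v := by
      apply LinearIndependent.of_comp W.subtype
      refine b.linearIndependent.comp (fun x : S => last x.1) ?_
      intro x y hxy
      exact Subtype.ext (hinj _ (Finset.mem_filter.1 x.2).1 _ (Finset.mem_filter.1 y.2).1 hxy)
    simpa using hv.fintype_card_le_finrank

lemma normal_form {d : ℕ} (A : GL (Fin d) ℂ) :
    ∃ (P : GL (Fin d) ℂ)
      (lam : Fin d → ℂ) (E : Matrix (Fin d) (Fin d) ℂ) (h : Fin d → ℤ) (σ : Fin d ≃ Fin d),
      (∀ i, lam i ≠ 0) ∧ (∀ i j, E i j ≠ 0 → lam i = lam j ∧ h i = h j + 2) ∧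
      (E * Eᴴ - Eᴴ * E = Matrix.diagonal fun i => ((h i : ℤ) : ℂ)) ∧
      (∀ i, h (σ i) = - h i) ∧
      ((A : Matrix (Fin d) (Fin d) ℂ) * P = P * (Matrix.of fun i j => lam i * (1 + E) i j)) ∧
      ((Finset.univ.filter fun i => h i = 0).card ≤
        ∑ μ ∈ (A : Matrix (Fin d) (Fin d) ℂ).charpoly.roots.toFinset,
          finrank ℂ (LinearMap.ker (Matrix.toLin' ((A : Matrix (Fin d) (Fin d) ℂ) - μ • (1 : Matrix (Fin d) (Fin d) ℂ))))) := by
  classical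
  obtain ⟨I, _, _, b, lam, E, h, σ, h1, h2, h3, h4, h5, h6⟩ := sigma_form A
  let e : Fin d ≃ I := (Pi.basisFun ℂ (Fin d)).indexEquiv b
  let Q : Matrix (Fin d) (Fin d) ℂ := Matrix.of fun i j => b (e j) i
  have hQ : IsUnit Q := by
    rw [← Matrix.linearIndependent_cols_iff_isUnit]
    exact b.linearIndependent.comp e e.injective
  refine ⟨hQ.unit, lam ∘ e, E.submatrix e e, h ∘ e, (e.trans σ).trans e.symm, fun i => h1 _,
    fun i j => h2 _ _, ?_, ?_, ?_, ?_⟩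
  · rw [Matrix.conjTranspose_submatrix, Matrix.submatrix_mul_equiv, Matrix.submatrix_mul_equiv]
    have h7 : (E * Eᴴ - Eᴴ * E).submatrix e e = Matrix.diagonal fun i => (((h ∘ e) i : ℤ) : ℂ) := by
      rw [h3, Matrix.submatrix_diagonal_equiv]
      rfl
    exact h7
  · intro i; simp [h4]
  · rw [IsUnit.unit_spec]
    ext i j
    have := congrFun (h5 (e j)) i
    rw [← Equiv.sum_comp e] at this
    simp only [Matrix.mul_apply, Q, of_apply]
    simp only [Matrix.mulVec, dotProduct] at this
    rw [this, Finset.sum_apply]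
    refine Finset.sum_congr rfl fun l _ => ?_
    simp [Matrix.one_apply, mul_comm]
  · refine le_trans (le_of_eq ?_) h6
    apply Finset.card_bij (fun i _ => e i)
    · simp
    · intro a _ b _ hab; exact e.injective hab
    · intro y hy; exact ⟨e.symm y, by simpa using hy, by simp⟩
end normalform

section core
open Matrix Module

open scoped ComplexOrder in
lemma wt_inj {F : Type*} [Fintype F] [DecidableEq F] (w : F → ℤ) (M : Matrix F F ℂ)
    (hcomm : M * Mᴴ - Mᴴ * M = Matrix.diagonal fun f => ((w f : ℤ) : ℂ))
    (a : ℤ) (ha : a < 0) (v : F → ℂ) (hv : ∀ f, v f ≠ 0 → w f = a) (hM : M *ᵥ v = 0) : v = 0 := by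
  have h1 : (M * Mᴴ - Mᴴ * M) *ᵥ v = (a : ℂ) • v := by
    rw [hcomm]
    ext f
    rw [Matrix.mulVec_diagonal]
    by_cases hf : v f = 0
    · simp [hf]
    · simp [hv f hf]
  rw [Matrix.sub_mulVec, ← Matrix.mulVec_mulVec, ← Matrix.mulVec_mulVec, hM, Matrix.mulVec_zero,
    sub_zero] at h1
  have h2 : star (Mᴴ *ᵥ v) ⬝ᵥ (Mᴴ *ᵥ v) = (a : ℂ) * (star v ⬝ᵥ v) := by
    rw [Matrix.star_mulVec, Matrix.conjTranspose_conjTranspose, ← Matrix.dotProduct_mulVec, h1,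
      dotProduct_smul, smul_eq_mul]
  have h3 : 0 ≤ star (Mᴴ *ᵥ v) ⬝ᵥ (Mᴴ *ᵥ v) := dotProduct_star_self_nonneg _
  have h4 : 0 ≤ star v ⬝ᵥ v := dotProduct_star_self_nonneg _
  rw [h2] at h3
  have ha' : (a : ℂ) < 0 := by exact_mod_cast ha
  have h5 : star v ⬝ᵥ v = 0 := by
    have h6 : (a : ℂ) * (star v ⬝ᵥ v) ≤ 0 := mul_nonpos_of_nonpos_of_nonneg ha'.le h4
    have h7 := le_antisymm h6 h3
    exact (mul_eq_zero.1 h7).resolve_left ha'.ne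
  exact dotProduct_star_self_eq_zero.1 h5

lemma wt_triang {F : Type*} [Fintype F] [DecidableEq F] (w : F → ℤ) (E T : Matrix F F ℂ)
    (hE : ∀ f g, E f g ≠ 0 → w f = w g + 2)
    (hT : ∀ f g, T f g - E f g ≠ 0 → w g + 4 ≤ w f)
    (hcomm : E * Eᴴ - Eᴴ * E = Matrix.diagonal fun f => ((w f : ℤ) : ℂ))
    (c : ℤ) (hc : c ≤ 0) (v : F → ℂ) (hv : ∀ f, w f < c + 2 → (T *ᵥ v) f = 0) :
    ∀ f, w f < c → v f = 0 := by
  by_contra! hcon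
  obtain ⟨f1, hf1, hvf1⟩ := hcon
  obtain ⟨f0, hf0, hmin⟩ := Finset.exists_min_image (Finset.univ.filter fun f => w f < c ∧ v f ≠ 0) w
    ⟨f1, by simp [hf1, hvf1]⟩
  simp only [Finset.mem_filter, Finset.mem_univ, true_and] at hf0 hmin
  set a := w f0 with ha
  let v' : F → ℂ := fun f => if w f = a then v f else 0
  have hz : E *ᵥ v' = 0 := by
    ext f
    by_cases hf : w f = a + 2
    · have h1 := hv f (by omega)
      refine Eq.trans ?_ h1
      simp only [Matrix.mulVec, dotProduct]
      refine Finset.sum_congr rfl fun g _ => ?_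
      have hTE : a ≤ w g → T f g = E f g := by
        intro hg
        by_contra hne
        have := hT f g (sub_ne_zero.2 hne)
        omega
      rcases lt_trichotomy (w g) a with hg | hg | hg
      · have : v g = 0 := by
          by_contra hne
          have := hmin g ⟨by omega, hne⟩
          omega
        simp [v', this]
      · rw [hTE hg.ge]; simp [v', hg]
      · rw [hTE hg.le]
        have : E f g = 0 := by
          by_contra hne
          have := hE f g hne
          omega
        simp [this]
    · simp only [Matrix.mulVec, dotProduct, Pi.zero_apply]
      refine Finset.sum_eq_zero fun g _ => ?_
      by_cases hg : w g = a
      · have : E f g = 0 := by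
          by_contra hne
          have := hE f g hne
          omega
        simp [this]
      · simp [v', hg]
  have := wt_inj w E hcomm a (by omega) v' (by
    intro f hf; by_contra hne; simp [v', hne] at hf) hz
  have h0 := congrFun this f0
  simp [v', ← ha] at h0
  exact hf0.2 h0

lemma sum_subtype_zero {F : Type*} [Fintype F] (p : F → Prop) [DecidablePred p] (φ : F → ℂ)
    (h : ∀ g, ¬ p g → φ g = 0) : ∑ g : {g // p g}, φ g.1 = ∑ g, φ g := by
  rw [← Finset.sum_subtype (Finset.univ.filter p) (by simp) φ, Finset.sum_filter]
  refine Finset.sum_congr rfl fun g _ => ?_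
  by_cases hg : p g <;> simp [hg, h]

open scoped ComplexOrder in
lemma ker_bound {F : Type*} [Fintype F] [DecidableEq F] (w : F → ℤ) (E T : Matrix F F ℂ)
    (hE : ∀ f g, E f g ≠ 0 → w f = w g + 2)
    (hT : ∀ f g, T f g - E f g ≠ 0 → w g + 4 ≤ w f)
    (hcomm : E * Eᴴ - Eᴴ * E = Matrix.diagonal fun f => ((w f : ℤ) : ℂ)) :
    finrank ℂ (LinearMap.ker (Matrix.toLin' T)) ≤
      (Finset.univ.filter fun f => w f = 0).card + (Finset.univ.filter fun f => w f = 1).card := by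
  classical
  let M : Matrix {f // 2 ≤ w f} {f // 0 ≤ w f} ℂ := T.submatrix Subtype.val Subtype.val
  have hMinj : Function.Injective (Mᴴ).mulVecLin := by
    rw [← LinearMap.ker_eq_bot, LinearMap.ker_eq_bot']
    intro u hu
    let u' : F → ℂ := fun f => if hf : 2 ≤ w f then u ⟨f, hf⟩ else 0
    have key := wt_triang (fun f => - w f) Eᴴ Tᴴ (by
      intro f g hfg
      have := hE g f (by intro h0; simp [h0] at hfg)
      omega) (by
      intro f g hfg
      have := hT g f (by
        intro h0; apply hfg
        rw [conjTranspose_apply, conjTranspose_apply, ← star_sub, h0, star_zero])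
      omega) (by
      rw [conjTranspose_conjTranspose, ← neg_sub, hcomm, Matrix.diagonal_neg]
      simp) (-1) (by norm_num) u' (by
      intro f hf
      have hf' : 0 ≤ w f := by omega
      have := congrFun hu ⟨f, hf'⟩
      rw [Matrix.mulVecLin_apply] at this
      refine Eq.trans ?_ this
      simp only [Matrix.mulVec, dotProduct, conjTranspose_apply, M, submatrix_apply]
      rw [← sum_subtype_zero (fun g => 2 ≤ w g) (fun g => star (T g f) * u' g)
        (fun g hg => by simp [u', hg])]
      refine Finset.sum_congr rfl fun g _ => ?_
      simp [u', g.2])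
    ext ⟨f, hf⟩
    have := key f (by omega)
    simpa [u', hf] using this
  have hrank : M.rank = Fintype.card {f // 2 ≤ w f} := by
    rw [← Matrix.rank_conjTranspose, Matrix.rank, LinearMap.finrank_range_of_inj hMinj]
    simp
  have hker : finrank ℂ (LinearMap.ker M.mulVecLin) + Fintype.card {f // 2 ≤ w f}
      = Fintype.card {f // 0 ≤ w f} := by
    have := LinearMap.finrank_range_add_finrank_ker M.mulVecLin
    rw [← Matrix.rank, hrank] at this
    simp only [finrank_fintype_fun_eq_card] at this
    omega
  have hsup : ∀ v, T *ᵥ v = 0 → ∀ f, w f < 0 → v f = 0 := fun v hv =>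
    wt_triang w E T hE hT hcomm 0 le_rfl v (fun f _ => by rw [hv]; rfl)
  have hle : finrank ℂ (LinearMap.ker (Matrix.toLin' T)) ≤ finrank ℂ (LinearMap.ker M.mulVecLin) := by
    let ρ : LinearMap.ker (Matrix.toLin' T) →ₗ[ℂ] LinearMap.ker M.mulVecLin :=
      ((LinearMap.funLeft ℂ ℂ (Subtype.val : {f // 0 ≤ w f} → F)).domRestrict _).codRestrict _ (by
        rintro ⟨v, hv⟩
        rw [LinearMap.mem_ker, Matrix.toLin'_apply] at hv
        rw [LinearMap.mem_ker, Matrix.mulVecLin_apply]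
        ext ⟨f, hf⟩
        have := congrFun hv f
        refine Eq.trans ?_ this
        simp only [Matrix.mulVec, dotProduct, M, submatrix_apply, LinearMap.domRestrict_apply, LinearMap.funLeft_apply]
        exact sum_subtype_zero (fun g => 0 ≤ w g) (fun g => T f g * v g)
          (fun g hg => by simp [hsup v hv g (by omega)]))
    apply LinearMap.finrank_le_finrank_of_injective (f := ρ)
    rw [← LinearMap.ker_eq_bot, LinearMap.ker_eq_bot']
    rintro ⟨v, hv⟩ h0
    rw [LinearMap.mem_ker, Matrix.toLin'_apply] at hv
    apply Subtype.ext
    ext f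
    by_cases hf : w f < 0
    · exact hsup v hv f hf
    · exact congrFun (congrArg Subtype.val h0) ⟨f, by omega⟩
  have hcard : Fintype.card {f // 0 ≤ w f} = Fintype.card {f // 2 ≤ w f} +
      ((Finset.univ.filter fun f => w f = 0).card + (Finset.univ.filter fun f => w f = 1).card) := by
    rw [Fintype.card_subtype, Fintype.card_subtype, ← Finset.card_union_of_disjoint, ← Finset.card_union_of_disjoint]
    · congr 1; ext f; simp; omega
    · rw [Finset.disjoint_left]; intro f; simp; omega
    · rw [Finset.disjoint_left]; intro f; simp; omega
  omega

lemma sum_eig_le {F : Type*} [Fintype F] [DecidableEq F] (w : F → ℤ) (nu : F → ℂ) (hnu : ∀ f, nu f ≠ 0)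
    (U : Matrix F F ℂ) (hU : ∀ f g, U f g ≠ 0 → nu f = nu g)
    (hT : ∀ f g, (U - 1) f g ≠ 0 → w g < w f) (s : Finset ℂ) :
    ∑ μ ∈ s, finrank ℂ (LinearMap.ker (Matrix.toLin' ((Matrix.of fun f g => nu f * U f g) - μ • (1 : Matrix F F ℂ))))
      ≤ finrank ℂ (LinearMap.ker (Matrix.toLin' (U - 1))) := by
  classical
  set B : Matrix F F ℂ := Matrix.of fun f g => nu f * U f g with hB
  have hBv : ∀ v f, (B *ᵥ v) f = nu f * (U *ᵥ v) f := by
    intro v f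
    simp only [Matrix.mulVec, dotProduct, hB, of_apply, Finset.mul_sum, mul_assoc]
  have hsub : ∀ μ : ℂ, LinearMap.ker (Matrix.toLin' (B - μ • (1 : Matrix F F ℂ))) ≤ LinearMap.ker (Matrix.toLin' (U - 1)) := by
    intro μ v hv
    rw [LinearMap.mem_ker, Matrix.toLin'_apply, Matrix.sub_mulVec, Matrix.smul_mulVec, Matrix.one_mulVec, sub_eq_zero] at hv
    rw [LinearMap.mem_ker, Matrix.toLin'_apply, Matrix.sub_mulVec, Matrix.one_mulVec, sub_eq_zero]
    have hv' : ∀ f, nu f * (U *ᵥ v) f = μ * v f := fun f => by rw [← hBv, hv]; simp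
    have hsupp : ∀ f, nu f ≠ μ → v f = 0 := by
      by_contra! hcon
      obtain ⟨f1, hf1, hvf1⟩ := hcon
      obtain ⟨f0, hf0, hmin⟩ := Finset.exists_min_image (Finset.univ.filter fun f => nu f ≠ μ ∧ v f ≠ 0) w
        ⟨f1, by simp [hf1, hvf1]⟩
      simp only [Finset.mem_filter, Finset.mem_univ, true_and] at hf0 hmin
      have h1 : ((U - 1) *ᵥ v) f0 = 0 := by
        simp only [Matrix.mulVec, dotProduct]
        refine Finset.sum_eq_zero fun g _ => ?_
        by_contra hne
        have hne1 := left_ne_zero_of_mul hne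
        have hne2 := right_ne_zero_of_mul hne
        have hlt := hT f0 g hne1
        have hgf : f0 ≠ g := by rintro rfl; exact lt_irrefl _ hlt
        have : U f0 g ≠ 0 := by
          simpa [Matrix.sub_apply, Matrix.one_apply_ne hgf] using hne1
        have := hmin g ⟨by rw [← hU f0 g this]; exact hf0.1, hne2⟩
        omega
      rw [Matrix.sub_mulVec, Matrix.one_mulVec, Pi.sub_apply, sub_eq_zero] at h1
      have h2 := hv' f0
      rw [h1] at h2
      exact hf0.1 (mul_right_cancel₀ hf0.2 h2)
    ext f
    by_cases hf : nu f = μ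
    · have := hv' f
      rw [← hf] at this
      exact mul_left_cancel₀ (hnu f) this
    · rw [hsupp f hf]
      simp only [Matrix.mulVec, dotProduct]
      refine Finset.sum_eq_zero fun g _ => ?_
      by_contra hne
      have h1 := hU f g (left_ne_zero_of_mul hne)
      exact right_ne_zero_of_mul hne (hsupp g (by rwa [← h1]))
  have heq : ∀ μ : ℂ, LinearMap.ker (Matrix.toLin' (B - μ • (1 : Matrix F F ℂ))) = Module.End.eigenspace (Matrix.toLin' B) μ := by
    intro μ
    rw [Module.End.eigenspace_def]
    congr 1
    ext v; simp [Matrix.sub_mulVec, Matrix.smul_mulVec, Module.algebraMap_end_apply]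
  have hind : iSupIndep fun μ : s => LinearMap.ker (Matrix.toLin' (B - (μ : ℂ) • (1 : Matrix F F ℂ))) := by
    simp_rw [heq]
    exact (Module.End.eigenspaces_iSupIndep (Matrix.toLin' B)).comp Subtype.val_injective
  rw [← Finset.sum_coe_sort, ← Module.finrank_directSum]
  have hinj := hind.dfinsupp_lsum_injective
  let Φ := (DFinsupp.lsum ℕ fun μ : s => (LinearMap.ker (Matrix.toLin' (B - (μ : ℂ) • (1 : Matrix F F ℂ)))).subtype)
  refine LinearMap.finrank_le_finrank_of_injective (f := Φ.codRestrict (LinearMap.ker (Matrix.toLin' (U - 1))) ?_) ?_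
  · intro x
    have : Φ x ∈ ⨆ μ : s, LinearMap.ker (Matrix.toLin' (B - (μ : ℂ) • (1 : Matrix F F ℂ))) := by
      rw [Submodule.iSup_eq_range_dfinsupp_lsum]
      exact ⟨x, rfl⟩
    exact (iSup_le fun μ : s => hsub μ) this
  · intro x y hxy
    exact hinj (congrArg Subtype.val hxy)

end core

section tens
open Matrix Module

variable {I : Type*} [Fintype I] [DecidableEq I] {k : ℕ}

noncomputable def piT (M : Fin k → Matrix I I ℂ) : Matrix (Fin k → I) (Fin k → I) ℂ :=
  Matrix.of fun f g => ∏ t, M t (f t) (g t)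

lemma piT_mul (M N : Fin k → Matrix I I ℂ) : piT M * piT N = piT (M * N) := by
  ext f g
  simp only [piT, Matrix.mul_apply, of_apply, Pi.mul_apply]
  rw [Finset.prod_univ_sum, Fintype.piFinset_univ]
  simp only [Finset.prod_mul_distrib]

lemma prod_one_apply (f g : Fin k → I) : ∏ t, (1 : Matrix I I ℂ) (f t) (g t) = (1 : Matrix (Fin k → I) (Fin k → I) ℂ) f g := by
  by_cases h : f = g
  · subst h; simp
  · rw [Matrix.one_apply_ne h]
    obtain ⟨t, ht⟩ := Function.ne_iff.1 h
    exact Finset.prod_eq_zero (Finset.mem_univ t) (Matrix.one_apply_ne ht)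

noncomputable def opT (t : Fin k) (M : Matrix I I ℂ) : Matrix (Fin k → I) (Fin k → I) ℂ :=
  piT (Pi.mulSingle t M)

lemma opT_apply (t : Fin k) (M : Matrix I I ℂ) (f g : Fin k → I) :
    opT t M f g = M (f t) (g t) * ∏ s ∈ Finset.univ.erase t, (1 : Matrix I I ℂ) (f s) (g s) := by
  simp only [opT, piT, of_apply]
  rw [← Finset.mul_prod_erase _ _ (Finset.mem_univ t)]
  congr 1
  · simp
  · refine Finset.prod_congr rfl fun s hs => ?_
    rw [Pi.mulSingle_eq_of_ne (Finset.ne_of_mem_erase hs)]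

lemma opT_mul (t : Fin k) (M N : Matrix I I ℂ) : opT t M * opT t N = opT t (M * N) := by
  rw [opT, opT, opT, piT_mul, Pi.mulSingle_mul]

lemma opT_comm (s t : Fin k) (h : s ≠ t) (M N : Matrix I I ℂ) : opT s M * opT t N = opT t N * opT s M := by
  rw [opT, opT, piT_mul, piT_mul]
  rw [(Pi.mulSingle_commute (f := fun _ : Fin k => Matrix I I ℂ) h M N).eq]

lemma opT_sub (t : Fin k) (M N : Matrix I I ℂ) : opT t (M - N) = opT t M - opT t N := by
  ext f g
  simp only [Matrix.sub_apply, opT_apply, sub_mul]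

lemma opT_star (t : Fin k) (M : Matrix I I ℂ) : (opT t M)ᴴ = opT t Mᴴ := by
  ext f g
  rw [conjTranspose_apply, opT_apply, opT_apply, star_mul', conjTranspose_apply]
  congr 1
  rw [star_prod]
  refine Finset.prod_congr rfl fun s _ => ?_
  rw [← conjTranspose_apply, conjTranspose_one]

lemma opT_diag (t : Fin k) (h : I → ℂ) : opT t (Matrix.diagonal h) = Matrix.diagonal fun f => h (f t) := by
  ext f g
  rw [opT_apply]
  have : Matrix.diagonal h (f t) (g t) = h (f t) * (1 : Matrix I I ℂ) (f t) (g t) := by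
    simp [Matrix.diagonal_apply, Matrix.one_apply]
  rw [this, mul_assoc, Finset.mul_prod_erase Finset.univ (fun s => (1 : Matrix I I ℂ) (f s) (g s)) (Finset.mem_univ t),
    prod_one_apply]
  simp [Matrix.diagonal_apply, Matrix.one_apply]

lemma comm_tensor (E : Matrix I I ℂ) (h : I → ℤ)
    (hc : E * Eᴴ - Eᴴ * E = Matrix.diagonal fun i => ((h i : ℤ) : ℂ)) :
    (∑ t : Fin k, opT t E) * (∑ t : Fin k, opT t E)ᴴ - (∑ t : Fin k, opT t E)ᴴ * (∑ t : Fin k, opT t E)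
      = Matrix.diagonal fun f => ((∑ t, h (f t) : ℤ) : ℂ) := by
  rw [conjTranspose_sum]
  simp only [opT_star]
  rw [Finset.sum_mul_sum, Finset.sum_mul_sum, Finset.sum_comm (f := fun i j => opT i Eᴴ * opT j E),
    ← Finset.sum_sub_distrib]
  have : ∀ t : Fin k, (∑ s, opT t E * opT s Eᴴ - ∑ s, opT s Eᴴ * opT t E)
      = Matrix.diagonal fun f => ((h (f t) : ℤ) : ℂ) := by
    intro t
    rw [← Finset.sum_sub_distrib, Finset.sum_eq_single t]
    · rw [opT_mul, opT_mul, ← opT_sub, hc, opT_diag]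
    · intro s _ hs
      rw [opT_comm s t hs, sub_self]
    · simp
  simp only [this]
  ext f g
  rw [Matrix.sum_apply]
  by_cases hfg : f = g
  · subst hfg; simp
  · simp [Matrix.diagonal_apply_ne _ hfg]

lemma term_wt (E : Matrix I I ℂ) (h : I → ℤ) (hE : ∀ i j, E i j ≠ 0 → h i = h j + 2)
    (f g : Fin k → I) (S : Finset (Fin k))
    (hne : (∏ t ∈ S, E (f t) (g t)) * ∏ t ∈ Finset.univ \ S, (1 : Matrix I I ℂ) (f t) (g t) ≠ 0) :
    ∑ t, h (f t) = ∑ t, h (g t) + 2 * S.card := by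
  have h1 := Finset.prod_ne_zero_iff.1 (left_ne_zero_of_mul hne)
  have h2 := Finset.prod_ne_zero_iff.1 (right_ne_zero_of_mul hne)
  rw [← Finset.sum_sdiff (Finset.subset_univ S), ← Finset.sum_sdiff (Finset.subset_univ S) (f := fun t => h (g t))]
  have e1 : ∑ t ∈ Finset.univ \ S, h (f t) = ∑ t ∈ Finset.univ \ S, h (g t) := by
    refine Finset.sum_congr rfl fun t ht => ?_
    have : f t = g t := by
      by_contra hn
      exact h2 t ht (Matrix.one_apply_ne hn)
    rw [this]
  have e2 : ∑ t ∈ S, h (f t) = ∑ t ∈ S, (h (g t) + 2) :=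
    Finset.sum_congr rfl fun t ht => hE _ _ (h1 t ht)
  rw [e1, e2, Finset.sum_add_distrib]
  simp
  ring

lemma opT_term (E : Matrix I I ℂ) (f g : Fin k → I) (t : Fin k) :
    opT t E f g = (∏ t ∈ {t}, E (f t) (g t)) * ∏ s ∈ Finset.univ \ {t}, (1 : Matrix I I ℂ) (f s) (g s) := by
  rw [opT_apply, Finset.prod_singleton, Finset.erase_eq]

lemma opT_wt (E : Matrix I I ℂ) (h : I → ℤ) (hE : ∀ i j, E i j ≠ 0 → h i = h j + 2)
    (f g : Fin k → I) (hne : (∑ t : Fin k, opT t E) f g ≠ 0) :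
    ∑ t, h (f t) = ∑ t, h (g t) + 2 := by
  rw [Matrix.sum_apply] at hne
  obtain ⟨t, _, ht⟩ := Finset.exists_ne_zero_of_sum_ne_zero hne
  rw [opT_term] at ht
  have := term_wt E h hE f g _ ht
  simpa using this

lemma U_wt (E : Matrix I I ℂ) (h : I → ℤ) (hE : ∀ i j, E i j ≠ 0 → h i = h j + 2)
    (f g : Fin k → I) (hne : (piT (fun _ : Fin k => 1 + E) - 1) f g - (∑ t : Fin k, opT t E) f g ≠ 0) :
    ∑ t, h (g t) + 4 ≤ ∑ t, h (f t) := by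
  by_contra hcon
  apply hne
  let τ : Finset (Fin k) → ℂ := fun S =>
    (∏ t ∈ S, E (f t) (g t)) * ∏ t ∈ Finset.univ \ S, (1 : Matrix I I ℂ) (f t) (g t)
  have h1 : piT (fun _ : Fin k => 1 + E) f g = ∑ S ∈ (Finset.univ : Finset (Fin k)).powerset, τ S := by
    simp only [piT, of_apply]
    rw [add_comm]
    simp only [Matrix.add_apply]
    rw [Finset.prod_add]
  have h2 : ∑ S ∈ (Finset.univ : Finset (Fin k)).powerset, τ S
      = ∑ S ∈ insert ∅ (Finset.univ.image fun t : Fin k => ({t} : Finset (Fin k))), τ S := by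
    symm
    apply Finset.sum_subset
    · intro S _; simp
    · intro S _ hS
      by_contra hn
      have := term_wt E h hE f g S hn
      apply hS
      have hc : S.card ≤ 1 := by
        by_contra h'
        push Not at h'
        have : (2 : ℤ) ≤ S.card := by exact_mod_cast h'
        omega
      rcases Nat.le_one_iff_eq_zero_or_eq_one.1 hc with h0 | h0
      · simp [Finset.card_eq_zero.1 h0]
      · obtain ⟨t, rfl⟩ := Finset.card_eq_one.1 h0
        simp
  rw [Finset.sum_insert (by simp), Finset.sum_image (by intro a _ b _ hab; simpa using hab)] at h2
  have h3 : τ ∅ = (1 : Matrix (Fin k → I) (Fin k → I) ℂ) f g := by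
    simp only [τ]
    rw [Finset.prod_empty, one_mul, Finset.sdiff_empty, prod_one_apply]
  rw [Matrix.sub_apply, h1, h2, h3, Matrix.sum_apply]
  simp only [opT_term, τ]
  ring

lemma piT_bound (lam : I → ℂ) (hlam : ∀ i, lam i ≠ 0) (E : Matrix I I ℂ) (h : I → ℤ)
    (hE : ∀ i j, E i j ≠ 0 → lam i = lam j ∧ h i = h j + 2)
    (hc : E * Eᴴ - Eᴴ * E = Matrix.diagonal fun i => ((h i : ℤ) : ℂ)) (s : Finset ℂ) :
    ∑ μ ∈ s, finrank ℂ (LinearMap.ker (Matrix.toLin'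
      (piT (fun _ : Fin k => Matrix.of fun i j => lam i * (1 + E) i j) - μ • (1 : Matrix (Fin k → I) (Fin k → I) ℂ))))
      ≤ (Finset.univ.filter fun f : Fin k → I => ∑ t, h (f t) = 0).card
        + (Finset.univ.filter fun f : Fin k → I => ∑ t, h (f t) = 1).card := by
  have hE2 : ∀ i j, E i j ≠ 0 → h i = h j + 2 := fun i j hij => (hE i j hij).2
  have e : piT (fun _ : Fin k => Matrix.of fun i j => lam i * (1 + E) i j)
      = Matrix.of fun f g => (∏ t, lam (f t)) * piT (fun _ : Fin k => 1 + E) f g := by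
    ext f g
    simp only [piT, of_apply, Finset.prod_mul_distrib]
  rw [e]
  refine (sum_eig_le (fun f : Fin k → I => ∑ t, h (f t)) (fun f => ∏ t, lam (f t))
    (fun f => Finset.prod_ne_zero_iff.2 fun t _ => hlam _) (piT (fun _ : Fin k => 1 + E)) ?_ ?_ s).trans
    (ker_bound (fun f : Fin k → I => ∑ t, h (f t)) (∑ t : Fin k, opT t E) _ (opT_wt E h hE2)
      (U_wt E h hE2) (comm_tensor E h hc))
  · intro f g hne
    simp only [piT, of_apply] at hne
    have := Finset.prod_ne_zero_iff.1 hne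
    refine Finset.prod_congr rfl fun t ht => ?_
    have h1 := this t ht
    by_cases hfg : f t = g t
    · rw [hfg]
    · rw [Matrix.add_apply, Matrix.one_apply_ne hfg, zero_add] at h1
      exact (hE _ _ h1).1
  · intro f g hne
    by_cases h1 : (piT (fun _ : Fin k => 1 + E) - 1) f g - (∑ t : Fin k, opT t E) f g = 0
    · rw [sub_eq_zero.1 h1] at hne
      have := opT_wt E h hE2 f g hne
      show ∑ t, h (g t) < ∑ t, h (f t)
      omega
    · have := U_wt E h hE2 f g h1
      show ∑ t, h (g t) < ∑ t, h (f t)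
      omega

lemma ker_sim {F : Type*} [Fintype F] [DecidableEq F] (A B P Q : Matrix F F ℂ) (hPQ : P * Q = 1)
    (hAP : A * P = P * B) (μ : ℂ) :
    finrank ℂ (LinearMap.ker (Matrix.toLin' (A - μ • (1 : Matrix F F ℂ)))) ≤
    finrank ℂ (LinearMap.ker (Matrix.toLin' (B - μ • (1 : Matrix F F ℂ)))) := by
  have hQP : Q * P = 1 := mul_eq_one_comm.1 hPQ
  have hQA : B * Q = Q * A := by
    calc B * Q = (Q * P) * B * Q := by rw [hQP, one_mul]
      _ = Q * (P * B) * Q := by simp only [mul_assoc]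
      _ = Q * A * (P * Q) := by rw [← hAP]; simp only [mul_assoc]
      _ = Q * A := by rw [hPQ, mul_one]
  have hcomm : (B - μ • (1 : Matrix F F ℂ)) * Q = Q * (A - μ • (1 : Matrix F F ℂ)) := by
    rw [sub_mul, mul_sub, hQA]; simp
  let ρ : LinearMap.ker (Matrix.toLin' (A - μ • (1 : Matrix F F ℂ))) →ₗ[ℂ]
      LinearMap.ker (Matrix.toLin' (B - μ • (1 : Matrix F F ℂ))) :=
    ((Matrix.toLin' Q).domRestrict _).codRestrict _ (by
      rintro ⟨v, hv⟩
      rw [LinearMap.mem_ker, Matrix.toLin'_apply] at hv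
      rw [LinearMap.mem_ker, LinearMap.domRestrict_apply, Matrix.toLin'_apply, Matrix.toLin'_apply,
        Matrix.mulVec_mulVec, hcomm, ← Matrix.mulVec_mulVec, hv, Matrix.mulVec_zero])
  apply LinearMap.finrank_le_finrank_of_injective (f := ρ)
  intro x y hxy
  have h1 : Q *ᵥ x.1 = Q *ᵥ y.1 := congrArg Subtype.val hxy
  apply Subtype.ext
  have h2 := congrArg (fun z => P *ᵥ z) h1
  simpa [Matrix.mulVec_mulVec, hPQ] using h2

end tens

lemma kronPow_eq_piT {d : ℕ} (A : Matrix (Fin d) (Fin d) ℂ) (k : ℕ) : kronPow A k = piT (fun _ => A) := rfl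

lemma jnum_kronPow_le (γ : ℝ) (h0 : 0 < γ) (h1 : γ ≤ 1) (d : ℕ) (hd : 0 < d) (A : GL (Fin d) ℂ)
    (hA : jnum (A : Matrix (Fin d) (Fin d) ℂ) ≤ 1 - γ) (k : ℕ) :
    jnum (kronPow (A : Matrix (Fin d) (Fin d) ℂ) k) ≤ 2 * cI γ k := by
  obtain ⟨P, lam, E, h, σ, hlam, hE, hc, hσ, hAP, hcard⟩ := normal_form A
  haveI : Nonempty (Fin d) := ⟨⟨0, hd⟩⟩
  have hdR : (0 : ℝ) < d := by exact_mod_cast hd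
  have hz : ((Finset.univ.filter fun i => h i = 0).card : ℝ) ≤ (1 - γ) * Fintype.card (Fin d) := by
    rw [jnum, Fintype.card_fin, div_le_iff₀ hdR] at hA
    rw [Fintype.card_fin]
    refine le_trans ?_ hA
    exact_mod_cast hcard
  have b0 := anticonc h σ hσ γ h0 h1 hz 0 k
  have b1 := anticonc h σ hσ γ h0 h1 hz 1 k
  rw [jnum]
  have hcard2 : (Fintype.card (Fin k → Fin d) : ℝ) = (d : ℝ) ^ k := by simp
  rw [hcard2, div_le_iff₀ (by positivity)]
  rw [Fintype.card_fin] at b0 b1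
  set s := (kronPow (A : Matrix (Fin d) (Fin d) ℂ) k).charpoly.roots.toFinset
  have hb := piT_bound (k := k) lam hlam E h hE hc s
  have hsim : ∀ μ ∈ s, Module.finrank ℂ (LinearMap.ker (Matrix.toLin'
      (kronPow (A : Matrix (Fin d) (Fin d) ℂ) k - μ • (1 : Matrix (Fin k → Fin d) (Fin k → Fin d) ℂ)))) ≤
      Module.finrank ℂ (LinearMap.ker (Matrix.toLin'
      (piT (fun _ : Fin k => Matrix.of fun i j => lam i * (1 + E) i j)
        - μ • (1 : Matrix (Fin k → Fin d) (Fin k → Fin d) ℂ)))) := by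
    intro μ _
    apply ker_sim _ _ (piT fun _ : Fin k => (P : Matrix (Fin d) (Fin d) ℂ))
      (piT fun _ : Fin k => ((P⁻¹ : GL (Fin d) ℂ) : Matrix (Fin d) (Fin d) ℂ))
    · rw [piT_mul]
      ext f g
      rw [← prod_one_apply]
      simp only [piT, Matrix.of_apply, Pi.mul_apply]
      rw [← Units.val_mul, mul_inv_cancel, Units.val_one]
    · rw [kronPow_eq_piT, piT_mul, piT_mul]
      congr 1
      funext t
      exact hAP
  have hN := (Finset.sum_le_sum hsim).trans hb
  have hR : (∑ μ ∈ s, (Module.finrank ℂ (LinearMap.ker (Matrix.toLin'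
      (kronPow (A : Matrix (Fin d) (Fin d) ℂ) k - μ • (1 : Matrix (Fin k → Fin d) (Fin k → Fin d) ℂ)))) : ℝ))
      ≤ ((Finset.univ.filter fun f : Fin k → Fin d => ∑ t, h (f t) = 0).card : ℝ)
        + ((Finset.univ.filter fun f : Fin k → Fin d => ∑ t, h (f t) = 1).card : ℝ) := by
    exact_mod_cast hN
  linarith

/-- For every `γ > 0` and `η > 0` there is `N(γ,η)` (independent of the matrix and its
size) such that if `A ∈ GL_d(ℂ)` satisfies `j(A) ≤ 1 - γ`, then the iterated Kronecker
squares `A₁ = A`, `A_m = A_{m-1} ⊗ A_{m-1}` (so `A_m = A^{⊗2^{m-1}}`) satisfy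
`j(A_m) < η` for every `m > N(γ,η)`. -/
theorem jnum_iterated_kronecker_small (γ : ℝ) (hγ : 0 < γ) (η : ℝ) (hη : 0 < η) :
    ∃ N : ℕ, ∀ d : ℕ, 0 < d → ∀ A : GL (Fin d) ℂ,
      jnum (A : Matrix (Fin d) (Fin d) ℂ) ≤ 1 - γ →
      ∀ m : ℕ, N < m →
        jnum (kronPow (A : Matrix (Fin d) (Fin d) ℂ) (2 ^ (m - 1))) < η := by
  by_cases h1 : γ ≤ 1
  · have hev := (cI_tendsto γ hγ h1).eventually (gt_mem_nhds (half_pos hη))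
    obtain ⟨N, hN⟩ := Filter.eventually_atTop.1 hev
    refine ⟨N, fun d hd A hA m hm => ?_⟩
    have hk : N ≤ 2 ^ (m - 1) := by
      have := Nat.lt_two_pow_self (n := m - 1)
      omega
    have := jnum_kronPow_le γ hγ h1 d hd A hA (2 ^ (m - 1))
    have := hN _ hk
    linarith
  · refine ⟨0, fun d hd A hA => ?_⟩
    exfalso
    have : 0 ≤ jnum (A : Matrix (Fin d) (Fin d) ℂ) := by
      unfold jnum; positivity
    linarith
end

section
/- Let s, t ≥ 1 be integers and let α, β be nonzero complex numbers. Then the Kronecker product J(α, s) ⊗ J(β, t) of Jordan blocks is similar (conjugate in GL_{st}(ℂ)) to the block-diagonal matrix ⊕_{i=1}^{min(s,t)} J(αβ, s + t + 1 − 2i). -/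
open Matrix
open scoped Kronecker

/-- The `s × s` Jordan block with eigenvalue `α`: `α` on the diagonal, `1` directly
above the diagonal, `0` elsewhere. -/
noncomputable def jordanBlock (α : ℂ) (s : ℕ) : Matrix (Fin s) (Fin s) ℂ :=
  Matrix.of fun i j => if (j : ℕ) = (i : ℕ) then α else if (j : ℕ) = (i : ℕ) + 1 then 1 else 0

namespace JK

/-- Forward difference as a linear endomorphism. -/
noncomputable def dd (h : ℕ × ℕ) : Module.End ℂ (ℕ × ℕ → ℂ) where
  toFun := fwdDiff h
  map_add' := fwdDiff_add h
  map_smul' := fun r f => fwdDiff_const_smul h r f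

theorem dd_apply (h : ℕ × ℕ) (f : ℕ × ℕ → ℂ) (w : ℕ × ℕ) :
    dd h f w = f (w + h) - f w := rfl

theorem dd_pow (h : ℕ × ℕ) (n : ℕ) (f : ℕ × ℕ → ℂ) :
    (dd h ^ n) f = (fwdDiff h)^[n] f := by
  rw [Module.End.pow_apply]; rfl

theorem dd_comm (h k : ℕ × ℕ) : Commute (dd h) (dd k) := by
  refine LinearMap.ext fun f => funext fun w => ?_
  simp only [Module.End.mul_apply, dd_apply, add_right_comm w h k]
  ring

theorem dd_diag : dd (1, 1) = dd (1, 0) + dd (0, 1) + dd (1, 0) * dd (0, 1) := by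
  refine LinearMap.ext fun f => funext fun w => ?_
  have : w + (1, 0) + (0, 1) = w + (1, 1) := by simp [add_assoc]
  simp only [Module.End.mul_apply, LinearMap.add_apply, Pi.add_apply, dd_apply, this]
  ring

theorem dd_pow_poly (h : ℕ × ℕ) (f : ℕ × ℕ → ℂ) (w : ℕ × ℕ) (P : Polynomial ℂ)
    (hP : ∀ j : ℕ, f (w + j • h) = P.eval (j : ℂ)) (n : ℕ) :
    (dd h ^ n) f w = (fwdDiff (1 : ℂ))^[n] P.eval 0 := by
  rw [dd_pow, fwdDiff_iter_eq_sum_shift, fwdDiff_iter_eq_sum_shift]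
  refine Finset.sum_congr rfl fun k _ => ?_
  rw [hP]; simp

/-- The generator of the `i`-th chain. -/
noncomputable def gen (i a b : ℕ) : ℕ × ℕ → ℂ :=
  fun w => ((w.1 : ℂ) - w.2) ^ i * (w.1 : ℂ) ^ a * (w.2 : ℂ) ^ b

open Polynomial in
theorem gen_x (i a b n : ℕ) (hn : i + a < n) : (dd (1, 0) ^ n) (gen i a b) = 0 := by
  funext w
  rw [dd_pow_poly (1, 0) _ w
    ((X + C ((w.1 : ℂ) - w.2)) ^ i * (X + C (w.1 : ℂ)) ^ a * C ((w.2 : ℂ) ^ b))]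
  · rw [Polynomial.fwdDiff_iter_eq_zero_of_degree_lt]
    · rfl
    · refine lt_of_le_of_lt ?_ hn
      compute_degree
  · intro j; simp [gen]; left; ring

open Polynomial in
theorem gen_y (i a b n : ℕ) (hn : i + b < n) : (dd (0, 1) ^ n) (gen i a b) = 0 := by
  funext w
  rw [dd_pow_poly (0, 1) _ w
    ((C ((w.1 : ℂ) - w.2) - X) ^ i * C ((w.1 : ℂ) ^ a) * (X + C (w.2 : ℂ)) ^ b)]
  · rw [Polynomial.fwdDiff_iter_eq_zero_of_degree_lt]
    · rfl
    · refine lt_of_le_of_lt ?_ hn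
      compute_degree
  · intro j; simp [gen]; ring

open Polynomial in
theorem gen_diag_zero (i a b n : ℕ) (hn : a + b < n) : (dd (1, 1) ^ n) (gen i a b) = 0 := by
  funext w
  rw [dd_pow_poly (1, 1) _ w
    (C (((w.1 : ℂ) - w.2) ^ i) * (X + C (w.1 : ℂ)) ^ a * (X + C (w.2 : ℂ)) ^ b)]
  · rw [Polynomial.fwdDiff_iter_eq_zero_of_degree_lt]
    · rfl
    · refine lt_of_le_of_lt ?_ hn
      compute_degree
  · intro j; simp [gen]; ring

open Polynomial in
theorem gen_diag_top (i a b : ℕ) (w : ℕ × ℕ) : (dd (1, 1) ^ (a + b)) (gen i a b) w =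
    ((w.1 : ℂ) - w.2) ^ i * ((a + b).factorial : ℂ) := by
  have hm : ((X + C (w.1 : ℂ)) ^ a * (X + C (w.2 : ℂ)) ^ b).Monic :=
    ((monic_X_add_C _).pow a).mul ((monic_X_add_C _).pow b)
  have hd : ((X + C (w.1 : ℂ)) ^ a * (X + C (w.2 : ℂ)) ^ b).natDegree = a + b := by
    rw [((monic_X_add_C _).pow a).natDegree_mul ((monic_X_add_C _).pow b),
      natDegree_pow, natDegree_pow, natDegree_X_add_C, natDegree_X_add_C, mul_one, mul_one]
  have key := congrFun (Polynomial.fwdDiff_iter_degree_eq_factorial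
    ((X + C (w.1 : ℂ)) ^ a * (X + C (w.2 : ℂ)) ^ b)) 0
  rw [hd, hm.leadingCoeff] at key
  rw [dd_pow_poly (1, 1) _ w
    (C (((w.1 : ℂ) - w.2) ^ i) * ((X + C (w.1 : ℂ)) ^ a * (X + C (w.2 : ℂ)) ^ b))]
  · have : (Polynomial.eval · (C (((w.1 : ℂ) - w.2) ^ i) *
        ((X + C (w.1 : ℂ)) ^ a * (X + C (w.2 : ℂ)) ^ b))) =
        (((w.1 : ℂ) - w.2) ^ i) • 
          (Polynomial.eval · ((X + C (w.1 : ℂ)) ^ a * (X + C (w.2 : ℂ)) ^ b)) := by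
      funext z; simp
    erw [this]
    rw [fwdDiff_iter_const_smul, Pi.smul_apply]
    erw [key]
    simp
  · intro j; simp [gen]; ring

/-- Newton coefficients. -/
noncomputable def coef (α β : ℂ) (p q : ℕ) : (ℕ × ℕ → ℂ) →ₗ[ℂ] ℂ :=
  (α ^ p * β ^ q) • ((LinearMap.proj (0 : ℕ × ℕ)) ∘ₗ (dd (1, 0) ^ p * dd (0, 1) ^ q))

theorem coef_apply (α β : ℂ) (p q : ℕ) (f : ℕ × ℕ → ℂ) :
    coef α β p q f = α ^ p * β ^ q * (dd (1, 0) ^ p * dd (0, 1) ^ q) f 0 := rfl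

theorem coef_x (α β : ℂ) (s p q : ℕ) (f : ℕ × ℕ → ℂ) (hf : (dd (1, 0) ^ s) f = 0)
    (hp : s ≤ p) : coef α β p q f = 0 := by
  obtain ⟨k, rfl⟩ := Nat.exists_eq_add_of_le hp
  have : dd (1, 0) ^ (s + k) * dd (0, 1) ^ q = dd (1, 0) ^ k * dd (0, 1) ^ q * dd (1, 0) ^ s := by
    rw [mul_assoc, ← ((dd_comm (1, 0) (0, 1)).pow_pow s q).eq, ← mul_assoc, ← pow_add, add_comm]
  rw [coef_apply, this, Module.End.mul_apply, hf]; simp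

theorem coef_y (α β : ℂ) (t p q : ℕ) (f : ℕ × ℕ → ℂ) (hf : (dd (0, 1) ^ t) f = 0)
    (hq : t ≤ q) : coef α β p q f = 0 := by
  obtain ⟨k, rfl⟩ := Nat.exists_eq_add_of_le hq
  rw [coef_apply, add_comm t k, pow_add (dd (0, 1)), ← mul_assoc (dd (1, 0) ^ p), Module.End.mul_apply, hf]; simp

theorem coef_rel (α β : ℂ) (p q : ℕ) (f : ℕ × ℕ → ℂ) :
    α * β * coef α β p q f + α * coef α β p (q + 1) f +
      (β * coef α β (p + 1) q f + coef α β (p + 1) (q + 1) f) =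
    α * β * (coef α β p q f + coef α β p q (dd (1, 1) f)) := by
  have e1 : (dd (1, 0) ^ p * dd (0, 1) ^ q) (dd (1, 1) f) 0 =
      (dd (1, 0) ^ (p + 1) * dd (0, 1) ^ q) f 0 + (dd (1, 0) ^ p * dd (0, 1) ^ (q + 1)) f 0
       + (dd (1, 0) ^ (p + 1) * dd (0, 1) ^ (q + 1)) f 0 := by
    have : dd (1, 0) ^ p * dd (0, 1) ^ q * dd (1, 1) =
      dd (1, 0) ^ (p + 1) * dd (0, 1) ^ q + dd (1, 0) ^ p * dd (0, 1) ^ (q + 1)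
       + dd (1, 0) ^ (p + 1) * dd (0, 1) ^ (q + 1) := by
      have h2 : dd (0, 1) ^ q * dd (1, 0) = dd (1, 0) * dd (0, 1) ^ q :=
        ((dd_comm (0, 1) (1, 0)).pow_left q).eq
      rw [dd_diag, mul_add, mul_add, mul_assoc _ _ (dd (1, 0)), h2, ← mul_assoc, ← pow_succ,
        mul_assoc _ _ (dd (0, 1)), ← pow_succ, mul_assoc _ _ (dd (1, 0) * dd (0, 1)),
        ← mul_assoc (dd (0, 1) ^ q), h2, pow_succ _ p, pow_succ _ q]
      simp only [mul_assoc]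
    rw [← Module.End.mul_apply, this]; rfl
  simp only [coef_apply, e1]
  ring

theorem eq_zero_of_coef (α β : ℂ) (hα : α ≠ 0) (hβ : β ≠ 0) (f : ℕ × ℕ → ℂ)
    (h : ∀ p q, coef α β p q f = 0) : f = 0 := by
  have h' : ∀ p q, (dd (1, 0) ^ p) ((dd (0, 1) ^ q) f) 0 = 0 := fun p q => by
    have := h p q
    rw [coef_apply] at this
    simpa [hα, hβ] using this
  have h2 : ∀ q x : ℕ, (dd (0, 1) ^ q) f (x, 0) = 0 := fun q x => by
    have := shift_eq_sum_fwdDiff_iter (1, 0) ((dd (0, 1) ^ q) f) x 0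
    simp only [← dd_pow (1, 0), h'] at this
    simpa using this
  funext w
  have := shift_eq_sum_fwdDiff_iter (0, 1) f w.2 (w.1, 0)
  simp only [← dd_pow (0, 1), h2] at this
  simpa using this

theorem jordan_row (α : ℂ) (s : ℕ) (i : Fin s) (g : ℕ → ℂ) (hg : g s = 0) :
    ∑ j : Fin s, jordanBlock α s i j * g j = α * g i + g (i + 1) := by
  have : ∀ j : Fin s, jordanBlock α s i j * g j =
      (if j = i then α * g i else 0) + (if (j : ℕ) = i + 1 then g (i + 1) else 0) := by
    intro j
    simp only [jordanBlock, Matrix.of_apply, Fin.ext_iff]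
    split_ifs <;> first | omega | simp_all
  rw [Finset.sum_congr rfl fun j _ => this j, Finset.sum_add_distrib]
  congr 1
  · simp
  · by_cases h : (i : ℕ) + 1 < s
    · rw [Finset.sum_eq_single ⟨i + 1, h⟩]
      · simp
      · intro b _ hb
        rw [if_neg]; simpa [Fin.ext_iff] using hb
      · simp
    · have : (i : ℕ) + 1 = s := by omega
      rw [this, hg]; simp

theorem jordan_col (α : ℂ) (s : ℕ) (j : Fin s) (g : ℕ → ℂ) :
    ∑ i : Fin s, g i * jordanBlock α s i j =
      α * g j + (if (j : ℕ) = 0 then 0 else g (j - 1)) := by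
  have : ∀ i : Fin s, g i * jordanBlock α s i j =
      (if i = j then α * g j else 0) + (if (i : ℕ) + 1 = j then g (j - 1) else 0) := by
    intro i
    simp only [jordanBlock, Matrix.of_apply, Fin.ext_iff]
    rcases lt_trichotomy (i : ℕ) (j : ℕ) with h | h | h
    · rw [if_neg h.ne', if_neg h.ne]
      by_cases h' : (i : ℕ) + 1 = j
      · rw [if_pos h'.symm, if_pos h', mul_one, zero_add, ← h', Nat.add_sub_cancel]
      · rw [if_neg (Ne.symm h'), if_neg h', mul_zero, zero_add]
    · rw [if_pos h.symm, if_pos h, if_neg (by omega), h, add_zero, mul_comm]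
    · rw [if_neg (by omega), if_neg (by omega), if_neg (by omega), if_neg (by omega), mul_zero,
        zero_add]
  rw [Finset.sum_congr rfl fun j _ => this j, Finset.sum_add_distrib]
  congr 1
  · simp
  · by_cases h : (j : ℕ) = 0
    · simp [h]
    · rw [if_neg h, Finset.sum_eq_single ⟨j - 1, by omega⟩]
      · simp; omega
      · intro b _ hb
        rw [if_neg]; rw [Ne, Fin.ext_iff] at hb; simp at hb; omega
      · simp

theorem kron_coef (α β : ℂ) (s t : ℕ) (f : ℕ × ℕ → ℂ) (hx : (dd (1, 0) ^ s) f = 0)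
    (hy : (dd (0, 1) ^ t) f = 0) (p : Fin s) (q : Fin t) :
    ∑ r : Fin s × Fin t, (jordanBlock α s ⊗ₖ jordanBlock β t) (p, q) r * coef α β r.1 r.2 f =
      α * β * (coef α β p q f + coef α β p q (dd (1, 1) f)) := by
  rw [Fintype.sum_prod_type]
  have h1 : ∀ x : Fin s, ∑ y : Fin t,
      (jordanBlock α s ⊗ₖ jordanBlock β t) (p, q) (x, y) * coef α β x y f =
      jordanBlock α s p x * (β * coef α β x q f + coef α β x (q + 1) f) := by
    intro x
    rw [← jordan_row β t q (fun y => coef α β x y f) (coef_y _ _ t _ _ _ hy le_rfl),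
      Finset.mul_sum]
    refine Finset.sum_congr rfl fun y _ => ?_
    rw [Matrix.kroneckerMap_apply, mul_assoc]
  rw [Finset.sum_congr rfl fun x _ => h1 x,
    jordan_row α s p (fun x => β * coef α β x q f + coef α β x (q + 1) f)
      (by simp [coef_x _ _ s s _ _ hx le_rfl]), ← coef_rel]
  ring

/-- Element `j` of the `i`-th chain. -/
noncomputable def chain (γ : ℂ) (s t i j : ℕ) : ℕ × ℕ → ℂ :=
  (γ⁻¹) ^ j • (dd (1, 1) ^ (s + t - 1 - 2 * i - 1 - j)) (gen i (s - 1 - i) (t - 1 - i))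

theorem chain_x (γ : ℂ) (s t i j : ℕ) (hi : i < min s t) :
    (dd (1, 0) ^ s) (chain γ s t i j) = 0 := by
  rw [chain, map_smul, ← Module.End.mul_apply, ((dd_comm (1, 0) (1, 1)).pow_pow _ _).eq,
    Module.End.mul_apply, gen_x _ _ _ _ (by omega)]
  simp

theorem chain_y (γ : ℂ) (s t i j : ℕ) (hi : i < min s t) :
    (dd (0, 1) ^ t) (chain γ s t i j) = 0 := by
  rw [chain, map_smul, ← Module.End.mul_apply, ((dd_comm (0, 1) (1, 1)).pow_pow _ _).eq,
    Module.End.mul_apply, gen_y _ _ _ _ (by omega)]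
  simp

theorem chain_zero (γ : ℂ) (s t i j n : ℕ) (hi : i < min s t) (hj : j < n) :
    (dd (1, 1) ^ n) (chain γ s t i j) = 0 := by
  rw [chain, map_smul, ← Module.End.mul_apply, ← pow_add, gen_diag_zero _ _ _ _ (by omega)]
  simp

theorem chain_succ (γ : ℂ) (hγ : γ ≠ 0) (s t i j : ℕ) (hj : j + 1 < s + t - 1 - 2 * i) :
    γ • dd (1, 1) (chain γ s t i (j + 1)) = chain γ s t i j := by
  rw [chain, chain, map_smul, ← Module.End.mul_apply, ← pow_succ', smul_smul, pow_succ' _ j,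
    mul_inv_cancel_left₀ hγ]
  congr 3
  omega

theorem chain_top (γ : ℂ) (s t i j : ℕ) (hi : i < min s t) (hj : j < s + t - 1 - 2 * i)
    (w : ℕ × ℕ) : (dd (1, 1) ^ j) (chain γ s t i j) w =
      (γ⁻¹ ^ j * ((s - 1 - i + (t - 1 - i)).factorial : ℂ)) * ((w.1 : ℂ) - w.2) ^ i := by
  rw [chain, map_smul, ← Module.End.mul_apply, ← pow_add,
    show j + (s + t - 1 - 2 * i - 1 - j) = s - 1 - i + (t - 1 - i) by omega, Pi.smul_apply,
    gen_diag_top, smul_eq_mul]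
  ring

abbrev Idx (s t : ℕ) := (i : Fin (min s t)) × Fin (s + t - 1 - 2 * (i : ℕ))

theorem chain_indep (γ : ℂ) (hγ : γ ≠ 0) (s t : ℕ) (c : Idx s t → ℂ)
    (h : ∑ x : Idx s t, c x • chain γ s t x.1 x.2 = 0) : c = 0 := by
  have key : ∀ n : ℕ, (∀ x : Idx s t, n ≤ x.2 → c x = 0) → c = 0 := by
    intro n
    induction n with
    | zero => intro hc; funext x; exact hc x (Nat.zero_le _)
    | succ n ih =>
      intro hc
      apply ih
      have h1 : ∀ w : ℕ × ℕ, ∑ i : Fin (min s t),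
          (if hn : n < s + t - 1 - 2 * (i : ℕ) then c ⟨i, ⟨n, hn⟩⟩ *
            (γ⁻¹ ^ n * ((s - 1 - i + (t - 1 - i)).factorial : ℂ)) else 0) *
              ((w.1 : ℂ) - w.2) ^ (i : ℕ) = 0 := by
        intro w
        have h2 := congrFun (congrArg (dd (1, 1) ^ n) h) w
        rw [map_sum, map_zero, Finset.sum_apply, Fintype.sum_sigma] at h2
        refine Eq.trans ?_ h2
        refine Finset.sum_congr rfl fun i _ => ?_
        have h3 : ∀ j : Fin (s + t - 1 - 2 * (i : ℕ)), (j : ℕ) ≠ n →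
            (dd (1, 1) ^ n) (c ⟨i, j⟩ • chain γ s t i j) w = 0 := by
          intro j hj
          rcases lt_or_gt_of_ne hj with hj | hj
          · rw [map_smul, chain_zero _ _ _ _ _ _ i.2 hj]; simp
          · rw [hc ⟨i, j⟩ hj]; simp
        split_ifs with hn
        · rw [Finset.sum_eq_single ⟨n, hn⟩]
          · simp only [map_smul, Pi.smul_apply, smul_eq_mul]
            rw [chain_top _ _ _ _ _ i.2 hn]
            ring
          · intro j _ hj
            exact h3 j (by simpa [Fin.ext_iff] using hj)
          · simp
        · rw [Finset.sum_eq_zero]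
          · simp
          · intro j _
            exact h3 j (by have := j.2; omega)
      have h4 := Matrix.eq_zero_of_forall_index_sum_mul_pow_eq_zero
        (f := fun k : Fin (min s t) => ((k : ℕ) : ℂ))
        (fun a b hab => Fin.ext (Nat.cast_injective hab)) (fun k => by
          have := h1 (k, 0)
          simp only [Nat.cast_zero, sub_zero] at this
          exact this)
      rintro ⟨i, j⟩ hj
      rcases Nat.eq_or_lt_of_le hj with hj | hj
      · have h5 := congrFun h4 i
        simp only at hj
        have hn : n < s + t - 1 - 2 * (i : ℕ) := by have := j.2; omega
        simp only [hn, dif_pos, Pi.zero_apply] at h5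
        have h6 : j = ⟨n, hn⟩ := Fin.ext hj.symm
        rw [h6]
        rcases mul_eq_zero.1 h5 with h5 | h5
        · exact h5
        · exfalso
          have := Nat.factorial_ne_zero (s - 1 - i + (t - 1 - i))
          rcases mul_eq_zero.1 h5 with h5 | h5
          · exact pow_ne_zero _ (inv_ne_zero hγ) h5
          · exact this (by exact_mod_cast h5)
      · exact hc _ hj
  exact key (s + t) fun x hx => by have := x.2.2; omega

theorem card_sum (n k : ℕ) : ∑ i : Fin n, (2 * n + k - 1 - 2 * (i : ℕ)) = n * (n + k) := by
  induction n generalizing k with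
  | zero => simp
  | succ n ih =>
    rw [Fin.sum_univ_castSucc]
    have := ih (k + 2)
    simp only [Fin.val_castSucc, Fin.val_last]
    rw [show 2 * (n + 1) + k = 2 * n + (k + 2) by ring, this,
      show 2 * n + (k + 2) - 1 - 2 * n = k + 1 by omega]
    ring

theorem card_eq (s t : ℕ) : Fintype.card (Idx s t) = Fintype.card (Fin s × Fin t) := by
  simp only [Fintype.card_sigma, Fintype.card_fin, Fintype.card_prod]
  rcases le_total s t with h | h
  · obtain ⟨k, rfl⟩ := Nat.exists_eq_add_of_le h
    rw [← card_sum, min_eq_left h]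
    simp only [two_mul, add_assoc]
  · obtain ⟨k, rfl⟩ := Nat.exists_eq_add_of_le h
    rw [mul_comm, ← card_sum, min_eq_right h]
    refine Finset.sum_congr rfl fun i _ => ?_
    omega

/-- The transition matrix. -/
noncomputable def Q (α β : ℂ) (s t : ℕ) : Matrix (Fin s × Fin t) (Idx s t) ℂ :=
  Matrix.of fun r x => coef α β r.1 r.2 (chain (α * β) s t x.1 x.2)

theorem Q_rel (α β : ℂ) (hα : α ≠ 0) (hβ : β ≠ 0) (s t : ℕ) :
    (jordanBlock α s ⊗ₖ jordanBlock β t) * Q α β s t = Q α β s t *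
      Matrix.blockDiagonal' fun i : Fin (min s t) =>
            jordanBlock (α * β) (s + t - 1 - 2 * (i : ℕ)) := by
  ext ⟨p, q⟩ ⟨i, j⟩
  rw [Matrix.mul_apply, Matrix.mul_apply]
  simp only [Q, Matrix.of_apply]
  rw [kron_coef _ _ _ _ _ (chain_x _ _ _ _ _ i.2) (chain_y _ _ _ _ _ i.2), Fintype.sum_sigma,
    Finset.sum_eq_single i]
  · simp only [Matrix.blockDiagonal'_apply_eq]
    rw [jordan_col (α * β) _ j (fun j => coef α β p q (chain (α * β) s t i j)), mul_add]
    congr 1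
    split_ifs with h
    · have := chain_zero (α * β) s t i j 1 i.2 (by omega)
      rw [pow_one] at this
      rw [this]; simp
    · obtain ⟨k, hk⟩ := Nat.exists_eq_succ_of_ne_zero h
      have := chain_succ (α * β) (mul_ne_zero hα hβ) s t i k (by have := j.2; omega)
      rw [hk, Nat.succ_eq_add_one, Nat.add_sub_cancel, ← this, map_smul, smul_eq_mul]
  · intro i' _ hi'
    refine Finset.sum_eq_zero fun j' _ => ?_
    rw [Matrix.blockDiagonal'_apply_ne _ _ _ hi', mul_zero]
  · simp

theorem Q_inj (α β : ℂ) (hα : α ≠ 0) (hβ : β ≠ 0) (s t : ℕ) (c : Idx s t → ℂ)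
    (h : Q α β s t *ᵥ c = 0) : c = 0 := by
  apply chain_indep (α * β) (mul_ne_zero hα hβ) s t
  apply eq_zero_of_coef α β hα hβ
  intro p q
  rw [map_sum]
  by_cases hp : p < s
  · by_cases hq : q < t
    · have := congrFun h (⟨p, hp⟩, ⟨q, hq⟩)
      rw [Matrix.mulVec, dotProduct, Pi.zero_apply] at this
      rw [← this]
      refine Finset.sum_congr rfl fun x _ => ?_
      rw [map_smul, smul_eq_mul, mul_comm]; rfl
    · refine Finset.sum_eq_zero fun x _ => ?_
      rw [map_smul, coef_y _ _ t _ _ _ (chain_y _ _ _ _ _ x.1.2) (by omega), smul_zero]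
  · refine Finset.sum_eq_zero fun x _ => ?_
    rw [map_smul, coef_x _ _ s _ _ _ (chain_x _ _ _ _ _ x.1.2) (by omega), smul_zero]

end JK

/-- For `s, t ≥ 1` and nonzero `α, β ∈ ℂ`, the Kronecker product `J(α,s) ⊗ J(β,t)` of
Jordan blocks is similar to the block-diagonal matrix
`⊕_{i=1}^{min(s,t)} J(αβ, s + t + 1 - 2i)`. -/
theorem jordanBlock_kronecker (s t : ℕ) (hs : 1 ≤ s) (ht : 1 ≤ t)
    (α β : ℂ) (hα : α ≠ 0) (hβ : β ≠ 0) :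
    ∃ (e : ((i : Fin (min s t)) × Fin (s + t - 1 - 2 * (i : ℕ))) ≃ Fin s × Fin t)
      (P : GL (Fin s × Fin t) ℂ),
      (↑P⁻¹ : Matrix (Fin s × Fin t) (Fin s × Fin t) ℂ) *
          (jordanBlock α s ⊗ₖ jordanBlock β t) * (↑P : Matrix (Fin s × Fin t) (Fin s × Fin t) ℂ) =
        Matrix.reindex e e
          (Matrix.blockDiagonal' fun i : Fin (min s t) =>
            jordanBlock (α * β) (s + t - 1 - 2 * (i : ℕ))) := by
  let e : JK.Idx s t ≃ Fin s × Fin t := Fintype.equivOfCardEq (JK.card_eq s t)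
  have hu : IsUnit ((JK.Q α β s t).submatrix id e.symm) := by
    rw [← Matrix.mulVec_injective_iff_isUnit]
    rw [← Matrix.coe_mulVecLin, injective_iff_map_eq_zero]
    intro c hc
    have h1 : JK.Q α β s t *ᵥ (c ∘ e) = 0 := by
      rw [← hc, Matrix.mulVecLin_apply, Matrix.submatrix_mulVec_equiv]
      simp
    have h2 := JK.Q_inj α β hα hβ s t _ h1
    funext r
    simpa using congrFun h2 (e.symm r)
  obtain ⟨P, hP⟩ := hu
  refine ⟨e, P, ?_⟩
  rw [mul_assoc]
  apply (Units.inv_mul_eq_iff_eq_mul P).2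
  rw [hP, Matrix.reindex_apply, Matrix.submatrix_mul_equiv, ← JK.Q_rel α β hα hβ]
  ext r x
  simp [Matrix.mul_apply]
end

section
/- Let 0 ≤ ε ≤ 2 and let n ≥ 2 be an integer. For every real number θ with sin(θ) ≠ 0 and |cos(θ)| ≤ 1 − ε/2, one has |sin(nθ)/sin(θ)| ≤ n − ε. In particular, |sin(nθ)/sin(θ)| ≤ n holds for every real θ with sin(θ) ≠ 0. -/
theorem abs_sin_nat_mul_le (θ : ℝ) (n : ℕ) (hn : 2 ≤ n) :
    |Real.sin (n * θ)| ≤ (n - 2 + 2 * |Real.cos θ|) * |Real.sin θ| := by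
  induction n, hn using Nat.le_induction with
  | base =>
    push_cast
    rw [Real.sin_two_mul, abs_mul, abs_mul, abs_two]
    apply le_of_eq
    ring
  | succ k hk ih =>
    have e : ((k + 1 : ℕ) : ℝ) * θ = k * θ + θ := by push_cast; ring
    rw [e, Real.sin_add]
    have h1 := abs_add_le (Real.sin (k * θ) * Real.cos θ) (Real.cos (k * θ) * Real.sin θ)
    rw [abs_mul, abs_mul] at h1
    have h2 := mul_le_of_le_one_right (abs_nonneg (Real.sin (k * θ))) (Real.abs_cos_le_one θ)
    have h3 := mul_le_of_le_one_left (abs_nonneg (Real.sin θ)) (Real.abs_cos_le_one (k * θ))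
    push_cast
    linarith

/-- Let `0 ≤ ε ≤ 2` and `n ≥ 2`. For every real `θ` with `sin θ ≠ 0` and
`|cos θ| ≤ 1 - ε/2`, one has `|sin(nθ)/sin(θ)| ≤ n - ε`. In particular,
`|sin(nθ)/sin(θ)| ≤ n` for every real `θ` with `sin θ ≠ 0`. -/
theorem abs_sin_div_sin_le (ε : ℝ) (hε0 : 0 ≤ ε) (hε2 : ε ≤ 2) (n : ℕ) (hn : 2 ≤ n) :
    (∀ θ : ℝ, Real.sin θ ≠ 0 → |Real.cos θ| ≤ 1 - ε / 2 →
      |Real.sin (n * θ) / Real.sin θ| ≤ n - ε) ∧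
    (∀ θ : ℝ, Real.sin θ ≠ 0 → |Real.sin (n * θ) / Real.sin θ| ≤ n) := by
  constructor
  · intro θ hs hc
    rw [abs_div, div_le_iff₀ (abs_pos.mpr hs)]
    refine (abs_sin_nat_mul_le θ n hn).trans ?_
    exact mul_le_mul_of_nonneg_right (by linarith) (abs_nonneg _)
  · intro θ hs
    rw [abs_div, div_le_iff₀ (abs_pos.mpr hs)]
    refine (abs_sin_nat_mul_le θ n hn).trans ?_
    exact mul_le_mul_of_nonneg_right (by linarith [Real.abs_cos_le_one θ]) (abs_nonneg _)
end

section
/- Let G be a finite group, ε > 0, d ≥ 1, and let φ : G → GL_d(ℂ) be a map such that rank(φ(g)·φ(h) − φ(gh)) < ε·d for all g, h ∈ G. Then there exists a group homomorphism ψ : G → GL_d(ℂ) such that rank(φ(g) − ψ(g)) < |G|²·ε·d for every g ∈ G. -/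
open Matrix

lemma rank_stab_aux {ι : Type*} [Fintype ι] {d : ℕ} (A : ι → Matrix (Fin d) (Fin d) ℂ) :
    ∃ P : Matrix (Fin d) (Fin d) ℂ, (∀ i, A i * P = 0) ∧
      (∀ B : Matrix (Fin d) (Fin d) ℂ, (∀ i, A i * B = 0) → P * B = B) ∧
      (1 - P).rank ≤ ∑ i, (A i).rank := by
  let L : (Fin d → ℂ) →ₗ[ℂ] ((i : ι) → LinearMap.range (A i).mulVecLin) :=
    LinearMap.pi fun i => (A i).mulVecLin.rangeRestrict
  have hL : ∀ v, v ∈ LinearMap.ker L ↔ ∀ i, A i *ᵥ v = 0 := by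
    intro v
    rw [LinearMap.mem_ker, funext_iff]
    refine forall_congr' fun i => ?_
    rw [Subtype.ext_iff]
    rfl
  obtain ⟨p, hp⟩ := (LinearMap.ker L).subtype.exists_leftInverse_of_injective
    (LinearMap.ker L).ker_subtype
  let P := LinearMap.toMatrix' ((LinearMap.ker L).subtype ∘ₗ p)
  have hPv : ∀ v, P *ᵥ v = (p v : Fin d → ℂ) := fun v => by
    simp only [P, LinearMap.toMatrix'_mulVec]; rfl
  have hPk : ∀ v, v ∈ LinearMap.ker L → P *ᵥ v = v := by
    intro v hv
    rw [hPv]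
    exact congrArg Subtype.val (LinearMap.congr_fun hp ⟨v, hv⟩)
  refine ⟨P, ?_, ?_, ?_⟩
  · intro i
    apply Matrix.toLin'.injective
    ext1 v
    ext1
    simp only [LinearMap.comp_apply, Matrix.toLin'_apply, ← Matrix.mulVec_mulVec, hPv, map_zero,
      LinearMap.zero_apply]
    rw [(hL _).1 (p _).2 i]
  · intro B hB
    apply Matrix.toLin'.injective
    apply LinearMap.ext
    intro v
    simp only [Matrix.toLin'_apply, ← Matrix.mulVec_mulVec]
    apply hPk
    rw [hL]
    intro i
    rw [Matrix.mulVec_mulVec, hB, Matrix.zero_mulVec]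
  · have h1 := LinearMap.finrank_range_add_finrank_ker L
    have h2 := LinearMap.finrank_range_add_finrank_ker (1 - P).mulVecLin
    have h3 : LinearMap.ker L ≤ LinearMap.ker (1 - P).mulVecLin := by
      intro v hv
      rw [LinearMap.mem_ker, Matrix.mulVecLin_apply, Matrix.sub_mulVec, hPk v hv,
        Matrix.one_mulVec, sub_self]
    have h4 := Submodule.finrank_mono h3
    have h5 := Submodule.finrank_le (LinearMap.range L)
    rw [Module.finrank_pi_fintype] at h5
    simp only [Matrix.rank]
    omega



/-- Stability of finite groups in the normalized rank metric: if `G` is a finite group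
and `φ : G → GL_d(ℂ)` satisfies `rank(φ(g)φ(h) - φ(gh)) < ε·d` for all `g, h ∈ G`, then
there is a group homomorphism `ψ : G → GL_d(ℂ)` with `rank(φ(g) - ψ(g)) < |G|²·ε·d` for
every `g ∈ G`. -/
theorem finite_group_rank_stability (G : Type*) [Group G] [Fintype G]
    (ε : ℝ) (hε : 0 < ε) (d : ℕ) (hd : 0 < d) (φ : G → GL (Fin d) ℂ)
    (h : ∀ g h' : G,
      (((φ g : Matrix (Fin d) (Fin d) ℂ) * (φ h' : Matrix (Fin d) (Fin d) ℂ) -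
        (φ (g * h') : Matrix (Fin d) (Fin d) ℂ)).rank : ℝ) < ε * d) :
    ∃ ψ : G →* GL (Fin d) ℂ, ∀ g : G,
      (((φ g : Matrix (Fin d) (Fin d) ℂ) - (ψ g : Matrix (Fin d) (Fin d) ℂ)).rank : ℝ)
        < (Fintype.card G : ℝ) ^ 2 * ε * d := by
  classical
  obtain ⟨P, hP, hB, hr⟩ := rank_stab_aux (fun x : G × G =>
    (φ x.1 : Matrix (Fin d) (Fin d) ℂ) * (φ x.2 : Matrix (Fin d) (Fin d) ℂ) -
        (φ (x.1 * x.2) : Matrix (Fin d) (Fin d) ℂ))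
  have hmul : ∀ a b : G, (φ a : Matrix (Fin d) (Fin d) ℂ) * ((φ b).1 * P) = (φ (a * b)).1 * P := by
    intro a b
    have := hP (a, b)
    rw [sub_mul, sub_eq_zero, mul_assoc] at this
    exact this
  have hPP : P * P = P := hB P hP
  have hinv : ∀ k : G, P * ((φ k).1 * P) = (φ k).1 * P := by
    intro k
    apply hB
    rintro ⟨a, b⟩
    simp only [sub_mul, mul_assoc, hmul, sub_self]
  have hone : (φ 1).1 * P = P := by
    have h1 := hmul 1 1
    rw [mul_one] at h1
    exact (Units.mul_right_inj (φ 1)).1 h1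
  let f : G →* Matrix (Fin d) (Fin d) ℂ :=
    { toFun := fun g => (φ g).1 * P + (1 - P)
      map_one' := by rw [hone]; abel
      map_mul' := by
        intro a b
        have e : ((φ a).1 * P + (1 - P)) * ((φ b).1 * P + (1 - P)) =
          (φ a).1 * (P * ((φ b).1 * P)) + (φ a).1 * (P - P * P) +
            ((φ b).1 * P - P * ((φ b).1 * P)) + (1 - P - (P - P * P)) := by noncomm_ring
        rw [e, hinv, hmul, hPP]
        simp }
  refine ⟨f.toHomUnits, fun g => ?_⟩
  have e : (φ g).1 - (f.toHomUnits g).1 = ((φ g).1 - 1) * (1 - P) := by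
    change (φ g).1 - ((φ g).1 * P + (1 - P)) = _
    noncomm_ring
  have h1 : ((φ g).1 - (f.toHomUnits g).1).rank ≤ _ :=
    (e ▸ Matrix.rank_mul_le_right _ _).trans hr
  refine lt_of_le_of_lt (Nat.cast_le.2 h1) ?_
  rw [Nat.cast_sum]
  refine lt_of_lt_of_eq (Finset.sum_lt_sum_of_nonempty Finset.univ_nonempty
    (fun x _ => h x.1 x.2)) ?_
  simp only [Finset.sum_const, Finset.card_univ, Fintype.card_prod, nsmul_eq_mul]
  push_cast
  ring
end
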